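/- Let n ≥ 1 and let F_n(x,y,z) = f(x^n, y^n, z^n) where f(x,y,z) = x² + y² + z² + 2(xz − xy + yz), and let C̃_n = {[x:y:z] ∈ ℙ²(ℂ) : F_n(x,y,z) = 0}. Then the fundamental group π₁(ℙ²(ℂ) ∖ C̃_n) is isomorphic to the group presented by generators ε_{i,j} for i,j ∈ ℤ/nℤ subject to the relations: (i) ε_{i+2,j} = ε_{i+1,j}⁻¹ · ε_{i,j} · ε_{i+1,j} for all i,j ∈ ℤ/nℤ; (ii) ε_{i,j+2} = ε_{i,j+1}⁻¹ · ε_{i,j} · ε_{i,j+1} for all i,j ∈ ℤ/nℤ; (iii) the product ∏_{i=0}^{n−1} (ε_{i,i} · ε_{i,i+1}) = 1, i.e. ε_{0,0} · ε_{0,1} · ε_{1,1} · ε_{1,2} · ⋯ · ε_{n−1,n−1} · ε_{n−1,0} = 1 (indices mod n). -/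

import Mathlib

open MvPolynomial

noncomputable section

/-- The conic `f(x,y,z) = x² + y² + z² + 2(xz − xy + yz)`. -/
def fPoly : MvPolynomial (Fin 3) ℂ :=
  X 0 ^ 2 + X 1 ^ 2 + X 2 ^ 2 + 2 * (X 0 * X 2 - X 0 * X 1 + X 1 * X 2)

/-- `F_n(x,y,z) = f(xⁿ, yⁿ, zⁿ)`. -/
def Fn (n : ℕ) : MvPolynomial (Fin 3) ℂ :=
  bind₁ (fun i => X i ^ n) fPoly

instance : TopologicalSpace (Projectivization ℂ (Fin 3 → ℂ)) :=
  inferInstanceAs (TopologicalSpace (Quotient (projectivizationSetoid ℂ (Fin 3 → ℂ))))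

/-- The curve `C̃_n = {F_n = 0} ⊆ ℙ²(ℂ)`. -/
def curveCn (n : ℕ) : Set (Projectivization ℂ (Fin 3 → ℂ)) :=
  {p | eval p.rep (Fn n) = 0}

/-- The relators of the presentation of `π₁(ℙ² ∖ C̃_n)`:
`ε_{i+2,j} = ε_{i+1,j}⁻¹ ε_{i,j} ε_{i+1,j}`, `ε_{i,j+2} = ε_{i,j+1}⁻¹ ε_{i,j} ε_{i,j+1}` and
`ε_{0,0} ε_{0,1} ε_{1,1} ε_{1,2} ⋯ ε_{n−1,n−1} ε_{n−1,0} = 1`. -/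
def relsCn (n : ℕ) : Set (FreeGroup (ZMod n × ZMod n)) :=
  {r | (∃ i j : ZMod n, r = FreeGroup.of (i + 2, j) *
          ((FreeGroup.of (i + 1, j))⁻¹ * FreeGroup.of (i, j) * FreeGroup.of (i + 1, j))⁻¹) ∨
       (∃ i j : ZMod n, r = FreeGroup.of (i, j + 2) *
          ((FreeGroup.of (i, j + 1))⁻¹ * FreeGroup.of (i, j) * FreeGroup.of (i, j + 1))⁻¹) ∨
       r = ((List.range n).map (fun i =>
          FreeGroup.of ((i : ZMod n), (i : ZMod n)) *
          FreeGroup.of ((i : ZMod n), (i : ZMod n) + 1))).prod}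

section

open Topology Set
noncomputable section
namespace VK


variable {X : Type*} [TopologicalSpace X] {ι : Type*}

lemma homotopic_of_mem {s : Set X} (hs : IsSimplyConnected s) {p q : X} (γ₁ γ₂ : Path p q)
    (h₁ : ∀ t, γ₁ t ∈ s) (h₂ : ∀ t, γ₂ t ∈ s) : Path.Homotopic γ₁ γ₂ := by
  have hp : p ∈ s := by simpa using h₁ 0
  have hq : q ∈ s := by simpa using h₁ 1
  have : SimplyConnectedSpace s := hs
  let δ₁ : Path (⟨p, hp⟩ : s) ⟨q, hq⟩ :=
    { toFun := fun t => ⟨γ₁ t, h₁ t⟩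
      continuous_toFun := by fun_prop
      source' := by simp
      target' := by simp }
  let δ₂ : Path (⟨p, hp⟩ : s) ⟨q, hq⟩ :=
    { toFun := fun t => ⟨γ₂ t, h₂ t⟩
      continuous_toFun := by fun_prop
      source' := by simp
      target' := by simp }
  have h := (SimplyConnectedSpace.paths_homotopic δ₁ δ₂).map ⟨Subtype.val, continuous_subtype_val⟩
  exact h

/-- class of a path inside `s` -/
def inn {s : Set X} (hs : IsPathConnected s) {p q : X} (hp : p ∈ s) (hq : q ∈ s) : Path.Homotopic.Quotient p q :=
  Path.Homotopic.Quotient.mk (hs.joinedIn p hp q hq).somePath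

lemma mk_eq_inn {s : Set X} (hs : IsSimplyConnected s) {p q : X} (hp : p ∈ s) (hq : q ∈ s)
    (γ : Path p q) (h : ∀ t, γ t ∈ s) : Path.Homotopic.Quotient.mk γ = inn hs.isPathConnected hp hq :=
  Path.Homotopic.Quotient.eq.2 (homotopic_of_mem hs _ _ h (JoinedIn.somePath_mem _))

lemma inn_trans {s : Set X} (hs : IsSimplyConnected s) {p q r : X} (hp : p ∈ s) (hq : q ∈ s)
    (hr : r ∈ s) : (inn hs.isPathConnected hp hq).trans (inn hs.isPathConnected hq hr) =
      inn hs.isPathConnected hp hr := by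
  unfold inn
  rw [← Path.Homotopic.Quotient.mk_trans]
  refine mk_eq_inn hs hp hr _ fun t => ?_
  rw [Path.trans_apply]
  split_ifs <;> exact JoinedIn.somePath_mem _ _

lemma inn_self {s : Set X} (hs : IsSimplyConnected s) {p : X} (hp : p ∈ s) :
    inn hs.isPathConnected hp hp = Path.Homotopic.Quotient.refl p := by
  rw [← Path.Homotopic.Quotient.mk_refl]
  exact (mk_eq_inn hs hp hp _ (by simpa using hp)).symm

lemma inn_symm {s : Set X} (hs : IsSimplyConnected s) {p q : X} (hp : p ∈ s) (hq : q ∈ s) :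
    (inn hs.isPathConnected hp hq).symm = inn hs.isPathConnected hq hp := by
  rw [← Path.Homotopic.Quotient.refl_trans (inn hs.isPathConnected hp hq).symm, ← inn_self hs hq,
    ← inn_trans hs hq hp hq, Path.Homotopic.Quotient.trans_assoc, Path.Homotopic.Quotient.trans_symm, Path.Homotopic.Quotient.trans_refl]

variable {U : ι → Set X} (hU : ∀ a, IsSimplyConnected (U a)) (c : ι) (xb : ι → X)
  (hx1 : ∀ a, xb a ∈ U a) (hx2 : ∀ a, xb a ∈ U c)

/-- the class from the base point to `p` through `U a` -/
def tau (a : ι) {p : X} (hp : p ∈ U a) : Path.Homotopic.Quotient (xb c) p :=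
  (inn (hU c).isPathConnected (hx1 c) (hx2 a)).trans (inn (hU a).isPathConnected (hx1 a) hp)

lemma tau_trans (a : ι) {p q : X} (hp : p ∈ U a) (hq : q ∈ U a) :
    (tau hU c xb hx1 hx2 a hp).trans (inn (hU a).isPathConnected hp hq) =
      tau hU c xb hx1 hx2 a hq := by
  unfold tau
  rw [Path.Homotopic.Quotient.trans_assoc, inn_trans (hU a)]

lemma tau_base : tau hU c xb hx1 hx2 c (hx1 c) = Path.Homotopic.Quotient.refl _ := by
  unfold tau
  rw [inn_self (hU c), Path.Homotopic.Quotient.trans_refl]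

open Classical in
/-- transition elements -/
def hh (a b : ι) (p : X) : FundamentalGroup X (xb c) :=
  if h : p ∈ U a ∧ p ∈ U b then
    FundamentalGroup.fromPath ((tau hU c xb hx1 hx2 b h.2).trans
      (tau hU c xb hx1 hx2 a h.1).symm) else 1

lemma hh_eq {a b : ι} {p : X} (ha : p ∈ U a) (hb : p ∈ U b) :
    hh hU c xb hx1 hx2 a b p = FundamentalGroup.fromPath ((tau hU c xb hx1 hx2 b hb).trans
      (tau hU c xb hx1 hx2 a ha).symm) := dif_pos ⟨ha, hb⟩

lemma hh_mul {a b d : ι} {p : X} (ha : p ∈ U a) (hb : p ∈ U b) (hd : p ∈ U d) :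
    hh hU c xb hx1 hx2 a b p * hh hU c xb hx1 hx2 b d p = hh hU c xb hx1 hx2 a d p := by
  rw [hh_eq hU c xb hx1 hx2 ha hb, hh_eq hU c xb hx1 hx2 hb hd, hh_eq hU c xb hx1 hx2 ha hd]
  rw [FundamentalGroup.mul_def]
  unfold FundamentalGroup.fromPath FundamentalGroup.fromArrow
  rw [Path.Homotopic.Quotient.trans_assoc, ← Path.Homotopic.Quotient.trans_assoc _ _ (tau hU c xb hx1 hx2 a ha).symm,
    Path.Homotopic.Quotient.symm_trans, Path.Homotopic.Quotient.refl_trans]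

lemma hh_self {a : ι} {p : X} (ha : p ∈ U a) : hh hU c xb hx1 hx2 a a p = 1 := by
  exact mul_eq_left.1 (hh_mul hU c xb hx1 hx2 ha ha ha)

lemma hh_inv {a b : ι} {p : X} (ha : p ∈ U a) (hb : p ∈ U b) :
    (hh hU c xb hx1 hx2 a b p)⁻¹ = hh hU c xb hx1 hx2 b a p := by
  rw [inv_eq_iff_mul_eq_one, hh_mul hU c xb hx1 hx2 ha hb ha, hh_self hU c xb hx1 hx2 ha]

lemma hh_base (a : ι) : hh hU c xb hx1 hx2 c a (xb a) = 1 := by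
  rw [hh_eq hU c xb hx1 hx2 (hx2 a) (hx1 a), FundamentalGroup.one_def]
  unfold FundamentalGroup.fromPath FundamentalGroup.fromArrow tau
  rw [inn_self (hU a), Path.Homotopic.Quotient.trans_refl, inn_self (hU c), Path.Homotopic.Quotient.refl_trans,
    Path.Homotopic.Quotient.trans_symm]

lemma hh_joined {a b : ι} {p q : X} (h : JoinedIn (U a ∩ U b) p q) :
    hh hU c xb hx1 hx2 a b p = hh hU c xb hx1 hx2 a b q := by
  have hp := h.source_mem
  have hq := h.target_mem
  rw [hh_eq hU c xb hx1 hx2 hp.1 hp.2, hh_eq hU c xb hx1 hx2 hq.1 hq.2]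
  have h1 : inn (hU a).isPathConnected hp.1 hq.1 = inn (hU b).isPathConnected hp.2 hq.2 := by
    rw [← mk_eq_inn (hU a) hp.1 hq.1 h.somePath (fun t => (h.somePath_mem t).1),
      ← mk_eq_inn (hU b) hp.2 hq.2 h.somePath (fun t => (h.somePath_mem t).2)]
  rw [← tau_trans hU c xb hx1 hx2 b hp.2 hq.2, ← h1]
  have h2 : (inn (hU a).isPathConnected hp.1 hq.1).trans (tau hU c xb hx1 hx2 a hq.1).symm
      = (tau hU c xb hx1 hx2 a hp.1).symm := by
    have h3 := tau_trans hU c xb hx1 hx2 a hp.1 hq.1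
    set A := tau hU c xb hx1 hx2 a hp.1
    set B := tau hU c xb hx1 hx2 a hq.1
    set I := inn (hU a).isPathConnected hp.1 hq.1
    calc I.trans B.symm = (A.symm.trans A).trans (I.trans B.symm) := by
          rw [Path.Homotopic.Quotient.symm_trans, Path.Homotopic.Quotient.refl_trans]
      _ = A.symm.trans ((A.trans I).trans B.symm) := by simp only [Path.Homotopic.Quotient.trans_assoc]
      _ = A.symm := by rw [h3, Path.Homotopic.Quotient.trans_symm, Path.Homotopic.Quotient.trans_refl]
  congr 1
  rw [Path.Homotopic.Quotient.trans_assoc, h2]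

lemma subgroup_eq_top (hopen : ∀ a, IsOpen (U a)) (hcov : ∀ p, ∃ a, p ∈ U a)
    (H : Subgroup (FundamentalGroup X (xb c)))
    (hH : ∀ a b p, p ∈ U a → p ∈ U b → hh hU c xb hx1 hx2 a b p ∈ H) : H = ⊤ := by
  have key : ∀ {p q : X} (γ : Path p q) (hp : p ∈ U c) (hq : q ∈ U c),
      FundamentalGroup.fromPath (((tau hU c xb hx1 hx2 c hp).trans (Path.Homotopic.Quotient.mk γ)).trans
        (tau hU c xb hx1 hx2 c hq).symm) ∈ H := by
    intro p q γ hp hq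
    obtain ⟨t, t0, tm, ⟨N, tN⟩, hsub⟩ := exists_monotone_Icc_subset_open_cover_unitInterval
      (c := fun a => γ ⁻¹' (U a)) (fun a => (hopen a).preimage γ.continuous)
      (by intro s _; obtain ⟨a, ha⟩ := hcov (γ s); exact mem_iUnion.2 ⟨a, ha⟩)
    have hp0 : γ (t 0) ∈ U c := by rw [t0]; simpa using hp
    have step : ∀ m, ∀ a (ha : γ (t m) ∈ U a),
        FundamentalGroup.fromPath (((tau hU c xb hx1 hx2 c hp0).trans
          (Path.Homotopic.Quotient.mk (γ.subpath (t 0) (t m)))).trans (tau hU c xb hx1 hx2 a ha).symm) ∈ H := by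
      intro m
      induction m with
      | zero =>
        intro a ha
        rw [Path.subpath_self, Path.Homotopic.Quotient.mk_refl, Path.Homotopic.Quotient.trans_refl,
          ← hh_eq hU c xb hx1 hx2 ha hp0]
        exact hH a c _ ha hp0
      | succ m ih =>
        intro a ha
        obtain ⟨i, hi⟩ := hsub m
        have hm : γ (t m) ∈ U i := hi ⟨le_rfl, tm (Nat.le_succ m)⟩
        have hm1 : γ (t (m+1)) ∈ U i := hi ⟨tm (Nat.le_succ m), le_rfl⟩
        have e1 : Path.Homotopic.Quotient.mk (γ.subpath (t 0) (t (m+1))) =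
            (Path.Homotopic.Quotient.mk (γ.subpath (t 0) (t m))).trans
              (inn (hU i).isPathConnected hm hm1) := by
          rw [← mk_eq_inn (hU i) hm hm1 (γ.subpath (t m) (t (m+1))), ← Path.Homotopic.Quotient.mk_trans]
          · exact (Path.Homotopic.Quotient.eq.2 ⟨Path.Homotopy.subpathTransSubpath γ _ _ _⟩).symm
          · intro s
            have : γ.subpath (t m) (t (m+1)) s ∈ range (γ.subpath (t m) (t (m+1))) :=
              mem_range_self s
            rw [Path.range_subpath_of_le _ _ _ (tm (Nat.le_succ m))] at this
            obtain ⟨r, hr, hr'⟩ := this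
            rw [← hr']
            exact hi hr
        have e2 := H.mul_mem (hH a i _ ha hm1) (ih i hm)
        rw [hh_eq hU c xb hx1 hx2 ha hm1, FundamentalGroup.mul_def] at e2
        convert e2 using 1
        unfold FundamentalGroup.fromPath FundamentalGroup.fromArrow
        rw [e1, ← tau_trans hU c xb hx1 hx2 i hm hm1]
        simp only [Path.Homotopic.Quotient.trans_assoc]
        congr 2
        rw [← Path.Homotopic.Quotient.trans_assoc (tau hU c xb hx1 hx2 i hm).symm, Path.Homotopic.Quotient.symm_trans,
          Path.Homotopic.Quotient.refl_trans]
    have fin := step N c (by rw [tN N le_rfl]; simpa using hq)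
    have aux : ∀ {s0 s1 : unitInterval} (h0 : s0 = 0) (h1 : s1 = 1) (hs0 : γ s0 ∈ U c)
        (hs1 : γ s1 ∈ U c), FundamentalGroup.fromPath (((tau hU c xb hx1 hx2 c hs0).trans
          (Path.Homotopic.Quotient.mk (γ.subpath s0 s1))).trans (tau hU c xb hx1 hx2 c hs1).symm) ∈ H →
          FundamentalGroup.fromPath (((tau hU c xb hx1 hx2 c hp).trans (Path.Homotopic.Quotient.mk γ)).trans
        (tau hU c xb hx1 hx2 c hq).symm) ∈ H := by
      rintro s0 s1 rfl rfl hs0 hs1 hmem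
      convert hmem using 1
      rw [Path.subpath_zero_one]
      have : ∀ {p' q' : X} (e0 : p' = p) (e1 : q' = q) (hp' : p' ∈ U c) (hq' : q' ∈ U c),
        ((tau hU c xb hx1 hx2 c hp).trans (Path.Homotopic.Quotient.mk γ)).trans (tau hU c xb hx1 hx2 c hq).symm
        = ((tau hU c xb hx1 hx2 c hp').trans (Path.Homotopic.Quotient.mk (γ.cast e0 e1))).trans
          (tau hU c xb hx1 hx2 c hq').symm := by
        rintro p' q' rfl rfl hp' hq'
        rfl
      exact this _ _ _ _
    exact aux t0 (tN N le_rfl) _ _ fin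
  rw [eq_top_iff]
  rintro g -
  obtain ⟨γ, rfl⟩ := Path.Homotopic.Quotient.mk_surjective g
  have := key γ (hx1 c) (hx1 c)
  rw [tau_base, Path.Homotopic.Quotient.refl_trans] at this
  have e : (Path.Homotopic.Quotient.refl (xb c)).symm = Path.Homotopic.Quotient.refl (xb c) := by
    rw [← Path.Homotopic.Quotient.refl_trans (Path.Homotopic.Quotient.refl (xb c)).symm, Path.Homotopic.Quotient.trans_symm]
  rw [e, Path.Homotopic.Quotient.trans_refl] at this
  exact this

section cover
variable {Γ : Type*} [Group Γ] [TopologicalSpace Γ] [DiscreteTopology Γ]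

/-- The bundle core attached to a locally constant cocycle. -/
def core (hopen : ∀ a, IsOpen (U a)) (ind : X → ι) (hind : ∀ p, p ∈ U (ind p))
    (g : ι → ι → X → Γ)
    (hg : ∀ a b p, p ∈ U a → p ∈ U b → ∀ᶠ q in 𝓝 p, g a b q = g a b p)
    (hc : ∀ a b d p, p ∈ U a → p ∈ U b → p ∈ U d → g a b p * g b d p = g a d p) :
    FiberBundleCore ι X Γ where
  baseSet := U
  isOpen_baseSet := hopen
  indexAt := ind
  mem_baseSet_at := hind
  coordChange b a p s := g a b p * s
  coordChange_self a p hp v := by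
    have := hc a a a p hp hp hp
    rw [mul_eq_left] at this
    rw [this, one_mul]
  continuousOn_coordChange i j := by
    rintro ⟨p, s⟩ ⟨⟨h1, h2⟩, -⟩
    apply ContinuousAt.continuousWithinAt
    have h3 : ContinuousAt (fun q => g j i q) p := by
      apply (continuousAt_const (y := g j i p)).congr
      filter_upwards [hg j i p h2 h1] with q hq
      exact hq.symm
    exact (h3.comp (f := Prod.fst) (x := ((p, s) : X × Γ)) continuousAt_fst).mul continuousAt_snd
  coordChange_comp i j k x hx v := by
    rw [← mul_assoc, hc k j i x hx.2 hx.1.2 hx.1.1]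

variable (hopen : ∀ a, IsOpen (U a)) (ind : X → ι) (hind : ∀ p, p ∈ U (ind p))
    (g : ι → ι → X → Γ)
    (hg : ∀ a b p, p ∈ U a → p ∈ U b → ∀ᶠ q in 𝓝 p, g a b q = g a b p)
    (hc : ∀ a b d p, p ∈ U a → p ∈ U b → p ∈ U d → g a b p * g b d p = g a d p)

lemma cov : IsCoveringMap (core hopen ind hind g hg hc).proj :=
  FiberBundle.isCoveringMap (F := Γ) (E := (core hopen ind hind g hg hc).Fiber)

/-- flat sections -/
def sec (a : ι) (p : X) (s : Γ) : (core hopen ind hind g hg hc).proj ⁻¹' {p} :=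
  ⟨⟨p, g (ind p) a p * s⟩, rfl⟩

lemma sec_change {a b : ι} {p : X} (ha : p ∈ U a) (hb : p ∈ U b) (s : Γ) :
    sec hopen ind hind g hg hc b p s = sec hopen ind hind g hg hc a p (g a b p * s) := by
  unfold sec
  congr 2
  rw [← mul_assoc, hc _ _ _ p (hind p) ha hb]

lemma monodromy_inn {a : ι} {p q : X} (hp : p ∈ U a) (hq : q ∈ U a) (s : Γ) :
    (cov hopen ind hind g hg hc).monodromy (inn (hU a).isPathConnected hp hq)
      (sec hopen ind hind g hg hc a p s) = sec hopen ind hind g hg hc a q s := by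
  set Z := core hopen ind hind g hg hc
  let J := (hU a).isPathConnected.joinedIn p hp q hq
  let δ : Path (sec hopen ind hind g hg hc a p s).1 (sec hopen ind hind g hg hc a q s).1 :=
    { toFun := fun t => ⟨J.somePath t, g (ind (J.somePath t)) a (J.somePath t) * s⟩
      continuous_toFun := by
        have h1 := (Z.localTriv a).toOpenPartialHomeomorph.continuousOn_symm
        have h2 : Continuous fun t => (J.somePath t, s) := by fun_prop
        have h3 := h1.comp_continuous h2 (fun t => by
          exact (Z.mem_localTriv_target a _).2 (J.somePath_mem t))
        exact h3
      source' := by rw [J.somePath.source]; rfl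
      target' := by rw [J.somePath.target]; rfl }
  apply (cov hopen ind hind g hg hc).monodromy_eq_of_map_eq (Path.Homotopic.Quotient.mk δ)
  rfl

lemma monodromy_symm {x y : X} (γ : Path.Homotopic.Quotient x y)
    (e : (core hopen ind hind g hg hc).proj ⁻¹' {x})
    (f : (core hopen ind hind g hg hc).proj ⁻¹' {y})
    (h : (cov hopen ind hind g hg hc).monodromy γ e = f) :
    (cov hopen ind hind g hg hc).monodromy γ.symm f = e := by
  rw [← h, ← IsCoveringMap.monodromy_trans_apply, Path.Homotopic.Quotient.trans_symm,
    IsCoveringMap.monodromy_refl]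
  rfl

lemma monodromy_tau (hnorm : ∀ a, g a c (xb a) = 1) (a : ι) {p : X} (hp : p ∈ U a) (s : Γ) :
    (cov hopen ind hind g hg hc).monodromy (tau hU c xb hx1 hx2 a hp)
      (sec hopen ind hind g hg hc c (xb c) s) = sec hopen ind hind g hg hc a p s := by
  unfold tau
  rw [IsCoveringMap.monodromy_trans_apply, monodromy_inn hU,
    sec_change hopen ind hind g hg hc (hx1 a) (hx2 a), hnorm, one_mul, monodromy_inn hU]

lemma monodromy_hh (hnorm : ∀ a, g a c (xb a) = 1) {a b : ι} {p : X} (ha : p ∈ U a)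
    (hb : p ∈ U b) (s : Γ) :
    (cov hopen ind hind g hg hc).monodromyPerm (xb c) (hh hU c xb hx1 hx2 a b p)
      (sec hopen ind hind g hg hc c (xb c) s) =
      sec hopen ind hind g hg hc c (xb c) (g a b p * s) := by
  rw [IsCoveringMap.coe_monodromyPerm, hh_eq hU c xb hx1 hx2 ha hb]
  unfold FundamentalGroup.fromPath FundamentalGroup.fromArrow
  rw [IsCoveringMap.monodromy_trans_apply, monodromy_tau hU c xb hx1 hx2 hopen ind hind g hg hc hnorm,
    sec_change hopen ind hind g hg hc ha hb]
  exact monodromy_symm hopen ind hind g hg hc _ _ _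
    (monodromy_tau hU c xb hx1 hx2 hopen ind hind g hg hc hnorm a ha _)

lemma sec_inj {a : ι} {p : X} {s t : Γ}
    (h : sec hopen ind hind g hg hc a p s = sec hopen ind hind g hg hc a p t) : s = t := by
  have h1 := congrArg Subtype.val h
  unfold sec at h1
  have h2 := (Bundle.TotalSpace.mk.inj h1).2
  exact mul_left_cancel (eq_of_heq h2)

end cover

/-- Abstract van Kampen criterion. -/
theorem main {Γ : Type*} [Group Γ] (hopen : ∀ a, IsOpen (U a)) (hcov : ∀ p, ∃ a, p ∈ U a)
    (g : ι → ι → X → Γ)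
    (hg : ∀ a b p, p ∈ U a → p ∈ U b → ∀ᶠ q in 𝓝 p, g a b q = g a b p)
    (hc : ∀ a b d p, p ∈ U a → p ∈ U b → p ∈ U d → g a b p * g b d p = g a d p)
    (hnorm : ∀ a, g a c (xb a) = 1)
    (φ : Γ →* FundamentalGroup X (xb c)) (S : Set Γ) (hS : Subgroup.closure S = ⊤)
    (hφ : ∀ s ∈ S, ∃ a b p, p ∈ U a ∧ p ∈ U b ∧ φ s = hh hU c xb hx1 hx2 a b p ∧ g a b p = s)
    (hgen : ∀ a b p, p ∈ U a → p ∈ U b → hh hU c xb hx1 hx2 a b p ∈ φ.range) :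
    Function.Bijective φ := by
  constructor
  · let _ : TopologicalSpace Γ := ⊥
    have : DiscreteTopology Γ := ⟨rfl⟩
    choose ind hind using hcov
    have key : ∀ γ : Γ, ∀ s, (cov hopen ind hind g hg hc).monodromyPerm (xb c) (φ γ)
        (sec hopen ind hind g hg hc c (xb c) s) =
        sec hopen ind hind g hg hc c (xb c) (γ * s) := by
      intro γ
      have hγ : γ ∈ Subgroup.closure S := by rw [hS]; trivial
      induction hγ using Subgroup.closure_induction with
      | mem x hx =>
        intro s
        obtain ⟨a, b, p, ha, hb, h1, h2⟩ := hφ x hx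
        rw [h1, monodromy_hh hU c xb hx1 hx2 hopen ind hind g hg hc hnorm ha hb, h2]
      | one => intro s; rw [map_one, map_one, one_mul]; rfl
      | mul x y _ _ hx hy =>
        intro s
        rw [map_mul, map_mul, Equiv.Perm.mul_apply, hy, hx, mul_assoc]
      | inv x _ hx =>
        intro s
        rw [map_inv, map_inv, Equiv.Perm.inv_eq_iff_eq, hx, mul_inv_cancel_left]
    rw [injective_iff_map_eq_one]
    intro γ hγ
    have h1 := key γ 1
    rw [hγ, map_one, mul_one, Equiv.Perm.one_apply] at h1
    exact (sec_inj hopen ind hind g hg hc h1).symm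
  · rw [← MonoidHom.range_eq_top]
    exact subgroup_eq_top hU c xb hx1 hx2 hopen hcov _ hgen

end VK
end

end

section

open Topology Set
noncomputable section
namespace CN

open ComplexConjugate

variable (n : ℕ)

/-- n-th powers of coordinates -/
def Pw (u : Fin 3 → ℂ) (i : Fin 3) : ℂ := u i ^ n

/-- the angular functions -/
def ao (m : Fin 3) (u : Fin 3 → ℂ) : ℝ :=
  ‖Pw n u (m+1)‖ * ‖Pw n u (m+2)‖ - (Pw n u (m+1) * conj (Pw n u (m+2))).re

def sq (i : Fin 3) (u : Fin 3 → ℂ) : ℝ := √‖Pw n u i‖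

def GG (u : Fin 3 → ℂ) : ℂ :=
  Pw n u 0 ^ 2 + Pw n u 1 ^ 2 + Pw n u 2 ^ 2
    - 2 * (Pw n u 0 * Pw n u 1 + Pw n u 0 * Pw n u 2 + Pw n u 1 * Pw n u 2)

/-- the open sets around the vertices -/
def UC (k : Fin 3) (u : Fin 3 → ℂ) : Prop :=
  ¬ (ao n (k+1) u = ao n (k+2) u ∧ ao n (k+2) u ≤ ao n k u) ∨
    sq n (k+1) u + sq n (k+2) u < sq n k u

def jj (m : Fin 3) (A : Fin 3 → ℂ) : ℝ := (A (m+1) * conj (A (m+2))).im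

lemma jj_sum (k : Fin 3) (A : Fin 3 → ℂ) :
    (jj k A : ℂ) * A k + jj (k+1) A * A (k+1) + jj (k+2) A * A (k+2) = 0 := by
  fin_cases k <;> simp [jj] <;> apply Complex.ext <;> simp <;> ring

variable {n}

lemma norm_mul_sub (a b : ℂ) :
    ‖a^2‖ * ‖b^2‖ - (a^2 * conj (b^2)).re = 2 * (a * conj b).im ^ 2 := by
  have h1 : ‖a^2‖ * ‖b^2‖ = Complex.normSq a * Complex.normSq b := by
    rw [norm_pow, norm_pow, Complex.sq_norm, Complex.sq_norm]
  rw [h1]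
  simp [Complex.normSq_apply, pow_two]
  ring

lemma exists_root (u : Fin 3 → ℂ) : ∃ A : Fin 3 → ℂ, ∀ i, A i ^ 2 = Pw n u i := by
  have h : ∀ i, ∃ a : ℂ, a ^ 2 = Pw n u i := fun i => by
    obtain ⟨a, ha⟩ := IsAlgClosed.exists_pow_nat_eq (Pw n u i) (n := 2) (by norm_num)
    exact ⟨a, ha⟩
  choose A hA using h
  exact ⟨A, hA⟩

lemma ao_root {u A : Fin 3 → ℂ} (hA : ∀ i, A i ^ 2 = Pw n u i) (m : Fin 3) :
    ao n m u = 2 * jj m A ^ 2 := by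
  unfold ao jj
  rw [← hA, ← hA, norm_mul_sub]

lemma sq_root {u A : Fin 3 → ℂ} (hA : ∀ i, A i ^ 2 = Pw n u i) (m : Fin 3) :
    sq n m u = ‖A m‖ := by
  unfold sq
  rw [← hA, norm_pow, Real.sqrt_sq (norm_nonneg _)]

lemma ao_nonneg (m : Fin 3) (u : Fin 3 → ℂ) : 0 ≤ ao n m u := by
  obtain ⟨A, hA⟩ := exists_root (n := n) u
  rw [ao_root hA]; positivity

lemma sq_nonneg' (m : Fin 3) (u : Fin 3 → ℂ) : 0 ≤ sq n m u := Real.sqrt_nonneg _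

lemma B_zero {k : Fin 3} {u : Fin 3 → ℂ} (hB : sq n (k+1) u + sq n (k+2) u < sq n k u)
    (h1 : ao n (k+1) u = ao n (k+2) u) (h2 : ao n (k+2) u ≤ ao n k u) : ao n k u = 0 := by
  obtain ⟨A, hA⟩ := exists_root (n := n) u
  rw [sq_root hA, sq_root hA, sq_root hA] at hB
  rw [ao_root hA, ao_root hA] at h1 h2
  rw [ao_root hA]
  have h1' : |jj (k+1) A| = |jj (k+2) A| := by
    rw [← sq_eq_sq_iff_abs_eq_abs]; linarith
  have h2' : |jj (k+2) A| ≤ |jj k A| := by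
    rw [← sq_le_sq]; linarith
  have h3 := jj_sum k A
  have h4 : (jj k A : ℂ) * A k = -(jj (k+1) A * A (k+1) + jj (k+2) A * A (k+2)) := by
    linear_combination h3
  have h5 : |jj k A| * ‖A k‖ ≤ |jj (k+1) A| * ‖A (k+1)‖ + |jj (k+2) A| * ‖A (k+2)‖ := by
    have := congrArg norm h4
    rw [norm_mul, Complex.norm_real, norm_neg, Real.norm_eq_abs] at this
    rw [this]
    refine (norm_add_le _ _).trans ?_
    simp
  rw [h1'] at h5
  have h6 : |jj k A| = 0 := by
    by_contra hne
    have hpos : 0 < |jj k A| := lt_of_le_of_ne (abs_nonneg _) (Ne.symm hne)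
    have : |jj (k+2) A| * (‖A (k+1)‖ + ‖A (k+2)‖) ≤ |jj k A| * (‖A (k+1)‖ + ‖A (k+2)‖) :=
      mul_le_mul_of_nonneg_right h2' (by positivity)
    have := mul_lt_mul_of_pos_left hB hpos
    linarith
  have : jj k A = 0 := abs_eq_zero.1 h6
  simp [this]

lemma GG_root {u A : Fin 3 → ℂ} (hA : ∀ i, A i ^ 2 = Pw n u i) :
    GG n u = (A 0 + A 1 + A 2) * (A 0 + A 1 - A 2) * (A 0 - A 1 + A 2) * (A 0 - A 1 - A 2) := by
  unfold GG
  rw [← hA, ← hA, ← hA]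
  ring

lemma roots_of_GG {u : Fin 3 → ℂ} (h : GG n u = 0) :
    ∃ A : Fin 3 → ℂ, (∀ i, A i ^ 2 = Pw n u i) ∧ A 0 + A 1 + A 2 = 0 := by
  obtain ⟨A, hA⟩ := exists_root (n := n) u
  rw [GG_root hA] at h
  rcases mul_eq_zero.1 h with h | h
  rcases mul_eq_zero.1 h with h | h
  rcases mul_eq_zero.1 h with h | h
  · exact ⟨A, hA, h⟩
  · refine ⟨![A 0, A 1, -A 2], ?_, by simpa [sub_eq_add_neg] using h⟩
    intro i; fin_cases i <;> simp [← hA]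
  · refine ⟨![A 0, -A 1, A 2], ?_, by simpa [sub_eq_add_neg] using h⟩
    intro i; fin_cases i <;> simp [← hA]
  · refine ⟨![A 0, -A 1, -A 2], ?_, by simpa [sub_eq_add_neg] using h⟩
    intro i; fin_cases i <;> simp [← hA]

lemma sum3 (k : Fin 3) (A : Fin 3 → ℂ) : A k + A (k+1) + A (k+2) = A 0 + A 1 + A 2 := by
  fin_cases k <;> simp <;> ring

lemma GG_ne_of_UC {k : Fin 3} {u : Fin 3 → ℂ} (h : UC n k u) : GG n u ≠ 0 := by
  intro hG
  obtain ⟨A, hA, hs⟩ := roots_of_GG hG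
  rw [← sum3 k] at hs
  have e : A k = -(A (k+1) + A (k+2)) := by linear_combination hs
  have j1 : jj (k+1) A = jj k A := by
    have : jj (k+1) A = (A (k+2) * conj (A k)).im := by
      unfold jj; congr 3 <;> (fin_cases k <;> rfl)
    rw [this, e]; unfold jj; simp; ring
  have j2 : jj (k+2) A = jj k A := by
    have : jj (k+2) A = (A k * conj (A (k+1))).im := by
      unfold jj; congr 3 <;> (fin_cases k <;> rfl)
    rw [this, e]; unfold jj; simp; ring
  rcases h with h | h
  · apply h
    rw [ao_root hA, ao_root hA, ao_root hA, j1, j2]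
    exact ⟨rfl, le_rfl⟩
  · rw [sq_root hA, sq_root hA, sq_root hA, e, norm_neg] at h
    exact absurd (norm_add_le (A (k+1)) (A (k+2))) (not_le.2 h)

lemma ao_of_zero (hn : 1 ≤ n) {k : Fin 3} {u : Fin 3 → ℂ} (h : u k = 0) :
    ao n (k+1) u = 0 ∧ ao n (k+2) u = 0 ∧ sq n k u = 0 := by
  have hP : Pw n u k = 0 := by unfold Pw; rw [h, zero_pow (by omega)]
  have e1 : k + 1 + 2 = k := by fin_cases k <;> rfl
  have e2 : k + 2 + 1 = k := by fin_cases k <;> rfl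
  refine ⟨?_, ?_, ?_⟩
  · unfold ao; rw [e1, hP]; simp
  · unfold ao; rw [e2, hP]; simp
  · unfold sq; rw [hP]; simp

lemma ne_zero_of_UC (hn : 1 ≤ n) {k : Fin 3} {u : Fin 3 → ℂ} (h : UC n k u) : u k ≠ 0 := by
  intro h0
  obtain ⟨h1, h2, h3⟩ := ao_of_zero hn h0
  rcases h with h | h
  · apply h; rw [h1, h2]; exact ⟨rfl, ao_nonneg _ _⟩
  · rw [h3] at h
    have := sq_nonneg' (n := n) (k+1) u
    have := sq_nonneg' (n := n) (k+2) u
    linarith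

lemma i11 (k : Fin 3) : k + 1 + 1 = k + 2 := by fin_cases k <;> rfl
lemma i12 (k : Fin 3) : k + 1 + 2 = k := by fin_cases k <;> rfl
lemma i21 (k : Fin 3) : k + 2 + 1 = k := by fin_cases k <;> rfl
lemma i22 (k : Fin 3) : k + 2 + 2 = k + 1 := by fin_cases k <;> rfl

def AA (n : ℕ) (m : Fin 3) (u : Fin 3 → ℂ) : Prop :=
  min (ao n (m+1) u) (ao n (m+2) u) < ao n m u

def EE (n : ℕ) (m : Fin 3) (u : Fin 3 → ℂ) : Prop :=
  ao n m u < min (ao n (m+1) u) (ao n (m+2) u)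

lemma not_B_both {k l m : Fin 3} {u : Fin 3 → ℂ} (h1 : sq n l u + sq n m u < sq n k u)
    (h2 : sq n m u + sq n k u < sq n l u) : False := by
  have := sq_nonneg' (n := n) m u
  linarith

lemma UC_inter {m : Fin 3} {u : Fin 3 → ℂ} :
    (UC n (m+1) u ∧ UC n (m+2) u) ↔ (AA n m u ∨ EE n m u) := by
  unfold UC AA EE
  rw [i11, i12, i21, i22]
  constructor
  · rintro ⟨h1, h2⟩
    by_contra hcon
    push Not at hcon
    have heq : ao n m u = min (ao n (m+1) u) (ao n (m+2) u) := le_antisymm hcon.1 hcon.2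
    have h0 := ao_nonneg (n := n) m u
    have h01 := ao_nonneg (n := n) (m+1) u
    have h02 := ao_nonneg (n := n) (m+2) u
    rcases le_total (ao n (m+1) u) (ao n (m+2) u) with hle | hle
    · rw [min_eq_left hle] at heq
      have hB : sq n m u + sq n (m+1) u < sq n (m+2) u := by
        rcases h2 with h2 | h2
        · exact absurd ⟨heq, hle⟩ h2
        · exact h2
      have hz : ao n (m+2) u = 0 := B_zero (k := m+2) (by rw [i21, i22]; exact hB)
        (by rw [i21, i22]; exact heq) (by rw [i22]; exact hle)
      rcases h1 with h1 | h1
      · apply h1; constructor <;> linarith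
      · have := sq_nonneg' (n := n) m u
        linarith
    · rw [min_eq_right hle] at heq
      have hB : sq n (m+2) u + sq n m u < sq n (m+1) u := by
        rcases h1 with h1 | h1
        · exact absurd ⟨heq.symm, by linarith⟩ h1
        · exact h1
      have hz : ao n (m+1) u = 0 := B_zero (k := m+1) (by rw [i11, i12]; exact hB)
        (by rw [i11, i12]; exact heq.symm) (by rw [i12]; linarith)
      rcases h2 with h2 | h2
      · apply h2; constructor <;> linarith
      · have := sq_nonneg' (n := n) m u
        linarith
  · intro h
    have key : ao n m u ≠ min (ao n (m+1) u) (ao n (m+2) u) := by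
      rcases h with h | h
      · exact ne_of_gt h
      · exact ne_of_lt h
    constructor
    · left
      rintro ⟨h1, h2⟩
      apply key
      rw [h1, min_eq_right]; linarith
    · left
      rintro ⟨h1, h2⟩
      apply key
      rw [min_eq_left h2]; exact h1

lemma EE_UC {m : Fin 3} {u : Fin 3 → ℂ} (h : EE n m u) : UC n m u := by
  left
  rintro ⟨h1, h2⟩
  unfold EE at h
  have := min_le_right (ao n (m+1) u) (ao n (m+2) u)
  linarith

/-- coordinatewise real scaling -/
def dsc (d : Fin 3 → ℝ) (u : Fin 3 → ℂ) : Fin 3 → ℂ := fun i => (d i : ℂ) * u i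

lemma ao_dsc {d : Fin 3 → ℝ} (hd : ∀ i, 0 ≤ d i) (m : Fin 3) (u : Fin 3 → ℂ) :
    ao n m (dsc d u) = (d (m+1) * d (m+2)) ^ n * ao n m u := by
  have h : ∀ i, Pw n (dsc d u) i = ((d i ^ n : ℝ) : ℂ) * Pw n u i := fun i => by
    unfold Pw dsc; rw [mul_pow]; push_cast; rfl
  have h' : ∀ i, ‖Pw n (dsc d u) i‖ = d i ^ n * ‖Pw n u i‖ := fun i => by
    rw [h, norm_mul, Complex.norm_real, Real.norm_eq_abs, abs_of_nonneg (pow_nonneg (hd i) n)]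
  unfold ao
  rw [h', h', h, h]
  simp only [map_mul, Complex.conj_ofReal, mul_pow]
  have : ((d (m+1) ^ n : ℝ) : ℂ) * Pw n u (m+1) * (((d (m+2) ^ n : ℝ) : ℂ) * conj (Pw n u (m+2)))
    = ((d (m+1) ^ n * d (m+2) ^ n : ℝ) : ℂ) * (Pw n u (m+1) * conj (Pw n u (m+2))) := by
    push_cast; ring
  rw [this, Complex.re_ofReal_mul]
  ring

lemma sq_dsc {d : Fin 3 → ℝ} (hd : ∀ i, 0 ≤ d i) (i : Fin 3) (u : Fin 3 → ℂ) :
    sq n i (dsc d u) = √(d i ^ n) * sq n i u := by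
  unfold sq Pw dsc
  rw [mul_pow, norm_mul, norm_pow, Complex.norm_real, Real.norm_eq_abs, abs_of_nonneg (hd i),
    Real.sqrt_mul (pow_nonneg (hd i) n)]

lemma ao_smul (c : ℂ) (m : Fin 3) (u : Fin 3 → ℂ) :
    ao n m (c • u) = (‖c‖ ^ n) ^ 2 * ao n m u := by
  unfold ao Pw
  simp only [Pi.smul_apply, smul_eq_mul, mul_pow, norm_mul, norm_pow, map_mul, map_pow]
  have : c ^ n * u (m+1) ^ n * (conj c ^ n * conj (u (m+2)) ^ n)
    = (((‖c‖ ^ n) ^ 2 : ℝ) : ℂ) * (u (m+1) ^ n * conj (u (m+2)) ^ n) := by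
    have h : ((‖c‖ : ℂ)) ^ 2 = c * conj c := by rw [Complex.mul_conj']
    push_cast
    rw [← pow_mul, mul_comm n 2, pow_mul, h]; ring
  rw [this, Complex.re_ofReal_mul]
  ring

lemma sq_smul (c : ℂ) (m : Fin 3) (u : Fin 3 → ℂ) :
    sq n m (c • u) = √(‖c‖ ^ n) * sq n m u := by
  unfold sq Pw
  simp only [Pi.smul_apply, smul_eq_mul, mul_pow, norm_mul, norm_pow]
  rw [Real.sqrt_mul (by positivity)]

lemma GG_smul (c : ℂ) (u : Fin 3 → ℂ) : GG n (c • u) = (c ^ n) ^ 2 * GG n u := by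
  unfold GG Pw
  simp only [Pi.smul_apply, smul_eq_mul, mul_pow]
  ring

lemma UC_smul {c : ℂ} (hc : c ≠ 0) (k : Fin 3) (u : Fin 3 → ℂ) : UC n k (c • u) ↔ UC n k u := by
  unfold UC
  have h1 : 0 < ‖c‖ ^ n := by positivity
  have h2 : 0 < √(‖c‖ ^ n) := Real.sqrt_pos.2 h1
  simp only [ao_smul, sq_smul, ← mul_add]
  rw [mul_lt_mul_iff_right₀ h2, mul_right_inj' (by positivity), mul_le_mul_iff_right₀ (by positivity)]

lemma AA_smul {c : ℂ} (hc : c ≠ 0) (k : Fin 3) (u : Fin 3 → ℂ) : AA n k (c • u) ↔ AA n k u := by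
  unfold AA
  have h1 : 0 < ‖c‖ ^ n := by positivity
  simp only [ao_smul, min_lt_iff]
  rw [mul_lt_mul_iff_right₀ (by positivity), mul_lt_mul_iff_right₀ (by positivity)]

lemma EE_smul {c : ℂ} (hc : c ≠ 0) (k : Fin 3) (u : Fin 3 → ℂ) : EE n k (c • u) ↔ EE n k u := by
  unfold EE
  have h1 : 0 < ‖c‖ ^ n := by positivity
  simp only [ao_smul, lt_min_iff]
  rw [mul_lt_mul_iff_right₀ (by positivity), mul_lt_mul_iff_right₀ (by positivity)]

@[fun_prop]
lemma continuous_ao (m : Fin 3) : Continuous (ao n m) := by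
  unfold ao Pw; fun_prop

@[fun_prop]
lemma continuous_sq (m : Fin 3) : Continuous (sq n m) := by
  unfold sq Pw; fun_prop

@[fun_prop]
lemma continuous_GG : Continuous (GG n) := by
  unfold GG Pw; fun_prop

lemma isOpen_UC (k : Fin 3) : IsOpen {u | UC n k u} := by
  unfold UC
  rw [ofPred_or]
  apply IsOpen.union
  · apply (isOpen_compl_iff
      (s := {u | ao n (k+1) u = ao n (k+2) u ∧ ao n (k+2) u ≤ ao n k u})).2
    exact (isClosed_eq (continuous_ao _) (continuous_ao _)).inter
      (isClosed_le (continuous_ao _) (continuous_ao _))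
  · exact isOpen_lt (by fun_prop) (by fun_prop)

lemma isOpen_AA (k : Fin 3) : IsOpen {u | AA n k u} := by
  unfold AA; exact isOpen_lt (by fun_prop) (by fun_prop)

lemma isOpen_EE (k : Fin 3) : IsOpen {u | EE n k u} := by
  unfold EE; exact isOpen_lt (by fun_prop) (by fun_prop)

/-- scaling vector contracting to the vertex `k` -/
def dk (k : Fin 3) (s : ℝ) : Fin 3 → ℝ := fun i => if i = k then 1 else s

lemma dk_self (k : Fin 3) (s : ℝ) : dk k s k = 1 := by simp [dk]
lemma dk_1 (k : Fin 3) (s : ℝ) : dk k s (k+1) = s := by simp [dk]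
lemma dk_2 (k : Fin 3) (s : ℝ) : dk k s (k+2) = s := by simp [dk]

lemma UC_contract (hn : 1 ≤ n) {k : Fin 3} {u : Fin 3 → ℂ} (h : UC n k u) {s : ℝ} (h0 : 0 ≤ s)
    (h1 : s ≤ 1) : UC n k (dsc (dk k s) u) := by
  have hk := ne_zero_of_UC hn h
  have hd : ∀ i, 0 ≤ dk k s i := fun i => by unfold dk; split_ifs <;> linarith
  have hsq : 0 < sq n k u := by
    unfold sq Pw
    exact Real.sqrt_pos.2 (norm_pos_iff.2 (pow_ne_zero n hk))
  unfold UC at h ⊢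
  simp only [ao_dsc hd, sq_dsc hd, i11, i12, i21, i22, dk_self, dk_1, dk_2, one_mul, mul_one,
    one_pow, Real.sqrt_one, ← mul_add]
  rcases h0.eq_or_lt with rfl | hs
  · right
    rw [zero_pow (by omega)]; simpa using hsq
  · have hp : 0 < s ^ n := by positivity
    have hp1 : s ^ n ≤ 1 := pow_le_one₀ h0 h1
    have hq1 : √(s ^ n) ≤ 1 := Real.sqrt_le_one.2 hp1
    have e1 := sq_nonneg' (n := n) (k+1) u
    have e2 := sq_nonneg' (n := n) (k+2) u
    rcases h with h | h
    · left
      rintro ⟨g1, g2⟩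
      apply h
      refine ⟨mul_left_cancel₀ hp.ne' g1, ?_⟩
      rw [mul_pow, mul_assoc] at g2
      have := le_of_mul_le_mul_left g2 hp
      have h3 := mul_le_mul_of_nonneg_right hp1 (ao_nonneg (n := n) k u)
      linarith
    · right
      have := mul_le_mul_of_nonneg_right hq1 (add_nonneg e1 e2)
      linarith

end CN
end

end

section

open Topology Set
noncomputable section
namespace CN

open ComplexConjugate
open Complex (I)
open scoped Real

variable {n : ℕ}

/-- `s` has angular coordinate `t` (in units of `2π/n`). -/
def HT (n : ℕ) (s : ℂ) (t : ℝ) : Prop :=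
  s ≠ 0 ∧ s = ‖s‖ * Complex.exp (((2 * π * t / n : ℝ) : ℂ) * I)

def arc (n : ℕ) (s : ℂ) : ZMod n := ((⌊n * s.arg / (2 * π)⌋ : ℤ) : ZMod n)

lemma HT_arg (hn : 1 ≤ n) {s : ℂ} (hs : s ≠ 0) : HT n s (n * s.arg / (2 * π)) := by
  refine ⟨hs, ?_⟩
  have hn' : (n : ℝ) ≠ 0 := by positivity
  have : 2 * π * (n * s.arg / (2 * π)) / n = s.arg := by field_simp
  rw [this]
  exact (Complex.norm_mul_exp_arg_mul_I s).symm

lemma HT_unique (hn : 1 ≤ n) {s : ℂ} {t t' : ℝ} (h : HT n s t) (h' : HT n s t') :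
    ∃ k : ℤ, t' = t + k * n := by
  have hn' : (n : ℝ) ≠ 0 := by positivity
  have h1 := h.2.symm.trans h'.2
  have h2 := mul_left_cancel₀ (by simpa using h.1) h1
  rw [eq_comm, Complex.exp_eq_exp_iff_exists_int] at h2
  obtain ⟨k, hk⟩ := h2
  refine ⟨k, ?_⟩
  have h3 := congrArg Complex.im hk
  simp only [Complex.im_ofReal_mul, Complex.add_im, Complex.I_im, mul_one] at h3
  have h4 : ((k : ℂ) * (2 * π * I)).im = 2 * π * k := by
    simp; ring
  rw [h4] at h3
  field_simp at h3
  linarith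

lemma arc_eq (hn : 1 ≤ n) {s : ℂ} {t : ℝ} (h : HT n s t) : arc n s = ((⌊t⌋ : ℤ) : ZMod n) := by
  obtain ⟨k, hk⟩ := HT_unique hn (HT_arg hn h.1) h
  have : ⌊t⌋ = ⌊n * s.arg / (2 * π)⌋ + k * n := by
    rw [hk]
    have : (k : ℝ) * n = ((k * n : ℤ) : ℝ) := by push_cast; rfl
    rw [this, Int.floor_add_intCast]
  rw [this]
  simp [arc]

lemma HT_mul {s s' : ℂ} {t t' : ℝ} (h : HT n s t) (h' : HT n s' t') : HT n (s * s') (t + t') := by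
  refine ⟨mul_ne_zero h.1 h'.1, ?_⟩
  have e : (((2 * π * (t + t') / n : ℝ) : ℂ) * I) = ((2 * π * t / n : ℝ) : ℂ) * I +
    ((2 * π * t' / n : ℝ) : ℂ) * I := by push_cast; ring
  rw [e, Complex.exp_add, norm_mul]
  conv_lhs => rw [h.2, h'.2]
  push_cast; ring

lemma HT_inv {s : ℂ} {t : ℝ} (h : HT n s t) : HT n s⁻¹ (-t) := by
  refine ⟨inv_ne_zero h.1, ?_⟩
  have e : (((2 * π * (-t) / n : ℝ) : ℂ) * I) = -(((2 * π * t / n : ℝ) : ℂ) * I) := by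
    push_cast; ring
  rw [e, Complex.exp_neg, norm_inv]
  conv_lhs => rw [h.2]
  push_cast
  rw [mul_inv]

lemma HT_div {s s' : ℂ} {t t' : ℝ} (h : HT n s t) (h' : HT n s' t') : HT n (s / s') (t - t') := by
  rw [div_eq_mul_inv, sub_eq_add_neg]
  exact HT_mul h (HT_inv h')

lemma HT_exp (r t : ℝ) (hr : 0 < r) :
    HT n (r * Complex.exp (((2 * π * t / n : ℝ) : ℂ) * I)) t := by
  refine ⟨mul_ne_zero (by exact_mod_cast hr.ne') (Complex.exp_ne_zero _), ?_⟩
  rw [norm_mul, Complex.norm_exp_ofReal_mul_I, Complex.norm_real, Real.norm_eq_abs, abs_of_pos hr,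
    mul_one]

lemma HT_shift (hn : 1 ≤ n) {s : ℂ} {t : ℝ} (h : HT n s t) (k : ℤ) : HT n s (t + k * n) := by
  refine ⟨h.1, ?_⟩
  have hn' : (n : ℝ) ≠ 0 := by positivity
  have e : (((2 * π * (t + k * n) / n : ℝ) : ℂ) * I) = ((2 * π * t / n : ℝ) : ℂ) * I +
    k * (2 * π * I) := by
    have : (2 * π * (t + k * n) / n : ℝ) = 2 * π * t / n + k * (2 * π) := by field_simp
    rw [this]; push_cast; ring
  rw [e, Complex.exp_add, Complex.exp_int_mul_two_pi_mul_I, mul_one]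
  exact h.2

lemma HT_pow (hn : 1 ≤ n) {s : ℂ} {t : ℝ} (h : HT n s t) :
    s ^ n = ((‖s‖ ^ n : ℝ) : ℂ) * Complex.exp (((2 * π * t : ℝ) : ℂ) * I) := by
  have hn' : (n : ℂ) ≠ 0 := by exact_mod_cast (by omega : n ≠ 0)
  conv_lhs => rw [h.2]
  rw [mul_pow, ← Complex.exp_nat_mul]
  push_cast
  congr 2
  field_simp

lemma HT_re_pow (hn : 1 ≤ n) {s : ℂ} {t : ℝ} (h : HT n s t) :
    (s ^ n).re = ‖s‖ ^ n * Real.cos (2 * π * t) := by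
  rw [HT_pow hn h, Complex.re_ofReal_mul, Complex.exp_ofReal_mul_I_re]

lemma cos_eq_one {t : ℝ} : Real.cos (2 * π * t) = 1 ↔ ∃ k : ℤ, t = k := by
  rw [Real.cos_eq_one_iff]
  constructor
  · rintro ⟨k, hk⟩
    refine ⟨k, ?_⟩
    have := Real.pi_pos
    have h2 : 2 * π * (t - k) = 0 := by linarith
    rcases mul_eq_zero.1 h2 with h | h
    · linarith
    · linarith
  · rintro ⟨k, rfl⟩; exact ⟨k, by ring⟩

/-- nearby points have nearby angular coordinates -/
lemma HT_near (hn : 1 ≤ n) {s0 : ℂ} {t0 : ℝ} (h : HT n s0 t0) {ε : ℝ} (hε : 0 < ε) :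
    ∀ᶠ s in 𝓝 s0, ∃ t, HT n s t ∧ |t - t0| < ε := by
  have c1 : ContinuousAt (fun s : ℂ => n * (s / s0).arg / (2 * π)) s0 := by
    have : ContinuousAt (fun s : ℂ => (s / s0).arg) s0 := by
      apply ContinuousAt.comp (g := Complex.arg) (f := fun s => s / s0)
      · apply Complex.continuousAt_arg
        rw [div_self h.1]; exact Complex.one_mem_slitPlane
      · fun_prop
    fun_prop
  have v0 : (n * (s0 / s0).arg / (2 * π) : ℝ) = 0 := by rw [div_self h.1]; simp
  have h1 := c1.eventually (Metric.ball_mem_nhds _ hε)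
  filter_upwards [h1, isOpen_ne.mem_nhds h.1] with s hs hs0
  refine ⟨t0 + n * (s / s0).arg / (2 * π), ?_, ?_⟩
  · have := HT_mul h (HT_arg hn (div_ne_zero hs0 h.1))
    rwa [mul_div_cancel₀ _ h.1] at this
  · rw [v0] at hs
    rw [add_sub_cancel_left]; rwa [Real.dist_eq, sub_zero] at hs

lemma floor_near {t0 : ℝ} (h : ¬ ∃ k : ℤ, t0 = k) :
    ∃ ε > 0, ∀ t : ℝ, |t - t0| < ε → ⌊t⌋ = ⌊t0⌋ := by
  have h1 : (⌊t0⌋ : ℝ) < t0 := lt_of_le_of_ne (Int.floor_le t0) fun e => h ⟨_, e.symm⟩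
  have h2 := Int.lt_floor_add_one t0
  refine ⟨min (t0 - ⌊t0⌋) (⌊t0⌋ + 1 - t0), lt_min (by linarith) (by linarith), fun t ht => ?_⟩
  rw [lt_min_iff, abs_lt, abs_lt] at ht
  rw [Int.floor_eq_iff]
  constructor <;> linarith [ht.1.1, ht.1.2, ht.2.1, ht.2.2]

lemma arc_near (hn : 1 ≤ n) {s0 : ℂ} {t0 : ℝ} (h : HT n s0 t0) (ht : ¬ ∃ k : ℤ, t0 = k) :
    ∀ᶠ s in 𝓝 s0, arc n s = arc n s0 := by
  obtain ⟨ε, hε, hf⟩ := floor_near ht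
  filter_upwards [HT_near hn h hε] with s hs
  obtain ⟨t, h1, h2⟩ := hs
  rw [arc_eq hn h1, arc_eq hn h, hf t h2]

/-- arcs of a point -/
def ar (n : ℕ) (m : Fin 3) (u : Fin 3 → ℂ) : ZMod n := arc n (u (m+1) / u (m+2))

lemma ar_smul {c : ℂ} (hc : c ≠ 0) (m : Fin 3) (u : Fin 3 → ℂ) : ar n m (c • u) = ar n m u := by
  unfold ar
  simp only [Pi.smul_apply, smul_eq_mul]
  rw [mul_div_mul_left _ _ hc]

lemma ao_HT (hn : 1 ≤ n) {m : Fin 3} {u : Fin 3 → ℂ} {t : ℝ} (h : HT n (u (m+1) / u (m+2)) t) :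
    ao n m u = ‖u (m+1)‖ ^ n * ‖u (m+2)‖ ^ n * (1 - Real.cos (2 * π * t)) := by
  have h2 : u (m+2) ≠ 0 := by
    intro h0; apply h.1; rw [h0, div_zero]
  have e : u (m+1) ^ n * conj (u (m+2) ^ n) = ((‖u (m+2)‖ ^ n * ‖u (m+2)‖ ^ n : ℝ) : ℂ) *
      (u (m+1) / u (m+2)) ^ n := by
    have : ((‖u (m+2)‖ ^ n * ‖u (m+2)‖ ^ n : ℝ) : ℂ) = u (m+2) ^ n * conj (u (m+2) ^ n) := by
      rw [Complex.mul_conj']; push_cast; rw [norm_pow]; push_cast; ring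
    rw [this, div_pow]
    field_simp
  unfold ao Pw
  rw [e, Complex.re_ofReal_mul, HT_re_pow hn h, norm_div, norm_pow, norm_pow, div_pow]
  have : ‖u (m+2)‖ ^ n ≠ 0 := pow_ne_zero _ (norm_ne_zero_iff.2 h2)
  field_simp

lemma ne_zero_of_ao (hn : 1 ≤ n) {m : Fin 3} {u : Fin 3 → ℂ} (h : ao n m u ≠ 0) :
    u (m+1) ≠ 0 ∧ u (m+2) ≠ 0 := by
  constructor
  · intro h0
    have := (ao_of_zero hn h0).2.1
    rw [i12] at this; exact h this
  · intro h0
    have := (ao_of_zero hn h0).1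
    rw [i21] at this; exact h this

lemma exists_HT (hn : 1 ≤ n) {m : Fin 3} {u : Fin 3 → ℂ} (h : ao n m u ≠ 0) :
    ∃ t, HT n (u (m+1) / u (m+2)) t ∧ ¬ ∃ k : ℤ, t = k := by
  obtain ⟨h1, h2⟩ := ne_zero_of_ao hn h
  refine ⟨_, HT_arg hn (div_ne_zero h1 h2), fun hk => h ?_⟩
  rw [ao_HT hn (HT_arg hn (div_ne_zero h1 h2)), cos_eq_one.2 hk]
  simp

lemma ar_near (hn : 1 ≤ n) {m : Fin 3} {u : Fin 3 → ℂ} (h : ao n m u ≠ 0) :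
    ∀ᶠ v in 𝓝 u, ar n m v = ar n m u := by
  obtain ⟨t, h1, h2⟩ := exists_HT hn h
  have hne := ne_zero_of_ao hn h
  have c : ContinuousAt (fun v : Fin 3 → ℂ => v (m+1) / v (m+2)) u :=
    ContinuousAt.div (continuous_apply _).continuousAt (continuous_apply _).continuousAt hne.2
  exact c.eventually (arc_near hn h1 h2)

/-- open sector of half-angle `π/n` -/
def sct (n : ℕ) (s : ℂ) : Prop := s ≠ 0 ∧ |s.arg| < π / n

lemma sct_slit (hn : 1 ≤ n) {s : ℂ} (h : sct n s) : s ∈ Complex.slitPlane := by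
  rw [Complex.mem_slitPlane_iff_arg]
  refine ⟨fun e => ?_, h.1⟩
  have h2 := h.2
  rw [e, abs_of_pos Real.pi_pos] at h2
  have : π / n ≤ π := div_le_self Real.pi_pos.le (by exact_mod_cast hn)
  linarith

def rt (n : ℕ) (s : ℂ) : ℂ := s ^ (((n : ℝ) / 2 : ℝ) : ℂ)
def rti (n : ℕ) (a : ℂ) : ℂ := a ^ (((2 : ℝ) / n : ℝ) : ℂ)

lemma cpow_real {s : ℂ} (hs : s ≠ 0) (r : ℝ) :
    s ^ (r : ℂ) = ((‖s‖ ^ r : ℝ) : ℂ) * Complex.exp ((r * s.arg : ℝ) * I) := by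
  rw [Complex.cpow_def_of_ne_zero hs, Complex.log, add_mul, Complex.exp_add,
    Real.rpow_def_of_pos (norm_pos_iff.2 hs)]
  push_cast
  congr 2
  ring

lemma arg_cpow_real {s : ℂ} (hs : s ≠ 0) {r : ℝ} (h1 : -π < r * s.arg) (h2 : r * s.arg ≤ π) :
    (s ^ (r : ℂ)).arg = r * s.arg := by
  rw [cpow_real hs, Complex.exp_mul_I]
  exact Complex.arg_mul_cos_add_sin_mul_I (Real.rpow_pos_of_pos (norm_pos_iff.2 hs) _) ⟨h1, h2⟩

lemma cpow_real_ne {s : ℂ} (hs : s ≠ 0) (r : ℝ) : s ^ (r : ℂ) ≠ 0 := by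
  rw [Complex.cpow_def_of_ne_zero hs]; exact Complex.exp_ne_zero _

lemma sct_bd (hn : 1 ≤ n) {s : ℂ} (h : sct n s) :
    -(π/2) < (n / 2 : ℝ) * s.arg ∧ (n / 2 : ℝ) * s.arg < π / 2 := by
  have hn' : (0 : ℝ) < n := by exact_mod_cast hn
  have h2 := h.2
  rw [lt_div_iff₀ hn', ] at h2
  obtain ⟨h3, h4⟩ := abs_lt.1 (show |s.arg * n| < π by rw [abs_mul, abs_of_pos hn']; exact h2)
  constructor <;> linarith

lemma rt_arg (hn : 1 ≤ n) {s : ℂ} (h : sct n s) : (rt n s).arg = (n / 2 : ℝ) * s.arg := by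
  obtain ⟨h1, h2⟩ := sct_bd hn h
  have := Real.pi_pos
  exact arg_cpow_real h.1 (by linarith) (by linarith)

lemma rt_ne {s : ℂ} (h : s ≠ 0) : rt n s ≠ 0 := cpow_real_ne h _

lemma re_pos_iff {a : ℂ} (h : a ≠ 0) : 0 < a.re ↔ |a.arg| < π / 2 := by
  rw [Complex.abs_arg_lt_pi_div_two_iff]; simp [h]

lemma rt_re (hn : 1 ≤ n) {s : ℂ} (h : sct n s) : 0 < (rt n s).re := by
  rw [re_pos_iff (rt_ne h.1), rt_arg hn h, abs_lt]
  exact sct_bd hn h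

lemma rt_sq (s : ℂ) : rt n s ^ 2 = s ^ n := by
  unfold rt
  rw [← Complex.cpow_nat_mul]
  have : ((2 : ℕ) : ℂ) * ((n / 2 : ℝ) : ℂ) = (n : ℂ) := by push_cast; ring
  rw [this, Complex.cpow_natCast]

lemma log_mul_im (x : ℂ) (r : ℝ) : (Complex.log x * (r : ℂ)).im = r * x.arg := by
  rw [mul_comm, Complex.im_ofReal_mul, Complex.log_im]

lemma rti_rt (hn : 1 ≤ n) {s : ℂ} (h : sct n s) : rti n (rt n s) = s := by
  obtain ⟨h1, h2⟩ := sct_bd hn h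
  have := Real.pi_pos
  have hn' : (n : ℂ) ≠ 0 := by exact_mod_cast (by omega : n ≠ 0)
  unfold rti rt
  rw [← Complex.cpow_mul]
  · have : ((n / 2 : ℝ) : ℂ) * ((2 / n : ℝ) : ℂ) = 1 := by push_cast; field_simp
    rw [this, Complex.cpow_one]
  · rw [log_mul_im]; linarith
  · rw [log_mul_im]; linarith

lemma rti_bd (hn : 1 ≤ n) {a : ℂ} (h : 0 < a.re) :
    -(π/n) < (2 / n : ℝ) * a.arg ∧ (2 / n : ℝ) * a.arg < π / n := by
  have hn' : (0 : ℝ) < n := by exact_mod_cast hn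
  have h0 : a ≠ 0 := by rintro rfl; simp at h
  rw [re_pos_iff h0, abs_lt] at h
  constructor
  · rw [neg_lt, ← mul_neg, div_mul_eq_mul_div]; gcongr; linarith
  · rw [div_mul_eq_mul_div]; gcongr; linarith

lemma pi_n_le (hn : 1 ≤ n) : π / n ≤ π := div_le_self Real.pi_pos.le (by exact_mod_cast hn)

lemma sct_rti (hn : 1 ≤ n) {a : ℂ} (h : 0 < a.re) : sct n (rti n a) := by
  have h0 : a ≠ 0 := by rintro rfl; simp at h
  obtain ⟨h1, h2⟩ := rti_bd hn h
  have := pi_n_le hn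
  refine ⟨cpow_real_ne h0 _, ?_⟩
  unfold rti
  rw [arg_cpow_real h0 (by linarith) (by linarith), abs_lt]
  exact ⟨h1, h2⟩

lemma rt_rti (hn : 1 ≤ n) {a : ℂ} (h : 0 < a.re) : rt n (rti n a) = a := by
  obtain ⟨h1, h2⟩ := rti_bd hn h
  have := pi_n_le hn
  have hn' : (n : ℂ) ≠ 0 := by exact_mod_cast (by omega : n ≠ 0)
  unfold rti rt
  rw [← Complex.cpow_mul]
  · have : ((2 / n : ℝ) : ℂ) * ((n / 2 : ℝ) : ℂ) = 1 := by push_cast; field_simp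
    rw [this, Complex.cpow_one]
  · rw [log_mul_im]; linarith
  · rw [log_mul_im]; linarith

lemma rt_cont (hn : 1 ≤ n) {s : ℂ} (h : sct n s) : ContinuousAt (rt n) s :=
  continuousAt_cpow_const (sct_slit hn h)

lemma rti_cont {a : ℂ} (h : 0 < a.re) : ContinuousAt (rti n) a :=
  continuousAt_cpow_const (Or.inl h)

lemma sct_near (hn : 1 ≤ n) {s : ℂ} (h : sct n s) : ∀ᶠ v in 𝓝 s, sct n v := by
  have c : ContinuousAt (fun v : ℂ => |v.arg|) s :=
    (Complex.continuousAt_arg (sct_slit hn h)).abs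
  filter_upwards [isOpen_ne.mem_nhds h.1, c.eventually (isOpen_Iio.mem_nhds h.2)] with v h1 h2
  exact ⟨h1, h2⟩

/-- angular coordinate of a point of the sector, together with its polar data -/
lemma sct_HT (hn : 1 ≤ n) {s : ℂ} (h : sct n s) :
    ∃ τ : ℝ, HT n s τ ∧ |τ| < 1/2 ∧
      rt n s = (‖rt n s‖ : ℂ) * Complex.exp ((π * τ : ℝ) * I) ∧ 0 < ‖rt n s‖ := by
  refine ⟨_, HT_arg hn h.1, ?_, ?_, norm_pos_iff.2 (rt_ne h.1)⟩
  · have hn' : (0 : ℝ) < n := by exact_mod_cast hn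
    have h2 := h.2
    have hp := Real.pi_pos
    rw [abs_div, abs_mul, abs_of_pos hn', abs_of_pos (by positivity : 0 < 2 * π), div_lt_div_iff₀
      (by positivity) (by positivity)]
    rw [lt_div_iff₀ hn'] at h2
    linarith
  · have : π * (n * s.arg / (2 * π)) = (n / 2 : ℝ) * s.arg := by
      have := Real.pi_pos; field_simp
    rw [this, ← rt_arg hn h]
    exact (Complex.norm_mul_exp_arg_mul_I _).symm

end CN
end

end

section

open Topology Set
noncomputable section
namespace CN

open ComplexConjugate
open Complex (I)
open scoped Real

variable {n : ℕ}

def om (n : ℕ) (i : ZMod n) : ℂ := Complex.exp (((2 * π * (i.val : ℝ) / n : ℝ) : ℂ) * I)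

lemma om_ne (i : ZMod n) : om n i ≠ 0 := Complex.exp_ne_zero _

lemma HT_om (i : ZMod n) : HT n (om n i) i.val := by
  have := HT_exp (n := n) 1 (i.val : ℝ) one_pos
  simpa [om] using this

lemma norm_om (i : ZMod n) : ‖om n i‖ = 1 := Complex.norm_exp_ofReal_mul_I _

lemma om_pow (hn : 1 ≤ n) (i : ZMod n) : om n i ^ n = 1 := by
  rw [HT_pow hn (HT_om i), norm_om, one_pow, Complex.ofReal_one, one_mul]
  rw [Complex.exp_eq_one_iff]
  exact ⟨i.val, by push_cast; ring⟩

def sA (O : ZMod n × ZMod n) (u : Fin 3 → ℂ) : ℂ := u 0 / u 2 * (om n O.1)⁻¹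
def sB (O : ZMod n × ZMod n) (u : Fin 3 → ℂ) : ℂ := u 1 / u 2 * (om n O.2)⁻¹

def Av (O : ZMod n × ZMod n) (u : Fin 3 → ℂ) : Fin 3 → ℂ := ![rt n (sA O u), rt n (sB O u), 1]

/-- strict triangle inequalities -/
def TT (a b : ℂ) : Prop := a.re < b.re + 1 ∧ b.re < a.re + 1 ∧ 1 < a.re + b.re

lemma TT.pos1 {a b : ℂ} (h : TT a b) : 0 < a.re := by obtain ⟨h1, h2, h3⟩ := h; linarith
lemma TT.pos2 {a b : ℂ} (h : TT a b) : 0 < b.re := by obtain ⟨h1, h2, h3⟩ := h; linarith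

def VV (O : ZMod n × ZMod n) (u : Fin 3 → ℂ) : Prop :=
  u 2 ≠ 0 ∧ sct n (sA O u) ∧ sct n (sB O u) ∧ TT (rt n (sA O u)) (rt n (sB O u))

def cc (O : ZMod n × ZMod n) (m : Fin 3) (u : Fin 3 → ℂ) : ℝ := jj m (Av O u)

lemma sA_smul {c : ℂ} (hc : c ≠ 0) (O : ZMod n × ZMod n) (u : Fin 3 → ℂ) :
    sA O (c • u) = sA O u := by
  unfold sA; simp only [Pi.smul_apply, smul_eq_mul]; rw [mul_div_mul_left _ _ hc]

lemma sB_smul {c : ℂ} (hc : c ≠ 0) (O : ZMod n × ZMod n) (u : Fin 3 → ℂ) :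
    sB O (c • u) = sB O u := by
  unfold sB; simp only [Pi.smul_apply, smul_eq_mul]; rw [mul_div_mul_left _ _ hc]

lemma Av_smul {c : ℂ} (hc : c ≠ 0) (O : ZMod n × ZMod n) (u : Fin 3 → ℂ) :
    Av O (c • u) = Av O u := by
  unfold Av; rw [sA_smul hc, sB_smul hc]

lemma cc_smul {c : ℂ} (hc : c ≠ 0) (O : ZMod n × ZMod n) (m : Fin 3) (u : Fin 3 → ℂ) :
    cc O m (c • u) = cc O m u := by
  unfold cc; rw [Av_smul hc]

lemma VV_smul {c : ℂ} (hc : c ≠ 0) (O : ZMod n × ZMod n) (u : Fin 3 → ℂ) :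
    VV O (c • u) ↔ VV O u := by
  unfold VV; rw [sA_smul hc, sB_smul hc]; simp [hc]

/-- the chart -/
def Ph (O : ZMod n × ZMod n) (a b : ℂ) : Fin 3 → ℂ := ![om n O.1 * rti n a, om n O.2 * rti n b, 1]

lemma sA_Ph (O : ZMod n × ZMod n) (a b : ℂ) : sA O (Ph O a b) = rti n a := by
  have := om_ne O.1
  simp only [sA, Ph, Matrix.cons_val_zero, Matrix.cons_val, div_one]
  field_simp

lemma sB_Ph (O : ZMod n × ZMod n) (a b : ℂ) : sB O (Ph O a b) = rti n b := by
  have := om_ne O.2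
  simp only [sB, Ph, Matrix.cons_val_one, Matrix.cons_val, div_one]
  field_simp

lemma Av_Ph (hn : 1 ≤ n) (O : ZMod n × ZMod n) {a b : ℂ} (h : TT a b) :
    Av O (Ph O a b) = ![a, b, 1] := by
  unfold Av; rw [sA_Ph, sB_Ph, rt_rti hn h.pos1, rt_rti hn h.pos2]

lemma VV_Ph (hn : 1 ≤ n) (O : ZMod n × ZMod n) {a b : ℂ} (h : TT a b) : VV O (Ph O a b) := by
  unfold VV
  rw [sA_Ph, sB_Ph, rt_rti hn h.pos1, rt_rti hn h.pos2]
  exact ⟨by simp [Ph], sct_rti hn h.pos1, sct_rti hn h.pos2, h⟩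

lemma Ph_Av (hn : 1 ≤ n) {O : ZMod n × ZMod n} {u : Fin 3 → ℂ} (h : VV O u) :
    u 2 • Ph O (rt n (sA O u)) (rt n (sB O u)) = u := by
  obtain ⟨h0, h1, h2, h3⟩ := h
  unfold Ph
  rw [rti_rt hn h1, rti_rt hn h2]
  have := om_ne O.1
  have := om_ne O.2
  ext i
  fin_cases i <;> simp [sA, sB] <;> field_simp

lemma VV_near (hn : 1 ≤ n) {O : ZMod n × ZMod n} {u : Fin 3 → ℂ} (h : VV O u) :
    ContinuousAt (fun v => rt n (sA O v)) u ∧ ContinuousAt (fun v => rt n (sB O v)) u ∧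
      ∀ᶠ v in 𝓝 u, VV O v := by
  obtain ⟨h0, h1, h2, h3⟩ := h
  have c0 : ContinuousAt (sA O) u := by
    have : ContinuousAt (fun v : Fin 3 → ℂ => v 0 / v 2) u :=
      ContinuousAt.div (continuous_apply _).continuousAt (continuous_apply _).continuousAt h0
    exact this.mul continuousAt_const
  have c1 : ContinuousAt (sB O) u := by
    have : ContinuousAt (fun v : Fin 3 → ℂ => v 1 / v 2) u :=
      ContinuousAt.div (continuous_apply _).continuousAt (continuous_apply _).continuousAt h0
    exact this.mul continuousAt_const
  have d0 : ContinuousAt (fun v => rt n (sA O v)) u :=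
    ContinuousAt.comp (g := rt n) (rt_cont hn h1) c0
  have d1 : ContinuousAt (fun v => rt n (sB O v)) u :=
    ContinuousAt.comp (g := rt n) (rt_cont hn h2) c1
  refine ⟨d0, d1, ?_⟩
  have e0 : ContinuousAt (fun v => (rt n (sA O v)).re) u := Complex.continuous_re.continuousAt.comp d0
  have e1 : ContinuousAt (fun v => (rt n (sB O v)).re) u := Complex.continuous_re.continuousAt.comp d1
  obtain ⟨t1, t2, t3⟩ := h3
  filter_upwards [(continuous_apply (2 : Fin 3)).continuousAt.eventually (isOpen_ne.mem_nhds h0),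
    c0.eventually (sct_near hn h1), c1.eventually (sct_near hn h2),
    e0.eventually_lt (e1.add continuousAt_const) t1,
    e1.eventually_lt (e0.add continuousAt_const) t2,
    continuousAt_const.eventually_lt (e0.add e1) t3] with v g1 g2 g3 g4 g5 g6
  exact ⟨g1, g2, g3, g4, g5, g6⟩

lemma cc_near (hn : 1 ≤ n) {O : ZMod n × ZMod n} {u : Fin 3 → ℂ} (h : VV O u) (m : Fin 3) :
    ContinuousAt (cc O m) u := by
  obtain ⟨h0, h1, -⟩ := VV_near hn h
  unfold cc jj Av
  have : ∀ i : Fin 3, ContinuousAt (fun v => (![rt n (sA O v), rt n (sB O v), 1] : Fin 3 → ℂ) i) u := by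
    intro i
    fin_cases i
    · exact h0
    · exact h1
    · exact continuousAt_const
  exact Complex.continuous_im.continuousAt.comp
    ((this (m+1)).mul (Complex.continuous_conj.continuousAt.comp (this (m+2))))

/-- real parts -/
def rr (O : ZMod n × ZMod n) (m : Fin 3) (u : Fin 3 → ℂ) : ℝ := (Av O u m).re

lemma VV_rr {O : ZMod n × ZMod n} {u : Fin 3 → ℂ} (h : VV O u) (m : Fin 3) :
    0 < rr O m u ∧ rr O m u < rr O (m+1) u + rr O (m+2) u ∧
    rr O (m+1) u < rr O m u + rr O (m+2) u ∧ rr O (m+2) u < rr O m u + rr O (m+1) u := by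
  obtain ⟨-, -, -, t1, t2, t3⟩ := h
  fin_cases m <;> simp [rr, Av] <;> (repeat' constructor) <;> linarith

lemma cc_sum (O : ZMod n × ZMod n) (u : Fin 3 → ℂ) (m : Fin 3) :
    cc O m u * rr O m u + cc O (m+1) u * rr O (m+1) u + cc O (m+2) u * rr O (m+2) u = 0 := by
  have := congrArg Complex.re (jj_sum m (Av O u))
  simpa [rr, cc] using this

lemma cc_data (hn : 1 ≤ n) {O : ZMod n × ZMod n} {u : Fin 3 → ℂ} (h : VV O u) :
    ∃ κ : ℝ, 0 < κ ∧ (∀ m, ao n m u = κ * cc O m u ^ 2) ∧ ∃ μ : ℝ, 0 < μ ∧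
      ∀ m, sq n m u = μ * ‖Av O u m‖ := by
  obtain ⟨μ, hμ⟩ := IsAlgClosed.exists_pow_nat_eq (u 2 ^ n) (n := 2) (by norm_num)
  have h0 := h.1
  have hμ0 : μ ≠ 0 := by
    rintro rfl
    rw [zero_pow (by norm_num)] at hμ
    exact pow_ne_zero n h0 hμ.symm
  have hA : ∀ i, (μ • Av O u) i ^ 2 = Pw n u i := by
    intro i
    have p1 := om_pow hn O.1
    have p2 := om_pow hn O.2
    fin_cases i <;> simp [Av, mul_pow, hμ, Pw, rt_sq, sA, sB, div_pow, p1, p2] <;> field_simp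
  refine ⟨2 * (‖μ‖^2)^2, by positivity, fun m => ?_, ‖μ‖, by positivity, fun m => ?_⟩
  · rw [ao_root hA]
    have : jj m (μ • Av O u) = ‖μ‖^2 * cc O m u := by
      unfold cc jj
      have e : (μ • Av O u) (m+1) * conj ((μ • Av O u) (m+2)) =
        ((‖μ‖^2 : ℝ) : ℂ) * (Av O u (m+1) * conj (Av O u (m+2))) := by
        have : ((‖μ‖^2 : ℝ) : ℂ) = μ * conj μ := by rw [Complex.mul_conj']; push_cast; rfl
        rw [this]; simp; ring
      rw [e, Complex.im_ofReal_mul]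
    rw [this]; ring
  · rw [sq_root hA]; simp

lemma real_lem {r0 r1 r2 c0 c1 c2 : ℝ} (h0 : 0 < r0) (h1 : r0 < r1 + r2) (h2 : r1 < r0 + r2)
    (h3 : r2 < r0 + r1) (hs : c0 * r0 + c1 * r1 + c2 * r2 = 0) :
    (c1^2 = c2^2 ∧ c2^2 ≤ c0^2) ↔ c1 = c2 := by
  constructor
  · rintro ⟨h4, h5⟩
    rcases sq_eq_sq_iff_eq_or_eq_neg.1 h4 with h | h
    · exact h
    · have e : c0 * r0 = c2 * (r1 - r2) := by rw [h] at hs; linarith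
      have e2 : c0^2 * r0^2 = c2^2 * (r1-r2)^2 := by rw [← mul_pow, e, mul_pow]
      have l : (r1-r2)^2 < r0^2 := by
        rw [sq_lt_sq, abs_of_pos h0, abs_lt]; constructor <;> linarith
      by_contra hne
      have hc : c2 ≠ 0 := fun h0 => hne (by rw [h, h0]; simp)
      have : c2^2 * (r1-r2)^2 < c2^2 * r0^2 := mul_lt_mul_of_pos_left l (by positivity)
      have : c2^2 * r0^2 ≤ c0^2 * r0^2 := mul_le_mul_of_nonneg_right h5 (by positivity)
      linarith
  · rintro rfl
    refine ⟨rfl, ?_⟩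
    have e : c0 * r0 = -(c1 * (r1 + r2)) := by linarith
    have e2 : c0^2 * r0^2 = c1^2 * (r1+r2)^2 := by rw [← mul_pow, e, neg_sq, mul_pow]
    have l : r0^2 ≤ (r1+r2)^2 := by
      rw [sq_le_sq, abs_of_pos h0, abs_of_pos (by linarith)]; linarith
    have : c1^2 * r0^2 ≤ c1^2 * (r1+r2)^2 := mul_le_mul_of_nonneg_left l (by positivity)
    exact le_of_mul_le_mul_right (by linarith : c1^2 * r0^2 ≤ c0^2 * r0^2) (by positivity)

lemma fin3_cases : ∀ m k : Fin 3, m = k ∨ m = k+1 ∨ m = k+2 := by decide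

lemma UC_cc (hn : 1 ≤ n) {O : ZMod n × ZMod n} {u : Fin 3 → ℂ} (h : VV O u) (k : Fin 3) :
    UC n k u ↔ cc O (k+1) u ≠ cc O (k+2) u := by
  obtain ⟨κ, hκ, hao, μ, hμ, hsq⟩ := cc_data hn h
  obtain ⟨r0, r1, r2, r3⟩ := VV_rr h k
  have key : (ao n (k+1) u = ao n (k+2) u ∧ ao n (k+2) u ≤ ao n k u) ↔ cc O (k+1) u = cc O (k+2) u := by
    rw [← real_lem r0 r1 r2 r3 (cc_sum O u k), hao, hao, hao, mul_right_inj' hκ.ne',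
      mul_le_mul_iff_right₀ hκ]
  unfold UC
  rw [key]
  constructor
  · rintro (h1 | h1) he
    · exact h1 he
    · obtain ⟨g1, g2⟩ := key.2 he
      have z0 := B_zero h1 g1 g2
      have z2 : ao n (k+2) u = 0 := le_antisymm (by linarith) (ao_nonneg _ _)
      have z1 : ao n (k+1) u = 0 := by rw [g1, z2]
      have hz : ∀ m, ao n m u = 0 → cc O m u = 0 := by
        intro m hm
        rw [hao] at hm
        have := (mul_eq_zero.1 hm).resolve_left hκ.ne'
        exact pow_eq_zero_iff (two_ne_zero) |>.1 this
      have zall : ∀ m, cc O m u = 0 := by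
        intro m
        have : m = k ∨ m = k+1 ∨ m = k+2 := fin3_cases m k
        rcases this with rfl | rfl | rfl
        · exact hz _ z0
        · exact hz _ z1
        · exact hz _ z2
      have hb := zall 0
      have ha := zall 1
      simp [cc, jj, Av] at ha hb
      have hre : ∀ m, ‖Av O u m‖ = rr O m u := by
        intro m
        have him : (Av O u m).im = 0 := by fin_cases m <;> simp [Av, ha, hb]
        have hp := (VV_rr h m).1
        unfold rr at hp ⊢
        have e : Av O u m = ((Av O u m).re : ℂ) := by apply Complex.ext <;> simp [him]
        rw [e, Complex.norm_real, Real.norm_eq_abs, Complex.ofReal_re, abs_of_pos hp]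
      rw [hsq, hsq, hsq, hre, hre, hre, ← mul_add] at h1
      have := lt_of_mul_lt_mul_left h1 hμ.le
      linarith
  · exact Or.inl

lemma real_max {r0 r1 r2 c0 c1 c2 : ℝ} (h0 : 0 < r0) (h1 : r0 < r1 + r2) (h2 : r1 < r0 + r2)
    (h3 : r2 < r0 + r1) (hs : c0 * r0 + c1 * r1 + c2 * r2 = 0) (g1 : c1 < c0) (g2 : c2 < c0) :
    0 < c0 ∧ min (c1^2) (c2^2) < c0^2 := by
  have p1 : 0 < r1 := by linarith
  have p2 : 0 < r2 := by linarith
  have hc : 0 < c0 := by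
    by_contra hcon
    have := mul_nonpos_of_nonpos_of_nonneg (not_lt.1 hcon) h0.le
    have := mul_neg_of_neg_of_pos (by linarith : c1 < 0) p1
    have := mul_neg_of_neg_of_pos (by linarith : c2 < 0) p2
    linarith
  refine ⟨hc, ?_⟩
  by_contra hcon
  rw [not_lt, le_min_iff] at hcon
  obtain ⟨k1, k2⟩ := hcon
  have q1 : c1 ≤ -c0 := by
    by_contra hh; push Not at hh; have := sq_lt_sq' hh g1; linarith
  have q2 : c2 ≤ -c0 := by
    by_contra hh; push Not at hh; have := sq_lt_sq' hh g2; linarith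
  have := mul_le_mul_of_nonneg_right q1 p1.le
  have := mul_le_mul_of_nonneg_right q2 p2.le
  have := mul_lt_mul_of_pos_left h1 hc
  linarith

lemma real_med {r0 r1 r2 c0 c1 c2 : ℝ} (_h0 : 0 < r0) (h1 : r0 < r1 + r2) (h2 : r1 < r0 + r2)
    (h3 : r2 < r0 + r1) (hs : c0 * r0 + c1 * r1 + c2 * r2 = 0) (g1 : c1 < c0) (g2 : c0 < c2) :
    c1 < 0 ∧ 0 < c2 ∧ c0^2 < min (c1^2) (c2^2) := by
  have p1 : 0 < r1 := by linarith
  have p2 : 0 < r2 := by linarith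
  have q1 : c1 < -c0 := by
    by_contra hcon
    push Not at hcon
    have a1 := mul_le_mul_of_nonneg_right hcon p1.le
    have a2 := mul_lt_mul_of_pos_right g2 p2
    have : 0 < c0 := by linarith
    have := mul_lt_mul_of_pos_left h2 this
    linarith
  have q2 : -c0 < c2 := by
    by_contra hcon
    push Not at hcon
    have a1 := mul_le_mul_of_nonneg_right hcon p2.le
    have a2 := mul_lt_mul_of_pos_right g1 p1
    have : 0 < -c0 := by linarith
    have := mul_lt_mul_of_pos_left h3 this
    linarith
  refine ⟨by linarith, by linarith, lt_min ?_ ?_⟩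
  · rw [sq_lt_sq, abs_of_neg (by linarith : c1 < 0), abs_lt]; constructor <;> linarith
  · rw [sq_lt_sq, abs_of_pos (by linarith : 0 < c2), abs_lt]; constructor <;> linarith

lemma V_max (hn : 1 ≤ n) {O : ZMod n × ZMod n} {u : Fin 3 → ℂ} (h : VV O u) {m : Fin 3}
    (g1 : cc O (m+1) u < cc O m u) (g2 : cc O (m+2) u < cc O m u) : AA n m u ∧ 0 < cc O m u := by
  obtain ⟨κ, hκ, hao, -⟩ := cc_data hn h
  obtain ⟨r0, r1, r2, r3⟩ := VV_rr h m
  obtain ⟨k1, k2⟩ := real_max r0 r1 r2 r3 (cc_sum O u m) g1 g2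
  refine ⟨?_, k1⟩
  unfold AA
  rw [hao, hao, hao, ← mul_min_of_nonneg _ _ hκ.le]
  exact mul_lt_mul_of_pos_left k2 hκ

lemma V_min (hn : 1 ≤ n) {O : ZMod n × ZMod n} {u : Fin 3 → ℂ} (h : VV O u) {m : Fin 3}
    (g1 : cc O m u < cc O (m+1) u) (g2 : cc O m u < cc O (m+2) u) : AA n m u ∧ cc O m u < 0 := by
  obtain ⟨κ, hκ, hao, -⟩ := cc_data hn h
  obtain ⟨r0, r1, r2, r3⟩ := VV_rr h m
  obtain ⟨k1, k2⟩ := real_max (c0 := -cc O m u) (c1 := -cc O (m+1) u) (c2 := -cc O (m+2) u)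
    r0 r1 r2 r3 (by linarith [cc_sum O u m]) (by linarith) (by linarith)
  refine ⟨?_, by linarith⟩
  unfold AA
  rw [hao, hao, hao, ← mul_min_of_nonneg _ _ hκ.le]
  simp only [neg_sq] at k2
  exact mul_lt_mul_of_pos_left k2 hκ

lemma V_med (hn : 1 ≤ n) {O : ZMod n × ZMod n} {u : Fin 3 → ℂ} (h : VV O u) {m : Fin 3}
    (g1 : cc O (m+1) u < cc O m u) (g2 : cc O m u < cc O (m+2) u) :
    EE n m u ∧ cc O (m+1) u < 0 ∧ 0 < cc O (m+2) u := by
  obtain ⟨κ, hκ, hao, -⟩ := cc_data hn h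
  obtain ⟨r0, r1, r2, r3⟩ := VV_rr h m
  obtain ⟨k1, k2, k3⟩ := real_med r0 r1 r2 r3 (cc_sum O u m) g1 g2
  refine ⟨?_, k1, k2⟩
  unfold EE
  rw [hao, hao, hao, ← mul_min_of_nonneg _ _ hκ.le]
  exact mul_lt_mul_of_pos_left k3 hκ

lemma V_med' (hn : 1 ≤ n) {O : ZMod n × ZMod n} {u : Fin 3 → ℂ} (h : VV O u) {m : Fin 3}
    (g1 : cc O m u < cc O (m+1) u) (g2 : cc O (m+2) u < cc O m u) :
    EE n m u ∧ 0 < cc O (m+1) u ∧ cc O (m+2) u < 0 := by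
  obtain ⟨κ, hκ, hao, -⟩ := cc_data hn h
  obtain ⟨r0, r1, r2, r3⟩ := VV_rr h m
  obtain ⟨k1, k2, k3⟩ := real_med (c0 := -cc O m u) (c1 := -cc O (m+1) u) (c2 := -cc O (m+2) u)
    r0 r1 r2 r3 (by linarith [cc_sum O u m]) (by linarith) (by linarith)
  refine ⟨?_, by linarith, by linarith⟩
  unfold EE
  rw [hao, hao, hao, ← mul_min_of_nonneg _ _ hκ.le]
  simp only [neg_sq] at k3
  exact mul_lt_mul_of_pos_left k3 hκ

lemma AA_not_EE {m : Fin 3} {u : Fin 3 → ℂ} (h : AA n m u) : ¬ EE n m u := by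
  unfold AA EE at *; exact not_lt.2 h.le


def oo (O : ZMod n × ZMod n) : Fin 3 → ZMod n := ![O.2, -O.1, O.1 - O.2]

lemma zval [NeZero n] (i : ZMod n) : ((i.val : ℤ) : ZMod n) = i := by simp

lemma floor_shift (k : ℤ) {τ : ℝ} (h : |τ| < 1) :
    (0 < τ → ⌊(k : ℝ) + τ⌋ = k) ∧ (τ < 0 → ⌊(k : ℝ) + τ⌋ = k - 1) := by
  rw [abs_lt] at h
  constructor
  · intro h0
    rw [Int.floor_eq_iff]; constructor <;> linarith
  · intro h0
    rw [Int.floor_eq_iff]; push_cast; constructor <;> linarith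

lemma VV_HT (hn : 1 ≤ n) {O : ZMod n × ZMod n} {u : Fin 3 → ℂ} (h : VV O u) :
    ∃ τ σ : ℝ, |τ| < 1/2 ∧ |σ| < 1/2 ∧ HT n (u 0 / u 2) (O.1.val + τ) ∧
      HT n (u 1 / u 2) (O.2.val + σ) ∧
      (∃ r > 0, cc O 0 u = r * Real.sin (π * σ)) ∧
      (∃ r > 0, cc O 1 u = -(r * Real.sin (π * τ))) ∧
      (∃ r > 0, cc O 2 u = r * Real.sin (π * (τ - σ))) := by
  obtain ⟨h0, h1, h2, h3⟩ := h
  obtain ⟨τ, t1, t2, t3, t4⟩ := sct_HT hn h1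
  obtain ⟨σ, s1, s2, s3, s4⟩ := sct_HT hn h2
  refine ⟨τ, σ, t2, s2, ?_, ?_, ⟨_, s4, ?_⟩, ⟨_, t4, ?_⟩, ⟨_, mul_pos t4 s4, ?_⟩⟩
  · have := HT_mul (HT_om O.1) t1
    rwa [sA, mul_comm (u 0 / u 2), mul_inv_cancel_left₀ (om_ne _)] at this
  · have := HT_mul (HT_om O.2) s1
    rwa [sB, mul_comm (u 1 / u 2), mul_inv_cancel_left₀ (om_ne _)] at this
  · have : cc O 0 u = (rt n (sB O u)).im := by simp [cc, jj, Av]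
    rw [this, ← Complex.exp_ofReal_mul_I_im, ← Complex.im_ofReal_mul, ← s3]
  · have : cc O 1 u = -(rt n (sA O u)).im := by simp [cc, jj, Av]
    rw [this, ← Complex.exp_ofReal_mul_I_im, ← Complex.im_ofReal_mul, ← t3]
  · have : cc O 2 u = (rt n (sA O u) * conj (rt n (sB O u))).im := by simp [cc, jj, Av]
    rw [this, ← Complex.exp_ofReal_mul_I_im, ← Complex.im_ofReal_mul]
    congr 1
    conv_lhs => rw [t3, s3]
    rw [map_mul, ← Complex.exp_conj, Complex.conj_ofReal, map_mul, Complex.conj_ofReal,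
      Complex.conj_I]
    have e : ((π * (τ - σ) : ℝ) : ℂ) * I = ((π * τ : ℝ) : ℂ) * I + ((π * σ : ℝ) : ℂ) * -I := by
      push_cast; ring
    rw [e, Complex.exp_add]
    push_cast; ring

lemma sin_pi_pos {τ : ℝ} (h : |τ| < 1) : (0 < Real.sin (π * τ) ↔ 0 < τ) ∧
    (Real.sin (π * τ) < 0 ↔ τ < 0) := by
  rw [abs_lt] at h
  have hp := Real.pi_pos
  have a1 : 0 < τ → 0 < Real.sin (π * τ) := fun h0 =>
    Real.sin_pos_of_pos_of_lt_pi (by positivity) (by nlinarith)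
  have a2 : τ < 0 → Real.sin (π * τ) < 0 := fun h0 =>
    Real.sin_neg_of_neg_of_neg_pi_lt (by nlinarith) (by nlinarith)
  rcases lt_trichotomy τ 0 with h0 | h0 | h0
  · have := a2 h0
    constructor <;> constructor <;> intro <;> first | assumption | (exfalso; linarith)
  · subst h0; simp
  · have := a1 h0
    constructor <;> constructor <;> intro <;> first | assumption | (exfalso; linarith)

lemma mul_neg_iff_pos {r x : ℝ} (hr : 0 < r) : r * x < 0 ↔ x < 0 := by
  rw [mul_neg_iff]; constructor
  · rintro (h | h) <;> [exact h.2; linarith [h.1]]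
  · exact fun h => Or.inl ⟨hr, h⟩

lemma ar_V (hn : 1 ≤ n) {O : ZMod n × ZMod n} {u : Fin 3 → ℂ} (h : VV O u) (m : Fin 3) :
    (0 < cc O m u → ar n m u = oo O m) ∧ (cc O m u < 0 → ar n m u = oo O m - 1) := by
  have : NeZero n := ⟨by omega⟩
  obtain ⟨τ, σ, t1, t2, H1, H2, ⟨r0, p0, c0⟩, ⟨r1, p1, c1⟩, ⟨r2, p2, c2⟩⟩ := VV_HT hn h
  have key : ∀ (k : ℤ) (ρ r : ℝ), |ρ| < 1 → 0 < r → cc O m u = r * Real.sin (π * ρ) →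
      HT n (u (m+1) / u (m+2)) ((k : ℝ) + ρ) → (k : ZMod n) = oo O m →
      (0 < cc O m u → ar n m u = oo O m) ∧ (cc O m u < 0 → ar n m u = oo O m - 1) := by
    intro k ρ r hρ hr hc hH hk
    rw [hc, mul_pos_iff_of_pos_left hr, (sin_pi_pos hρ).1, mul_neg_iff_pos hr, (sin_pi_pos hρ).2]
    unfold ar
    rw [arc_eq hn hH]
    constructor <;> intro h0
    · rw [(floor_shift k hρ).1 h0, hk]
    · rw [(floor_shift k hρ).2 h0]; push_cast; rw [hk]
  have u2 := h.1
  have habs : |τ - σ| < 1 := by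
    rw [abs_lt] at t1 t2 ⊢; constructor <;> linarith
  fin_cases m
  · exact key O.2.val σ r0 (by linarith) p0 c0 (by simpa using H2) (by simp [oo])
  · refine key (-O.1.val) (-τ) r1 (by rw [abs_neg]; linarith) p1 ?_ ?_ (by simp [oo])
    · rw [mul_neg, Real.sin_neg, mul_neg]; exact c1
    · have := HT_inv H1
      rw [inv_div] at this
      have e : (((-O.1.val : ℤ) : ℝ) + -τ) = -(O.1.val + τ) := by push_cast; ring
      rw [e]; exact this
  · refine key (O.1.val - O.2.val) (τ - σ) r2 habs p2 c2 ?_ (by simp [oo])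
    have := HT_div H1 H2
    have e : u 0 / u 2 / (u 1 / u 2) = u 0 / u 1 := div_div_div_cancel_right₀ u2 _ _
    rw [e] at this
    have e : (((O.1.val - O.2.val : ℤ) : ℝ) + (τ - σ)) = O.1.val + τ - (O.2.val + σ) := by
      push_cast; ring
    rw [e]; exact this

lemma VV_disj (hn : 1 ≤ n) {O O' : ZMod n × ZMod n} {u : Fin 3 → ℂ} (h : VV O u) (h' : VV O' u) :
    O = O' := by
  have : NeZero n := ⟨by omega⟩
  obtain ⟨τ, σ, t1, t2, H1, H2, -⟩ := VV_HT hn h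
  obtain ⟨τ', σ', t1', t2', H1', H2', -⟩ := VV_HT hn h'
  have key : ∀ (s : ℂ) (i i' : ZMod n) (τ τ' : ℝ), |τ| < 1/2 → |τ'| < 1/2 → HT n s (i.val + τ) →
      HT n s (i'.val + τ') → i = i' := by
    intro s i i' τ τ' h1 h2 h3 h4
    obtain ⟨k, hk⟩ := HT_unique hn h3 h4
    rw [abs_lt] at h1 h2
    have e : (i'.val : ℤ) - i.val - k * n = 0 := by
      have a1 : ((i'.val : ℤ) - i.val - k * n : ℤ) < 1 := by
        have : (((i'.val : ℤ) - i.val - k * n : ℤ) : ℝ) < 1 := by push_cast; linarith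
        exact_mod_cast this
      have a2 : -1 < ((i'.val : ℤ) - i.val - k * n : ℤ) := by
        have : (-1 : ℝ) < (((i'.val : ℤ) - i.val - k * n : ℤ) : ℝ) := by push_cast; linarith
        exact_mod_cast this
      omega
    have := congrArg (Int.cast : ℤ → ZMod n) e
    push_cast at this
    rw [ZMod.natCast_zmod_val, ZMod.natCast_zmod_val] at this
    simp at this
    exact (sub_eq_zero.1 this).symm
  exact Prod.ext (key _ _ _ _ _ t1 t1' H1 H1') (key _ _ _ _ _ t2 t2' H2 H2')

lemma GG_VV (hn : 1 ≤ n) {O : ZMod n × ZMod n} {u : Fin 3 → ℂ} (h : VV O u) : GG n u ≠ 0 := by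
  intro hG
  have hno : ∀ k, ¬ UC n k u := fun k hk => GG_ne_of_UC hk hG
  have hc : ∀ k, cc O (k+1) u = cc O (k+2) u := fun k => by
    have := hno k; rw [UC_cc hn h] at this; exact not_not.1 this
  obtain ⟨μ, hμ⟩ := IsAlgClosed.exists_pow_nat_eq (u 2 ^ n) (n := 2) (by norm_num)
  have h0 := h.1
  have hμ0 : μ ≠ 0 := by
    rintro rfl
    rw [zero_pow (by norm_num)] at hμ
    exact pow_ne_zero n h0 hμ.symm
  have hA : ∀ i, (μ • Av O u) i ^ 2 = Pw n u i := by
    intro i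
    have p1 := om_pow hn O.1
    have p2 := om_pow hn O.2
    fin_cases i <;> simp [Av, mul_pow, hμ, Pw, rt_sq, sA, sB, div_pow, p1, p2] <;> field_simp
  rw [GG_root hA] at hG
  obtain ⟨-, -, -, t1, t2, t3⟩ := h
  have fac : ∀ z : ℂ, z.re ≠ 0 → μ * z ≠ 0 := fun z hz => mul_ne_zero hμ0 fun h => hz (by simp [h])
  revert hG
  simp only [imp_false]
  refine mul_ne_zero (mul_ne_zero (mul_ne_zero ?_ ?_) ?_) ?_ <;>
    simp only [Pi.smul_apply, smul_eq_mul, ← mul_add, ← mul_sub] <;> apply fac <;> simp [Av]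
  all_goals intro hh; linarith

end CN
end

end

section

open Topology Set
noncomputable section
namespace CN

open ComplexConjugate
open Complex (I)
open scoped Real

variable {n : ℕ}

lemma collinear_of_ao {u : Fin 3 → ℂ} (h : ∀ m, ao n m u = 0) (i j : Fin 3) :
    Pw n u i * conj (Pw n u j) = ((‖Pw n u i‖ * ‖Pw n u j‖ : ℝ) : ℂ) := by
  have h1 : ∀ p q : ℂ, ‖p‖ * ‖q‖ - (p * conj q).re = 0 → p * conj q = ((‖p‖ * ‖q‖ : ℝ) : ℂ) := by
    intro p q h
    have e1 : (p * conj q).re = ‖p * conj q‖ := by rw [norm_mul, RCLike.norm_conj]; linarith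
    have e2 := (Complex.re_eq_norm).1 e1
    have e3 : (p * conj q).im = 0 := (Complex.nonneg_iff.1 e2).2.symm
    apply Complex.ext
    · rw [Complex.ofReal_re]; linarith
    · rw [Complex.ofReal_im, e3]
  have h2 : ∀ p q : ℂ, ‖p‖ * ‖q‖ - (p * conj q).re = 0 → q * conj p = ((‖q‖ * ‖p‖ : ℝ) : ℂ) := by
    intro p q h
    have := congrArg conj (h1 p q h)
    simp only [map_mul, Complex.conj_conj, Complex.conj_ofReal] at this
    rw [mul_comm, this, mul_comm]
  rcases fin3_cases j i with rfl | rfl | rfl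
  · rw [Complex.mul_conj']; push_cast; ring
  · have := h (i+2)
    unfold ao at this
    rw [i21, i22] at this
    exact h1 _ _ this
  · have := h (i+1)
    unfold ao at this
    rw [i11, i12] at this
    exact h2 _ _ this

lemma sq_mul_self (m : Fin 3) (u : Fin 3 → ℂ) : sq n m u ^ 2 = ‖Pw n u m‖ := by
  unfold sq; exact Real.sq_sqrt (norm_nonneg _)

lemma collinear_tri {u : Fin 3 → ℂ} (h : ∀ m, ao n m u = 0) (hG : GG n u ≠ 0)
    (ht : ∀ k, sq n k u ≤ sq n (k+1) u + sq n (k+2) u) (k : Fin 3) :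
    sq n k u < sq n (k+1) u + sq n (k+2) u := by
  have hex : ∃ k, Pw n u k ≠ 0 := by
    by_contra hcon
    push Not at hcon
    apply hG
    unfold GG; simp [hcon]
  obtain ⟨l, hl⟩ := hex
  obtain ⟨e, he⟩ := IsAlgClosed.exists_pow_nat_eq (Pw n u l / ‖Pw n u l‖) (n := 2) (by norm_num)
  have hA : ∀ i, (fun i => (sq n i u : ℂ) * e) i ^ 2 = Pw n u i := by
    intro i
    have c := collinear_of_ao h i l
    have c2 : Pw n u l * conj (Pw n u l) = (‖Pw n u l‖ : ℂ) ^ 2 := Complex.mul_conj' _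
    have hl' : (‖Pw n u l‖ : ℂ) ≠ 0 := by simpa using hl
    have hlc : conj (Pw n u l) ≠ 0 := by simpa using hl
    simp only [mul_pow, he]
    rw [← Complex.ofReal_pow, sq_mul_self]
    push_cast at c
    apply mul_right_cancel₀ hlc
    rw [c, mul_assoc, div_mul_eq_mul_div, c2]
    field_simp
  rw [GG_root hA] at hG
  have fac : ∀ x : ℝ, (x : ℂ) * e ≠ 0 → x ≠ 0 := fun x hx h0 => hx (by simp [h0])
  have g0 : sq n 0 u + sq n 1 u - sq n 2 u ≠ 0 := by
    apply fac; intro h0; apply hG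
    have : (sq n 0 u : ℂ) * e + sq n 1 u * e - sq n 2 u * e = 0 := by
      rw [← h0]; push_cast; ring
    simp [this]
  have g1 : sq n 0 u - sq n 1 u + sq n 2 u ≠ 0 := by
    apply fac; intro h0; apply hG
    have : (sq n 0 u : ℂ) * e - sq n 1 u * e + sq n 2 u * e = 0 := by
      rw [← h0]; push_cast; ring
    simp [this]
  have g2 : sq n 0 u - sq n 1 u - sq n 2 u ≠ 0 := by
    apply fac; intro h0; apply hG
    have : (sq n 0 u : ℂ) * e - sq n 1 u * e - sq n 2 u * e = 0 := by
      rw [← h0]; push_cast; ring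
    simp [this]
  refine lt_of_le_of_ne (ht k) fun heq => ?_
  fin_cases k <;> simp at heq
  · apply g2; linarith
  · apply g1; linarith
  · apply g0; linarith

lemma rt_pos_real {s : ℂ} {x : ℝ} (hx : 0 < x) (h : s = x) :
    sct n s ∨ n = 0 := by
  by_cases hn : n = 0
  · exact Or.inr hn
  left
  subst h
  refine ⟨by exact_mod_cast hx.ne', ?_⟩
  rw [Complex.arg_ofReal_of_nonneg hx.le, abs_zero]
  have : (0 : ℝ) < n := by exact_mod_cast Nat.pos_of_ne_zero hn
  have := Real.pi_pos
  positivity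

lemma rt_real {x : ℝ} (hx : 0 < x) : rt n (x : ℂ) = (√(x ^ n) : ℝ) := by
  unfold rt
  rw [← Complex.ofReal_cpow hx.le]
  congr 1
  rw [Real.sqrt_eq_rpow, ← Real.rpow_natCast, ← Real.rpow_mul hx.le]
  congr 1
  ring

lemma HT_int_om (hn : 1 ≤ n) {s : ℂ} {t : ℝ} (h : HT n s t) {k : ℤ} (hk : t = k) :
    s * (om n (k : ZMod n))⁻¹ = (‖s‖ : ℂ) := by
  have : NeZero n := ⟨by omega⟩
  have h1 := HT_mul h (HT_inv (HT_om (k : ZMod n)))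
  set d := (k : ZMod n).val with hd
  have : ((d : ℤ) : ZMod n) = (k : ZMod n) := by
    rw [hd]; simp
  rw [ZMod.intCast_eq_intCast_iff_dvd_sub] at this
  obtain ⟨q, hq⟩ := this
  have h2 := HT_shift hn h1 (-q)
  have e : t + -(d : ℝ) + ((-q : ℤ) : ℝ) * n = 0 := by
    have : (k : ℝ) - d = n * q := by exact_mod_cast hq
    rw [hk]; push_cast; linarith
  rw [e] at h2
  have h3 := h2.2
  rw [norm_mul, norm_inv, norm_om] at h3
  rw [h3]; simp

lemma cover (hn : 1 ≤ n) {u : Fin 3 → ℂ} (hG : GG n u ≠ 0) :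
    (∃ k, UC n k u) ∨ ∃ O : ZMod n × ZMod n, VV O u := by
  by_contra hcon
  push Not at hcon
  obtain ⟨hU, hV⟩ := hcon
  have hU' : ∀ k, ao n (k+1) u = ao n (k+2) u ∧ sq n k u ≤ sq n (k+1) u + sq n (k+2) u := by
    intro k
    have := hU k
    unfold UC at this
    push Not at this
    exact ⟨this.1.1, this.2⟩
  have heq : ∀ m, ao n m u = ao n 0 u := by
    have a0 := (hU' 1).1
    have a1 := (hU' 2).1
    intro m
    fin_cases m
    · rfl
    · exact a1.symm
    · exact a0
  by_cases hz : ao n 0 u = 0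
  · have hz' : ∀ m, ao n m u = 0 := fun m => (heq m).trans hz
    have tri := collinear_tri hz' hG fun k => (hU' k).2
    have t0 := tri 0
    have t1 := tri 1
    have t2 := tri 2
    simp at t0 t1 t2
    have q0 := sq_nonneg' (n := n) 0 u
    have q1 := sq_nonneg' (n := n) 1 u
    have q2 := sq_nonneg' (n := n) 2 u
    have nz : ∀ i, u i ≠ 0 := by
      intro i h0
      have := (ao_of_zero hn h0).2.2
      fin_cases i <;> simp at this <;> linarith
    have int : ∀ m : Fin 3, ∀ t, HT n (u (m+1) / u (m+2)) t → ∃ k : ℤ, t = k := by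
      intro m t ht
      have := ao_HT hn ht
      rw [hz'] at this
      have p1 := norm_pos_iff.2 (nz (m+1))
      have p2 := norm_pos_iff.2 (nz (m+2))
      rw [eq_comm, mul_eq_zero] at this
      have := this.resolve_left (by positivity)
      exact cos_eq_one.1 (by linarith)
    have H0 := HT_arg hn (div_ne_zero (nz 1) (nz 2))
    have H1 := HT_arg hn (div_ne_zero (nz 0) (nz 2))
    obtain ⟨j, hj⟩ := int 0 _ H0
    obtain ⟨i, hi⟩ := int 1 _ (by have := HT_inv H1; rw [inv_div] at this; exact this)
    have hi' : (n * (u 0 / u 2).arg / (2 * π) : ℝ) = ((-i : ℤ) : ℝ) := by push_cast; linarith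
    apply hV (((-i : ℤ) : ZMod n), (j : ZMod n))
    have ea := HT_int_om hn H1 hi'
    have eb := HT_int_om hn H0 hj
    have pa : 0 < ‖u 0 / u 2‖ := norm_pos_iff.2 (div_ne_zero (nz 0) (nz 2))
    have pb : 0 < ‖u 1 / u 2‖ := norm_pos_iff.2 (div_ne_zero (nz 1) (nz 2))
    have hn0 : n ≠ 0 := by omega
    have pq2 : 0 < sq n 2 u := by linarith
    have rat : ∀ i, √(‖u i / u 2‖ ^ n) = sq n i u / sq n 2 u := by
      intro i
      unfold sq Pw
      rw [norm_div, div_pow, Real.sqrt_div (by positivity), norm_pow, norm_pow]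
    unfold VV sA sB
    simp only []
    rw [ea, eb, rt_real pa, rt_real pb, rat, rat]
    refine ⟨nz 2, (rt_pos_real pa rfl).resolve_right hn0, (rt_pos_real pb rfl).resolve_right hn0, ?_⟩
    unfold TT
    simp only [Complex.ofReal_re]
    refine ⟨?_, ?_, ?_⟩
    · rw [div_add_one pq2.ne']; gcongr
    · rw [div_add_one pq2.ne']; gcongr; linarith
    · rw [← add_div, one_lt_div pq2]; exact t2
  · obtain ⟨A, hA⟩ := exists_root (n := n) u
    have hj : ∀ m, jj m A ^ 2 = jj 0 A ^ 2 := by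
      intro m
      have := heq m
      rw [ao_root hA, ao_root hA] at this
      linarith
    have h0 : (jj 0 A : ℂ) ≠ 0 := by
      intro h; apply hz; rw [ao_root hA]
      have : jj 0 A = 0 := by exact_mod_cast h
      rw [this]; simp
    have hs := jj_sum 0 A
    simp only [zero_add] at hs
    apply hG
    rw [GG_root hA]
    have cancel : ∀ z : ℂ, (jj 0 A : ℂ) * z = 0 → z = 0 := fun z hz => (mul_eq_zero.1 hz).resolve_left h0
    rcases sq_eq_sq_iff_eq_or_eq_neg.1 (hj 1) with h1 | h1 <;>
    rcases sq_eq_sq_iff_eq_or_eq_neg.1 (hj 2) with h2 | h2 <;> rw [h1, h2] at hs <;> push_cast at hs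
    · rw [cancel (A 0 + A 1 + A 2) (by linear_combination hs)]; simp
    · rw [cancel (A 0 + A 1 - A 2) (by linear_combination hs)]; simp
    · rw [cancel (A 0 - A 1 + A 2) (by linear_combination hs)]; simp
    · rw [cancel (A 0 - A 1 - A 2) (by linear_combination hs)]; simp

end CN
end

end

section

open Topology Set
noncomputable section
namespace CN

open ComplexConjugate
open Complex (I)
open scoped Real

variable {n : ℕ} {Γ : Type*} [Group Γ]

structure Alg (n : ℕ) (Γ : Type*) [Group Γ] where
  e : ZMod n → ZMod n → Γ
  X : ZMod n → Γ
  Y : ZMod n → Γ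
  Z : ZMod n → Γ
  X1 : X (-1) = 1
  Y0 : Y 0 = 1
  hX : ∀ i j, X (i-1) = e i j * e i (j+1) * X i
  hY : ∀ i j, Y (j-1) = e (i-1) j * e i j * Y j
  hZ : ∀ i j, Z (i-j-1) = (X (i-1))⁻¹ * e i j * Y j
  hZ' : ∀ i j, Z (i-j) = (X i)⁻¹ * (e i j)⁻¹ * Y (j-1)

lemma cyc_prim [NeZero n] (p : ZMod n → Γ) (h : ((List.range n).map fun k : ℕ => p k).prod = 1) :
    ∃ X : ZMod n → Γ, X (-1) = 1 ∧ ∀ i, X (i-1) = p i * X i := by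
  set W : ℕ → Γ := fun k => ((List.range k).map fun k : ℕ => p k).prod with hW
  have hs : ∀ k, W (k+1) = W k * p k := fun k => by
    simp [hW, List.range_succ]
  have key : ∀ i : ZMod n, W (i+1).val = W (i.val + 1) := by
    intro i
    have hlt := ZMod.val_lt i
    by_cases hc : i.val + 1 < n
    · congr 1
      have : (i + 1) = ((i.val + 1 : ℕ) : ZMod n) := by push_cast; simp
      rw [this, ZMod.val_natCast, Nat.mod_eq_of_lt hc]
    · have hn : i.val + 1 = n := by omega
      have : (i + 1) = ((i.val + 1 : ℕ) : ZMod n) := by push_cast; simp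
      rw [this, ZMod.val_natCast, hn, Nat.mod_self]
      have : W n = 1 := h
      rw [this]; simp [hW]
  refine ⟨fun i => (W (i+1).val)⁻¹, by simp [hW], fun i => ?_⟩
  simp only [sub_add_cancel]
  rw [key, hs, mul_inv_rev, ZMod.natCast_zmod_val, mul_inv_cancel_left]


lemma zmod_const [NeZero n] {α : Type*} {f : ZMod n → α} (h : ∀ i, f (i+1) = f i) (i : ZMod n) :
    f i = f 0 := by
  have : ∀ k : ℕ, f (k : ZMod n) = f 0 := by
    intro k
    induction k with
    | zero => simp
    | succ k ih => rw [Nat.cast_succ, h, ih]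
  rw [← this i.val, ZMod.natCast_zmod_val]

lemma prod_regroup (A B : ℕ → Γ) (k : ℕ) :
    ((List.range k).map fun i => A i * B i).prod * A k =
      A 0 * ((List.range k).map fun i => B i * A (i+1)).prod := by
  induction k with
  | zero => simp
  | succ k ih =>
    simp only [List.range_succ, List.map_append, List.prod_append, List.map_cons, List.map_nil,
      List.prod_cons, List.prod_nil, mul_one]
    rw [← mul_assoc, ← mul_assoc, ih]
    simp only [mul_assoc]

lemma mkAlg [NeZero n] (e : ZMod n → ZMod n → Γ)
    (h1 : ∀ i j, e (i+2) j = (e (i+1) j)⁻¹ * e i j * e (i+1) j)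
    (h2 : ∀ i j, e i (j+2) = (e i (j+1))⁻¹ * e i j * e i (j+1))
    (h3 : ((List.range n).map fun i : ℕ => e i i * e i (i+1)).prod = 1) :
    ∃ A : Alg n Γ, A.e = e := by
  have p : ∀ i j, e i j * e i (j+1) = e i 0 * e i (0+1) := fun i =>
    zmod_const (f := fun j => e i j * e i (j+1)) fun j => by
      have : j + 1 + 1 = j + 2 := by ring
      simp only [this, h2]; group
  have q : ∀ j i, e i j * e (i+1) j = e 0 j * e (0+1) j := fun j =>
    zmod_const (f := fun i => e i j * e (i+1) j) fun i => by
      have : i + 1 + 1 = i + 2 := by ring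
      simp only [this, h1]; group
  obtain ⟨X, X1, hX⟩ := cyc_prim (fun i => e i 0 * e i (0+1)) (by
    rw [← h3]; congr 1; apply List.map_congr_left; intro i _; exact (p _ _).symm)
  obtain ⟨Y', Y1, hY'⟩ := cyc_prim (fun j => e 0 (j+1) * e (0+1) (j+1)) (by
    have := prod_regroup (fun i : ℕ => e i i) (fun i : ℕ => e i (i+1)) n
    rw [h3] at this
    simp only [one_mul, CharP.cast_eq_zero, Nat.cast_add, Nat.cast_one, Nat.cast_zero] at this
    have h4 := left_eq_mul.1 this
    rw [← h4]
    congr 1; apply List.map_congr_left; intro i _; exact (q _ _).symm)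
  have hXX : ∀ i j, X (i-1) = e i j * e i (j+1) * X i := fun i j => by rw [p, hX]
  have hYY : ∀ i j, Y' (j-1-1) = e (i-1) j * e i j * Y' (j-1) := fun i j => by
    have := q j (i-1)
    rw [sub_add_cancel] at this
    rw [this, hY', sub_add_cancel]
  have D : ∀ i j, (X (i-1))⁻¹ * e i j * Y' (j-1) = (X (i-j-1))⁻¹ * e (i-j) 0 * Y' (-1) := by
    intro i j
    have := zmod_const (f := fun k => (X (i-j+k-1))⁻¹ * e (i-j+k) k * Y' (k-1)) (fun k => by
      have a1 := hXX (i-j+k) k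
      have a2 := hYY (i-j+k+1) (k+1)
      rw [add_sub_cancel_right, add_sub_cancel_right] at a2
      have e2 : i - j + (k+1) = i - j + k + 1 := by ring
      simp only [e2, add_sub_cancel_right]
      rw [a1, a2]; group) j
    simpa using this
  refine ⟨⟨e, X, fun j => Y' (j-1), fun k => (X k)⁻¹ * e (k+1) 0 * Y' (-1), X1, by simpa using Y1,
    hXX, fun i j => hYY i j, fun i j => ?_, fun i j => ?_⟩, rfl⟩
  · rw [D, sub_add_cancel]
  · have d := D (i+1) j
    have y := hYY (i+1) j
    rw [add_sub_cancel_right] at d y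
    rw [y]
    have e1 : i + 1 - j - 1 = i - j := by ring
    have e2 : i + 1 - j = i - j + 1 := by ring
    rw [e1, e2] at d
    rw [← d]; group

variable (A : Alg n Γ)
open Classical in
def f31 (u : Fin 3 → ℂ) : Γ :=
  if AA n 1 u then A.X (-1 - ar n 1 u)
  else (A.e (ar n 0 u + ar n 2 u + 1) (ar n 0 u))⁻¹ * A.X (ar n 0 u + ar n 2 u + 1 - 1)
open Classical in
def f32 (u : Fin 3 → ℂ) : Γ :=
  if AA n 0 u then A.Y (ar n 0 u)
  else A.e (-1 - ar n 1 u + 1) (-1 - ar n 1 u - ar n 2 u) * A.Y (-1 - ar n 1 u - ar n 2 u)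
open Classical in
def f12 (u : Fin 3 → ℂ) : Γ :=
  if AA n 2 u then A.Z (ar n 2 u)
  else (A.X (-1 - ar n 1 u))⁻¹ * A.Y (ar n 0 u)
def f3O (O : ZMod n × ZMod n) (u : Fin 3 → ℂ) : Γ :=
  if cc O 1 u < cc O 0 u then 1 else A.e O.1 O.2
def f1O (O : ZMod n × ZMod n) (u : Fin 3 → ℂ) : Γ :=
  if cc O 2 u < cc O 1 u then (A.X (O.1-1))⁻¹ * A.e O.1 O.2 else (A.X O.1)⁻¹
def f2O (O : ZMod n × ZMod n) (u : Fin 3 → ℂ) : Γ :=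
  if cc O 2 u < cc O 0 u then (A.Y O.2)⁻¹ else (A.Y (O.2-1))⁻¹ * A.e O.1 O.2

lemma AA_or_EE {m k l : Fin 3} {u : Fin 3 → ℂ} (hk : UC n k u) (hl : UC n l u)
    (h1 : m + 1 = k) (h2 : m + 2 = l) : AA n m u ∨ EE n m u := by
  subst h1 h2; exact UC_inter.1 ⟨hk, hl⟩

lemma AA0 {u : Fin 3 → ℂ} : AA n 0 u ↔ (ao n 1 u < ao n 0 u ∨ ao n 2 u < ao n 0 u) :=
  min_lt_iff
lemma EE0 {u : Fin 3 → ℂ} : EE n 0 u ↔ (ao n 0 u < ao n 1 u ∧ ao n 0 u < ao n 2 u) :=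
  lt_min_iff
lemma AA1 {u : Fin 3 → ℂ} : AA n 1 u ↔ (ao n 2 u < ao n 1 u ∨ ao n 0 u < ao n 1 u) :=
  min_lt_iff
lemma EE1 {u : Fin 3 → ℂ} : EE n 1 u ↔ (ao n 1 u < ao n 2 u ∧ ao n 1 u < ao n 0 u) :=
  lt_min_iff
lemma AA2 {u : Fin 3 → ℂ} : AA n 2 u ↔ (ao n 0 u < ao n 2 u ∨ ao n 1 u < ao n 2 u) :=
  min_lt_iff
lemma EE2 {u : Fin 3 → ℂ} : EE n 2 u ↔ (ao n 2 u < ao n 0 u ∧ ao n 2 u < ao n 1 u) :=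
  lt_min_iff

lemma co_312 {u : Fin 3 → ℂ} (h0 : UC n 0 u) (h1 : UC n 1 u) (h2 : UC n 2 u) :
    f31 A u * f12 A u = f32 A u := by
  have c0 := AA_or_EE (m := 0) h1 h2 rfl rfl
  have c1 := AA_or_EE (m := 1) h2 h0 rfl rfl
  have c2 := AA_or_EE (m := 2) h0 h1 rfl rfl
  rw [AA0, EE0] at c0
  rw [AA1, EE1] at c1
  rw [AA2, EE2] at c2
  have tri : (¬ AA n 0 u ∧ AA n 1 u ∧ AA n 2 u) ∨ (AA n 0 u ∧ ¬ AA n 1 u ∧ AA n 2 u) ∨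
      (AA n 0 u ∧ AA n 1 u ∧ ¬ AA n 2 u) := by
    rw [AA0, AA1, AA2]
    generalize ao n 0 u = x at *
    generalize ao n 1 u = y at *
    generalize ao n 2 u = z at *
    grind
  unfold f31 f12 f32
  rcases tri with ⟨t0, t1, t2⟩ | ⟨t0, t1, t2⟩ | ⟨t0, t1, t2⟩ <;> simp only [t0, t1, t2, if_true, if_false]
  · have := A.hZ (-1 - ar n 1 u + 1) (-1 - ar n 1 u - ar n 2 u)
    have e : -1 - ar n 1 u + 1 - (-1 - ar n 1 u - ar n 2 u) - 1 = ar n 2 u := by ring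
    rw [e, add_sub_cancel_right] at this
    rw [this]; group
  · have := A.hZ (ar n 0 u + ar n 2 u + 1) (ar n 0 u)
    have e : ar n 0 u + ar n 2 u + 1 - ar n 0 u - 1 = ar n 2 u := by ring
    rw [e] at this
    rw [this]; group
  · group

lemma co_31O (hn : 1 ≤ n) {O : ZMod n × ZMod n} {u : Fin 3 → ℂ} (h2 : UC n 2 u) (h0 : UC n 0 u)
    (h : VV O u) : f31 A u * f1O A O u = f3O A O u := by
  have d2 : cc O 0 u ≠ cc O 1 u := (UC_cc hn h 2).1 h2
  have d0 : cc O 1 u ≠ cc O 2 u := (UC_cc hn h 0).1 h0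
  have v0 := ar_V hn h 0
  have v1 := ar_V hn h 1
  have v2 := ar_V hn h 2
  simp only [oo, Matrix.cons_val_zero, Matrix.cons_val_one, Matrix.cons_val] at v0 v1 v2
  unfold f31 f1O f3O
  rcases lt_or_gt_of_ne d2 with g2 | g2 <;> rcases lt_or_gt_of_ne d0 with g0 | g0
  · obtain ⟨E, p, q⟩ := V_med' hn h (m := 1) g0 g2
    have nA : ¬ AA n 1 u := fun hA => AA_not_EE hA E
    rw [if_neg nA, if_neg (not_lt.2 g0.le), if_neg (not_lt.2 g2.le), v0.2 q, v2.1 p]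
    have e : O.2 - 1 + (O.1 - O.2) + 1 = O.1 := by ring
    rw [e, A.hX O.1 (O.2 - 1), sub_add_cancel]; group
  · obtain ⟨E, p⟩ := V_max hn h (m := 1) g0 g2
    rw [if_pos E, if_pos g0, if_neg (not_lt.2 g2.le), v1.1 p]
    have e : -1 - -O.1 = O.1 - 1 := by ring
    rw [e]; group
  · obtain ⟨E, p⟩ := V_min hn h (m := 1) g0 g2
    rw [if_pos E, if_neg (not_lt.2 g0.le), if_pos g2, v1.2 p]
    have e : -1 - (-O.1 - 1) = O.1 := by ring
    rw [e]; group
  · obtain ⟨E, p, q⟩ := V_med hn h (m := 1) g0 g2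
    have nA : ¬ AA n 1 u := fun hA => AA_not_EE hA E
    rw [if_neg nA, if_pos g0, if_pos g2, v0.1 q, v2.2 p]
    have e : O.2 + (O.1 - O.2 - 1) + 1 = O.1 := by ring
    rw [e]; group

lemma co_32O (hn : 1 ≤ n) {O : ZMod n × ZMod n} {u : Fin 3 → ℂ} (h2 : UC n 2 u) (h1 : UC n 1 u)
    (h : VV O u) : f32 A u * f2O A O u = f3O A O u := by
  have d2 : cc O 0 u ≠ cc O 1 u := (UC_cc hn h 2).1 h2
  have d1 : cc O 2 u ≠ cc O 0 u := (UC_cc hn h 1).1 h1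
  have v0 := ar_V hn h 0
  have v1 := ar_V hn h 1
  have v2 := ar_V hn h 2
  simp only [oo, Matrix.cons_val_zero, Matrix.cons_val_one, Matrix.cons_val] at v0 v1 v2
  unfold f32 f2O f3O
  rcases lt_or_gt_of_ne d2 with g2 | g2 <;> rcases lt_or_gt_of_ne d1 with g1 | g1
  · obtain ⟨E, p, q⟩ := V_med' hn h (m := 0) g2 g1
    have nA : ¬ AA n 0 u := fun hA => AA_not_EE hA E
    simp only [zero_add] at p q
    rw [if_neg nA, if_pos g1, if_neg (not_lt.2 g2.le), v1.1 p, v2.2 q]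
    have e : -1 - -O.1 + 1 = O.1 := by ring
    have e2 : -1 - -O.1 - (O.1 - O.2 - 1) = O.2 := by ring
    rw [e, e2]; group
  · obtain ⟨E, p⟩ := V_min hn h (m := 0) g2 g1
    rw [if_pos E, if_neg (not_lt.2 g1.le), if_neg (not_lt.2 g2.le), v0.2 p]
    group
  · obtain ⟨E, p⟩ := V_max hn h (m := 0) g2 g1
    rw [if_pos E, if_pos g1, if_pos g2, v0.1 p]
    group
  · obtain ⟨E, p, q⟩ := V_med hn h (m := 0) g2 g1
    have nA : ¬ AA n 0 u := fun hA => AA_not_EE hA E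
    simp only [zero_add] at p q
    rw [if_neg nA, if_neg (not_lt.2 g1.le), if_pos g2, v1.2 p, v2.1 q]
    have e : -1 - (-O.1 - 1) + 1 = O.1 + 1 := by ring
    have e2 : -1 - (-O.1 - 1) - (O.1 - O.2) = O.2 := by ring
    have := A.hY (O.1 + 1) O.2
    rw [add_sub_cancel_right] at this
    rw [e, e2, this]; group

lemma co_12O (hn : 1 ≤ n) {O : ZMod n × ZMod n} {u : Fin 3 → ℂ} (h0 : UC n 0 u) (h1 : UC n 1 u)
    (h : VV O u) : f12 A u * f2O A O u = f1O A O u := by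
  have d0 : cc O 1 u ≠ cc O 2 u := (UC_cc hn h 0).1 h0
  have d1 : cc O 2 u ≠ cc O 0 u := (UC_cc hn h 1).1 h1
  have v0 := ar_V hn h 0
  have v1 := ar_V hn h 1
  have v2 := ar_V hn h 2
  simp only [oo, Matrix.cons_val_zero, Matrix.cons_val_one, Matrix.cons_val] at v0 v1 v2
  unfold f12 f2O f1O
  rcases lt_or_gt_of_ne d0 with g0 | g0 <;> rcases lt_or_gt_of_ne d1 with g1 | g1
  · obtain ⟨E, p, q⟩ := V_med' hn h (m := 2) g1 g0
    have nA : ¬ AA n 2 u := fun hA => AA_not_EE hA E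
    rw [if_neg nA, if_pos g1, if_neg (not_lt.2 g0.le), v1.2 q, v0.1 p]
    have e : -1 - (-O.1 - 1) = O.1 := by ring
    rw [e]; group
  · obtain ⟨E, p⟩ := V_max hn h (m := 2) g1 g0
    rw [if_pos E, if_neg (not_lt.2 g1.le), if_neg (not_lt.2 g0.le), v2.1 p, A.hZ']
    group
  · obtain ⟨E, p⟩ := V_min hn h (m := 2) g1 g0
    rw [if_pos E, if_pos g1, if_pos g0, v2.2 p, A.hZ]
    group
  · obtain ⟨E, p, q⟩ := V_med hn h (m := 2) g1 g0
    have nA : ¬ AA n 2 u := fun hA => AA_not_EE hA E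
    rw [if_neg nA, if_neg (not_lt.2 g1.le), if_pos g0, v1.1 q, v0.2 p]
    have e : -1 - -O.1 = O.1 - 1 := by ring
    rw [e]; group

end CN
end

end

section

open Topology Set
noncomputable section
namespace CN

open ComplexConjugate
open Complex (I)
open scoped Real

variable {n : ℕ} {Γ : Type*} [Group Γ]

abbrev Idx (n : ℕ) := Fin 3 ⊕ (ZMod n × ZMod n)

def SS : Idx n → (Fin 3 → ℂ) → Prop
  | Sum.inl k, u => UC n k u
  | Sum.inr O, u => VV O u

def rk : Idx n → ℕ
  | Sum.inl k => (k + 1 : Fin 3).val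
  | Sum.inr _ => 3

def ff (A : Alg n Γ) : Idx n → Idx n → (Fin 3 → ℂ) → Γ
  | Sum.inl 2, Sum.inl 0, u => f31 A u
  | Sum.inl 2, Sum.inl 1, u => f32 A u
  | Sum.inl 0, Sum.inl 1, u => f12 A u
  | Sum.inl 2, Sum.inr O, u => f3O A O u
  | Sum.inl 0, Sum.inr O, u => f1O A O u
  | Sum.inl 1, Sum.inr O, u => f2O A O u
  | _, _, _ => 1

def gg (A : Alg n Γ) (a b : Idx n) (u : Fin 3 → ℂ) : Γ :=
  if rk a < rk b then ff A a b u else if rk b < rk a then (ff A b a u)⁻¹ else 1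

lemma SS_smul {c : ℂ} (hc : c ≠ 0) (a : Idx n) (u : Fin 3 → ℂ) : SS a (c • u) ↔ SS a u := by
  rcases a with k | O
  · exact UC_smul hc k u
  · exact VV_smul hc O u

lemma SS_near (hn : 1 ≤ n) {a : Idx n} {u : Fin 3 → ℂ} (h : SS a u) : ∀ᶠ v in 𝓝 u, SS a v := by
  rcases a with k | O
  · exact (isOpen_UC k).mem_nhds h
  · exact (VV_near hn h).2.2

lemma SS_GG (hn : 1 ≤ n) {a : Idx n} {u : Fin 3 → ℂ} (h : SS a u) : GG n u ≠ 0 := by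
  rcases a with k | O
  · exact GG_ne_of_UC h
  · exact GG_VV hn h

lemma SS_cover (hn : 1 ≤ n) {u : Fin 3 → ℂ} (h : GG n u ≠ 0) : ∃ a : Idx n, SS a u := by
  rcases cover hn h with ⟨k, hk⟩ | ⟨O, hO⟩
  · exact ⟨Sum.inl k, hk⟩
  · exact ⟨Sum.inr O, hO⟩

lemma ff_smul (A : Alg n Γ) {c : ℂ} (hc : c ≠ 0) (a b : Idx n) (u : Fin 3 → ℂ) :
    ff A a b (c • u) = ff A a b u := by
  unfold ff
  split
  · unfold f31; by_cases h : AA n 1 u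
    · rw [if_pos h, if_pos ((AA_smul hc 1 u).2 h)]; simp only [ar_smul hc]
    · rw [if_neg h, if_neg (fun h' => h ((AA_smul hc 1 u).1 h'))]; simp only [ar_smul hc]
  · unfold f32; by_cases h : AA n 0 u
    · rw [if_pos h, if_pos ((AA_smul hc 0 u).2 h)]; simp only [ar_smul hc]
    · rw [if_neg h, if_neg (fun h' => h ((AA_smul hc 0 u).1 h'))]; simp only [ar_smul hc]
  · unfold f12; by_cases h : AA n 2 u
    · rw [if_pos h, if_pos ((AA_smul hc 2 u).2 h)]; simp only [ar_smul hc]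
    · rw [if_neg h, if_neg (fun h' => h ((AA_smul hc 2 u).1 h'))]; simp only [ar_smul hc]
  · simp only [f3O, cc_smul hc]
  · simp only [f1O, cc_smul hc]
  · simp only [f2O, cc_smul hc]
  · rfl

lemma gg_smul (A : Alg n Γ) {c : ℂ} (hc : c ≠ 0) (a b : Idx n) (u : Fin 3 → ℂ) :
    gg A a b (c • u) = gg A a b u := by
  unfold gg; rw [ff_smul A hc, ff_smul A hc]

lemma AA_ao {m : Fin 3} {u : Fin 3 → ℂ} (h : AA n m u) : ao n m u ≠ 0 := by
  unfold AA at h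
  have := le_min (ao_nonneg (n := n) (m+1) u) (ao_nonneg (n := n) (m+2) u)
  exact (lt_of_le_of_lt this h).ne'

lemma EE_ao {m : Fin 3} {u : Fin 3 → ℂ} (h : EE n m u) :
    ao n (m+1) u ≠ 0 ∧ ao n (m+2) u ≠ 0 := by
  unfold EE at h
  rw [lt_min_iff] at h
  have := ao_nonneg (n := n) m u
  exact ⟨by linarith [h.1], by linarith [h.2]⟩

lemma EE_near {m : Fin 3} {u : Fin 3 → ℂ} (h : EE n m u) : ∀ᶠ v in 𝓝 u, EE n m v :=
  (isOpen_EE m).mem_nhds h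

lemma AA_near {m : Fin 3} {u : Fin 3 → ℂ} (h : AA n m u) : ∀ᶠ v in 𝓝 u, AA n m v :=
  (isOpen_AA m).mem_nhds h

lemma f31_near (hn : 1 ≤ n) (A : Alg n Γ) {u : Fin 3 → ℂ} (h2 : UC n 2 u) (h0 : UC n 0 u) :
    ∀ᶠ v in 𝓝 u, f31 A v = f31 A u := by
  rcases AA_or_EE (m := 1) h2 h0 rfl rfl with h | h
  · filter_upwards [AA_near h, ar_near hn (AA_ao h)] with v h1 h2
    unfold f31; rw [if_pos h, if_pos h1, h2]
  · obtain ⟨k1, k2⟩ := EE_ao h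
    filter_upwards [EE_near h, ar_near hn k1, ar_near hn k2] with v h1 h2 h3
    have h2' : ar n 2 v = ar n 2 u := h2
    have h3' : ar n 0 v = ar n 0 u := h3
    unfold f31
    rw [if_neg (fun hA => AA_not_EE hA h), if_neg (fun hA => AA_not_EE hA h1), h2', h3']

lemma f32_near (hn : 1 ≤ n) (A : Alg n Γ) {u : Fin 3 → ℂ} (h2 : UC n 2 u) (h1 : UC n 1 u) :
    ∀ᶠ v in 𝓝 u, f32 A v = f32 A u := by
  rcases AA_or_EE (m := 0) h1 h2 rfl rfl with h | h
  · filter_upwards [AA_near h, ar_near hn (AA_ao h)] with v h1 h2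
    unfold f32; rw [if_pos h, if_pos h1, h2]
  · obtain ⟨k1, k2⟩ := EE_ao h
    filter_upwards [EE_near h, ar_near hn k1, ar_near hn k2] with v h1 h2 h3
    have h2' : ar n 1 v = ar n 1 u := h2
    have h3' : ar n 2 v = ar n 2 u := h3
    unfold f32
    rw [if_neg (fun hA => AA_not_EE hA h), if_neg (fun hA => AA_not_EE hA h1), h2', h3']

lemma f12_near (hn : 1 ≤ n) (A : Alg n Γ) {u : Fin 3 → ℂ} (h0 : UC n 0 u) (h1 : UC n 1 u) :
    ∀ᶠ v in 𝓝 u, f12 A v = f12 A u := by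
  rcases AA_or_EE (m := 2) h0 h1 rfl rfl with h | h
  · filter_upwards [AA_near h, ar_near hn (AA_ao h)] with v h1 h2
    unfold f12; rw [if_pos h, if_pos h1, h2]
  · obtain ⟨k1, k2⟩ := EE_ao h
    filter_upwards [EE_near h, ar_near hn k1, ar_near hn k2] with v h1 h2 h3
    have h2' : ar n 0 v = ar n 0 u := h2
    have h3' : ar n 1 v = ar n 1 u := h3
    unfold f12
    rw [if_neg (fun hA => AA_not_EE hA h), if_neg (fun hA => AA_not_EE hA h1), h2', h3']

lemma cc_cmp_near (hn : 1 ≤ n) {O : ZMod n × ZMod n} {u : Fin 3 → ℂ} (h : VV O u) {m l : Fin 3}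
    (hne : cc O m u ≠ cc O l u) : ∀ᶠ v in 𝓝 u, (cc O m v < cc O l v ↔ cc O m u < cc O l u) := by
  rcases lt_or_gt_of_ne hne with hl | hl
  · filter_upwards [(cc_near hn h m).eventually_lt (cc_near hn h l) hl] with v hv
    simp [hl, hv]
  · filter_upwards [(cc_near hn h l).eventually_lt (cc_near hn h m) hl] with v hv
    simp [not_lt.2 hl.le, not_lt.2 (le_of_lt hv)]

lemma ff_near (hn : 1 ≤ n) (A : Alg n Γ) {a b : Idx n} {u : Fin 3 → ℂ} (ha : SS a u) (hb : SS b u) :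
    ∀ᶠ v in 𝓝 u, ff A a b v = ff A a b u := by
  unfold ff
  split
  · exact f31_near hn A ha hb
  · exact f32_near hn A ha hb
  · exact f12_near hn A ha hb
  · rename_i O
    have d2 : cc O 0 u ≠ cc O 1 u := (UC_cc hn hb 2).1 ha
    filter_upwards [cc_cmp_near hn hb d2.symm] with v hv
    unfold f3O; simp only [hv]
  · rename_i O
    have d0 : cc O 1 u ≠ cc O 2 u := (UC_cc hn hb 0).1 ha
    filter_upwards [cc_cmp_near hn hb d0.symm] with v hv
    unfold f1O; simp only [hv]
  · rename_i O
    have d1 : cc O 2 u ≠ cc O 0 u := (UC_cc hn hb 1).1 ha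
    filter_upwards [cc_cmp_near hn hb d1] with v hv
    unfold f2O; simp only [hv]
  · exact Filter.Eventually.of_forall fun _ => rfl

lemma gg_near (hn : 1 ≤ n) (A : Alg n Γ) {a b : Idx n} {u : Fin 3 → ℂ} (ha : SS a u) (hb : SS b u) :
    ∀ᶠ v in 𝓝 u, gg A a b v = gg A a b u := by
  filter_upwards [ff_near hn A ha hb, ff_near hn A hb ha] with v h1 h2
  unfold gg; rw [h1, h2]

lemma rk_lt (k : Fin 3) : rk (Sum.inl k : Idx n) < 3 := (k+1 : Fin 3).isLt
lemma rk_le (a : Idx n) : rk a ≤ 3 := by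
  rcases a with k | O
  · exact (rk_lt k).le
  · exact le_rfl

lemma rk_inj (hn : 1 ≤ n) {a b : Idx n} {u : Fin 3 → ℂ} (ha : SS a u) (hb : SS b u)
    (h : rk a = rk b) : a = b := by
  rcases a with k | O <;> rcases b with l | O'
  · have : k + 1 = l + 1 := Fin.ext h
    rw [add_right_cancel this]
  · exact absurd h (rk_lt k).ne
  · exact absurd h (rk_lt l).ne'
  · rw [VV_disj hn ha hb]

lemma ff_co (hn : 1 ≤ n) (A : Alg n Γ) {a b d : Idx n} {u : Fin 3 → ℂ} (ha : SS a u) (hb : SS b u)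
    (hd : SS d u) (h1 : rk a < rk b) (h2 : rk b < rk d) :
    ff A a b u * ff A b d u = ff A a d u := by
  have hd3 := rk_le d
  rcases b with k | O
  swap
  · exact absurd (lt_of_lt_of_le h2 hd3) (lt_irrefl 3)
  rcases a with l | O
  swap
  · exact absurd (h1.trans (rk_lt k)) (lt_irrefl 3)
  rcases d with m | O
  · have H : ∀ k l m : Fin 3, (l+1).val < (k+1).val → (k+1).val < (m+1).val →
      l = 2 ∧ k = 0 ∧ m = 1 := by decide
    obtain ⟨rfl, rfl, rfl⟩ := H k l m h1 h2
    exact co_312 A hb hd ha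
  · have H : ∀ k l : Fin 3, (l+1).val < (k+1).val →
      (l = 2 ∧ k = 0) ∨ (l = 2 ∧ k = 1) ∨ (l = 0 ∧ k = 1) := by decide
    rcases H k l h1 with ⟨rfl, rfl⟩ | ⟨rfl, rfl⟩ | ⟨rfl, rfl⟩
    · exact co_31O A hn ha hb hd
    · exact co_32O A hn ha hb hd
    · exact co_12O A hn ha hb hd

lemma gg_co (hn : 1 ≤ n) (A : Alg n Γ) {a b d : Idx n} {u : Fin 3 → ℂ} (ha : SS a u) (hb : SS b u)
    (hd : SS d u) : gg A a b u * gg A b d u = gg A a d u := by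
  unfold gg
  rcases lt_trichotomy (rk a) (rk b) with h1 | h1 | h1
  · rcases lt_trichotomy (rk b) (rk d) with h2 | h2 | h2
    · rw [if_pos h1, if_pos h2, if_pos (h1.trans h2), ff_co hn A ha hb hd h1 h2]
    · have := rk_inj hn hb hd h2
      subst this
      simp
    · rcases lt_trichotomy (rk a) (rk d) with h3 | h3 | h3
      · rw [if_pos h1, if_neg h2.not_gt, if_pos h2, if_pos h3, ← ff_co hn A ha hd hb h3 h2]; group
      · have := rk_inj hn ha hd h3
        subst this
        simp [h1, h1.not_gt]
      · rw [if_pos h1, if_neg h2.not_gt, if_pos h2, if_neg h3.not_gt, if_pos h3,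
          ← ff_co hn A hd ha hb h3 h1]; group
  · have := rk_inj hn ha hb h1
    subst this
    simp
  · rcases lt_trichotomy (rk b) (rk d) with h2 | h2 | h2
    · rcases lt_trichotomy (rk a) (rk d) with h3 | h3 | h3
      · rw [if_neg h1.not_gt, if_pos h1, if_pos h2, if_pos h3, ← ff_co hn A hb ha hd h1 h3]; group
      · have := rk_inj hn ha hd h3
        subst this
        simp [h1, h1.not_gt]
      · rw [if_neg h1.not_gt, if_pos h1, if_pos h2, if_neg h3.not_gt, if_pos h3,
          ← ff_co hn A hb hd ha h2 h3]; group
    · have := rk_inj hn hb hd h2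
      subst this
      simp
    · have h3 := h2.trans h1
      rw [if_neg h1.not_gt, if_pos h1, if_neg h2.not_gt, if_pos h2, if_neg h3.not_gt, if_pos h3,
        ← ff_co hn A hd hb ha h2 h1]; group

end CN
end

end

section

open Topology Set
noncomputable section
namespace CN

open ComplexConjugate
open Complex (I)
open scoped Real

variable {n : ℕ}

lemma joined_line {E : Type*} [TopologicalSpace E] {Q : E → Prop} (γ : ℝ → E) (hc : Continuous γ)
    (h : ∀ t, 0 ≤ t → t ≤ 1 → Q (γ t)) : JoinedIn {u | Q u} (γ 0) (γ 1) := by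
  refine JoinedIn.ofLine (f := γ) hc.continuousOn rfl rfl ?_
  rintro _ ⟨t, ht, rfl⟩
  exact h t ht.1 ht.2

lemma joined_smul {Q : (Fin 3 → ℂ) → Prop} (hQ : ∀ c : ℂ, c ≠ 0 → ∀ u, Q u → Q (c • u))
    {u : Fin 3 → ℂ} (h : Q u) {c : ℂ} (hc : c ≠ 0) : JoinedIn {u | Q u} u (c • u) := by
  have hl : Complex.exp (Complex.log c) = c := Complex.exp_log hc
  have := joined_line (Q := Q) (fun t : ℝ => Complex.exp (t * Complex.log c) • u) (by fun_prop)
    (fun t _ _ => hQ _ (Complex.exp_ne_zero _) _ h)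
  simpa [hl] using this

def NR (n : ℕ) (s : ℂ) : Prop := ∃ t : ℝ, HT n s t ∧ ¬ ∃ k : ℤ, t = k

lemma NR_ao (hn : 1 ≤ n) {m : Fin 3} {u : Fin 3 → ℂ} : NR n (u (m+1) / u (m+2)) ↔ ao n m u ≠ 0 := by
  constructor
  · rintro ⟨t, h, ht⟩
    rw [ao_HT hn h]
    have h1 := h.1
    have a1 : u (m+1) ≠ 0 := by rintro h0; rw [h0, zero_div] at h1; exact h1 rfl
    have a2 : u (m+2) ≠ 0 := by rintro h0; rw [h0, div_zero] at h1; exact h1 rfl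
    have := fun h => ht (cos_eq_one.1 h)
    have h3 : (1 : ℝ) - Real.cos (2 * π * t) ≠ 0 := fun h => this (by linarith)
    have := norm_pos_iff.2 a1
    have := norm_pos_iff.2 a2
    positivity
  · exact fun h => exists_HT hn h

lemma conv_lt {x a b c : ℝ} (h0 : 0 ≤ x) (h1 : x ≤ 1) (ha : c < a) (hb : c < b) :
    c < (1-x) * a + x * b := by
  rcases eq_or_lt_of_le h0 with rfl | h0
  · simpa using ha
  · nlinarith [mul_pos h0 (sub_pos.2 hb), mul_nonneg (sub_nonneg.2 h1) (sub_pos.2 ha).le]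

lemma conv_gt {x a b c : ℝ} (h0 : 0 ≤ x) (h1 : x ≤ 1) (ha : a < c) (hb : b < c) :
    (1-x) * a + x * b < c := by
  rcases eq_or_lt_of_le h0 with rfl | h0
  · simpa using ha
  · nlinarith [mul_pos h0 (sub_pos.2 hb), mul_nonneg (sub_nonneg.2 h1) (sub_pos.2 ha).le]

lemma arc_path (hn : 1 ≤ n) {s s' : ℂ} (h : NR n s) (h' : NR n s') (he : arc n s = arc n s') :
    ∃ γ : ℝ → ℂ, Continuous γ ∧ γ 0 = s ∧ γ 1 = s' ∧ (∀ t, γ t ≠ 0) ∧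
      ∀ t, 0 ≤ t → t ≤ 1 → NR n (γ t) ∧ arc n (γ t) = arc n s := by
  obtain ⟨t, h1, h2⟩ := h
  obtain ⟨t0, h1', h2'⟩ := h'
  rw [arc_eq hn h1, arc_eq hn h1'] at he
  obtain ⟨k, hk⟩ := (ZMod.intCast_eq_intCast_iff_dvd_sub _ _ _).1 he
  obtain ⟨t', ht', h3⟩ : ∃ t' : ℝ, HT n s' t' ∧ ⌊t'⌋ = ⌊t⌋ ∧ ¬ ∃ k : ℤ, t' = k := by
    refine ⟨t0 + (-k : ℤ) * n, HT_shift hn h1' _, ?_, ?_⟩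
    · have : ((-k : ℤ) : ℝ) * n = ((-k * n : ℤ) : ℝ) := by push_cast; ring
      rw [this, Int.floor_add_intCast]
      linarith
    · rintro ⟨l, hl⟩
      exact h2' ⟨l + k * n, by push_cast at hl ⊢; linarith⟩
  have p1 : 0 < ‖s‖ := norm_pos_iff.2 h1.1
  have p2 : 0 < ‖s'‖ := norm_pos_iff.2 ht'.1
  set γ : ℝ → ℂ := fun x => (Real.exp ((1-x) * Real.log ‖s‖ + x * Real.log ‖s'‖) : ℝ) *
    Complex.exp (((2 * π * ((1-x) * t + x * t') / n : ℝ) : ℂ) * I) with hγ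
  have hH : ∀ x, HT n (γ x) ((1-x) * t + x * t') := fun x => HT_exp _ _ (Real.exp_pos _)
  have b1 : (⌊t⌋ : ℝ) < t := lt_of_le_of_ne (Int.floor_le t) fun e => h2 ⟨_, e.symm⟩
  have b2 := Int.lt_floor_add_one t
  have b3 : (⌊t⌋ : ℝ) < t' := by
    rw [← h3.1]; exact lt_of_le_of_ne (Int.floor_le t') fun e => h3.2 ⟨_, e.symm⟩
  have b4 : t' < ⌊t⌋ + 1 := by rw [← h3.1]; exact Int.lt_floor_add_one t'
  refine ⟨γ, by fun_prop, ?_, ?_, fun x => (hH x).1, fun x x0 x1 => ?_⟩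
  · simp only [hγ, sub_zero, one_mul, zero_mul, add_zero]
    rw [Real.exp_log p1]; exact h1.2.symm
  · simp only [hγ, sub_self, one_mul, zero_mul, zero_add]
    rw [Real.exp_log p2]; exact ht'.2.symm
  · have c1 : (⌊t⌋ : ℝ) < (1-x) * t + x * t' := conv_lt x0 x1 b1 b3
    have c2 : (1-x) * t + x * t' < (⌊t⌋ : ℝ) + 1 := conv_gt x0 x1 b2 b4
    have hf : ⌊(1-x) * t + x * t'⌋ = ⌊t⌋ := Int.floor_eq_iff.2 ⟨c1.le, c2⟩
    refine ⟨⟨_, hH x, ?_⟩, ?_⟩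
    · rintro ⟨l, hl⟩
      rw [hl] at c1 c2
      have : ⌊t⌋ < l := by exact_mod_cast c1
      have : l < ⌊t⌋ + 1 := by exact_mod_cast c2
      omega
    · rw [arc_eq hn (hH x), hf, arc_eq hn h1]

def mk3 (m : Fin 3) (a b c : ℂ) : Fin 3 → ℂ := fun i => if i = m then a else if i = m+1 then b else c

lemma mk3_0 (m : Fin 3) (a b c : ℂ) : mk3 m a b c m = a := by simp [mk3]
lemma mk3_1 (m : Fin 3) (a b c : ℂ) : mk3 m a b c (m+1) = b := by simp [mk3]
lemma mk3_2 (m : Fin 3) (a b c : ℂ) : mk3 m a b c (m+2) = c := by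
  fin_cases m <;> simp [mk3]

lemma mk3_ext {m : Fin 3} {u v : Fin 3 → ℂ} (h0 : u m = v m) (h1 : u (m+1) = v (m+1))
    (h2 : u (m+2) = v (m+2)) : u = v := by
  funext i
  rcases fin3_cases i m with rfl | rfl | rfl <;> assumption

lemma mk3_cont {T : Type*} [TopologicalSpace T] (m : Fin 3) {a b c : T → ℂ} (ha : Continuous a)
    (hb : Continuous b) (hc : Continuous c) : Continuous fun t => mk3 m (a t) (b t) (c t) := by
  refine continuous_pi fun i => ?_
  unfold mk3
  split_ifs <;> assumption

lemma mk3_eta (m : Fin 3) (u : Fin 3 → ℂ) : mk3 m (u m) (u (m+1)) (u (m+2)) = u :=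
  mk3_ext (m := m) (mk3_0 ..) (mk3_1 ..) (mk3_2 ..)

lemma mk3_smul (m : Fin 3) (k a b c : ℂ) : k • mk3 m a b c = mk3 m (k*a) (k*b) (k*c) := by
  apply mk3_ext (m := m) <;> simp [mk3_0, mk3_1, mk3_2]

/-- scaling one coordinate by a nonnegative real -/
lemma ao_mk3_scale {r : ℝ} (hr : 0 ≤ r) (m : Fin 3) (a b c : ℂ) :
    ao n m (mk3 m (r * a) b c) = ao n m (mk3 m a b c) ∧
    ao n (m+1) (mk3 m (r * a) b c) = r ^ n * ao n (m+1) (mk3 m a b c) ∧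
    ao n (m+2) (mk3 m (r * a) b c) = r ^ n * ao n (m+2) (mk3 m a b c) := by
  set d : Fin 3 → ℝ := fun i => if i = m then r else 1 with hd
  have e : mk3 m (r * a) b c = dsc d (mk3 m a b c) := by
    apply mk3_ext (m := m) <;> simp [mk3_0, mk3_1, mk3_2, dsc, hd]
  have hd0 : ∀ i, 0 ≤ d i := fun i => by simp only [hd]; split_ifs <;> [exact hr; norm_num]
  have d0 : d m = r := by simp [hd]
  have d1 : d (m+1) = 1 := by simp [hd]
  have d2 : d (m+2) = 1 := by simp [hd]
  rw [e, ao_dsc hd0, ao_dsc hd0, ao_dsc hd0, i11, i12, i21, i22, d0, d1, d2]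
  simp

lemma AA_shrink (m : Fin 3) {u : Fin 3 → ℂ} (h : AA n m u) {r : ℝ} (h0 : 0 ≤ r) (h1 : r ≤ 1) :
    AA n m (mk3 m (r * u m) (u (m+1)) (u (m+2))) := by
  have hao := ao_mk3_scale (n := n) h0 m (u m) (u (m+1)) (u (m+2))
  rw [mk3_eta] at hao
  unfold AA at h ⊢
  rw [hao.1, hao.2.1, hao.2.2]
  have a1 := ao_nonneg (n := n) (m+1) u
  have a2 := ao_nonneg (n := n) (m+2) u
  have r1 : r ^ n ≤ 1 := pow_le_one₀ h0 h1
  rw [min_lt_iff] at h ⊢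
  rcases h with h | h
  · left; nlinarith
  · right; nlinarith

lemma AA_mk0 (hn : 1 ≤ n) (m : Fin 3) {s : ℂ} (h : NR n s) : AA n m (mk3 m 0 s 1) := by
  have h1 : ao n m (mk3 m 0 s 1) ≠ 0 := by
    rw [← NR_ao hn, mk3_1, mk3_2, div_one]; exact h
  have h2 := ao_of_zero hn (mk3_0 m 0 s 1)
  unfold AA
  rw [h2.1, h2.2.1, min_self]
  exact lt_of_le_of_ne (ao_nonneg _ _) h1.symm

lemma AA_to_mk0 (hn : 1 ≤ n) (m : Fin 3) {u : Fin 3 → ℂ} (h : AA n m u) :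
    JoinedIn {u | AA n m u} u (mk3 m 0 (u (m+1) / u (m+2)) 1) := by
  have hne := ne_zero_of_ao hn (AA_ao h)
  have j1 := joined_line (Q := AA n m)
    (fun t : ℝ => mk3 m (((1-t : ℝ) : ℂ) * u m) (u (m+1)) (u (m+2)))
    (mk3_cont m (by fun_prop) (by fun_prop) (by fun_prop))
    (fun t h0 h1 => AA_shrink m h (by linarith) (by linarith))
  have h1 := j1.target_mem
  have j2 := joined_smul (Q := AA n m) (fun c hc u => (AA_smul hc m u).2) h1 (inv_ne_zero hne.2)
  have j := j1.trans j2
  simp only [sub_zero, Complex.ofReal_one, one_mul, mk3_eta, sub_self, Complex.ofReal_zero,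
    zero_mul, mk3_smul, mul_zero, inv_mul_cancel₀ hne.2] at j
  rwa [div_eq_inv_mul]

lemma AA_joined (hn : 1 ≤ n) (m : Fin 3) {u v : Fin 3 → ℂ} (hu : AA n m u) (hv : AA n m v)
    (h : ar n m u = ar n m v) : JoinedIn {u | AA n m u} u v := by
  obtain ⟨γ, c, g0, g1, -, hγ⟩ := arc_path hn ((NR_ao hn).2 (AA_ao hu)) ((NR_ao hn).2 (AA_ao hv)) h
  have j := joined_line (Q := AA n m) (fun t => mk3 m 0 (γ t) 1)
    (mk3_cont m (by fun_prop) c (by fun_prop)) (fun t h0 h1 => AA_mk0 hn m (hγ t h0 h1).1)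
  simp only [g0, g1] at j
  exact (AA_to_mk0 hn m hu).trans (j.trans (AA_to_mk0 hn m hv).symm)

lemma EE_grow (m : Fin 3) {u : Fin 3 → ℂ} (h : EE n m u) {r : ℝ} (h1 : 1 ≤ r) :
    EE n m (mk3 m (r * u m) (u (m+1)) (u (m+2))) := by
  have hao := ao_mk3_scale (n := n) (by linarith : 0 ≤ r) m (u m) (u (m+1)) (u (m+2))
  rw [mk3_eta] at hao
  unfold EE at h ⊢
  rw [hao.1, hao.2.1, hao.2.2]
  have a1 := ao_nonneg (n := n) (m+1) u
  have a2 := ao_nonneg (n := n) (m+2) u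
  have r1 : 1 ≤ r ^ n := one_le_pow₀ h1
  rw [lt_min_iff] at h ⊢
  exact ⟨by nlinarith, by nlinarith⟩

lemma EE_to_mk (hn : 1 ≤ n) (m : Fin 3) {u : Fin 3 → ℂ} (h : EE n m u) {r : ℝ} (hr : 1 ≤ r) :
    JoinedIn {u | EE n m u} u (mk3 m r (u m / u (m+1))⁻¹ (u (m+2) / u m)) := by
  have hne := (ne_zero_of_ao hn (EE_ao h).1).2
  rw [i12] at hne
  have j2 := joined_smul (Q := EE n m) (fun c hc u => (EE_smul hc m u).2) h (inv_ne_zero hne)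
  have h1 := j2.target_mem
  have j1 := joined_line (Q := EE n m)
    (fun t : ℝ => mk3 m (((1 + t * (r-1) : ℝ) : ℂ) * ((u m)⁻¹ • u) m) (((u m)⁻¹ • u) (m+1))
      (((u m)⁻¹ • u) (m+2)))
    (mk3_cont m (by fun_prop) (by fun_prop) (by fun_prop))
    (fun t h0 _ => EE_grow m h1 (by nlinarith))
  simp only [zero_mul, add_zero, Complex.ofReal_one, one_mul, mk3_eta, Pi.smul_apply, smul_eq_mul,
    inv_mul_cancel₀ hne, mul_one, add_sub_cancel] at j1
  rw [inv_div, div_eq_inv_mul, div_eq_inv_mul]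
  refine j2.trans ?_
  convert j1 using 1
  conv_lhs => rw [← mk3_eta m ((u m)⁻¹ • u)]
  simp [inv_mul_cancel₀ hne]

lemma EE_joined (hn : 1 ≤ n) (m : Fin 3) {u v : Fin 3 → ℂ} (hu : EE n m u) (hv : EE n m v)
    (h1 : ar n (m+1) u = ar n (m+1) v) (h2 : ar n (m+2) u = ar n (m+2) v) :
    JoinedIn {u | EE n m u} u v := by
  obtain ⟨γ, c, g0, g1, gn, hγ⟩ := arc_path hn ((NR_ao hn).2 (EE_ao hu).1) ((NR_ao hn).2 (EE_ao hv).1) h1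
  obtain ⟨δ, c', d0, d1, dn, hδ⟩ := arc_path hn ((NR_ao hn).2 (EE_ao hu).2) ((NR_ao hn).2 (EE_ao hv).2) h2
  rw [i11, i12] at g0 g1
  rw [i21, i22] at d0 d1
  set w : ℝ → Fin 3 → ℂ := fun t => mk3 m 1 (δ t)⁻¹ (γ t) with hw
  have hwc : Continuous w := mk3_cont m (by fun_prop) (c'.inv₀ dn) c
  have hpos : ∀ t, 0 ≤ t → t ≤ 1 → 0 < min (ao n (m+1) (w t)) (ao n (m+2) (w t)) := by
    intro t t0 t1
    rw [lt_min_iff]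
    constructor
    · refine lt_of_le_of_ne (ao_nonneg _ _) (Ne.symm ?_)
      rw [← NR_ao hn, i11, i12]
      simp only [hw, mk3_2, mk3_0, div_one]
      exact (hγ t t0 t1).1
    · refine lt_of_le_of_ne (ao_nonneg _ _) (Ne.symm ?_)
      rw [← NR_ao hn, i21, i22]
      simp only [hw, mk3_1, mk3_0, one_div, inv_inv]
      exact (hδ t t0 t1).1
  have hcont : ContinuousOn (fun t => ao n m (w t) / min (ao n (m+1) (w t)) (ao n (m+2) (w t)))
      (Icc (0:ℝ) 1) := by
    refine ContinuousOn.div ?_ ?_ fun t ht => (hpos t ht.1 ht.2).ne'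
    · exact ((continuous_ao m).comp hwc).continuousOn
    · exact (((continuous_ao (m+1)).comp hwc).min ((continuous_ao (m+2)).comp hwc)).continuousOn
  obtain ⟨M, hM⟩ := (isCompact_Icc.image_of_continuousOn hcont).bddAbove
  set r : ℝ := max 1 (M + 1) with hr
  have hr1 : 1 ≤ r := le_max_left _ _
  have j := joined_line (Q := EE n m) (fun t => mk3 m r (δ t)⁻¹ (γ t))
    (mk3_cont m (by fun_prop) (c'.inv₀ dn) c) (fun t t0 t1 => by
      have hb := hM ⟨t, ⟨t0, t1⟩, rfl⟩
      have hp := hpos t t0 t1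
      simp only at hb
      rw [div_le_iff₀ hp] at hb
      have hao := ao_mk3_scale (n := n) (by linarith : 0 ≤ r) m 1 (δ t)⁻¹ (γ t)
      rw [mul_one] at hao
      unfold EE
      rw [hao.1, hao.2.1, hao.2.2, ← mul_min_of_nonneg _ _ (by positivity)]
      have r2 : r ≤ r ^ n := le_self_pow₀ hr1 (by omega)
      have r3 : M + 1 ≤ r := le_max_right _ _
      change ao n m (w t) < r ^ n * min (ao n (m+1) (w t)) (ao n (m+2) (w t))
      nlinarith)
  simp only [g0, g1, d0, d1] at j
  exact (EE_to_mk hn m hu hr1).trans (j.trans (EE_to_mk hn m hv hr1).symm)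

/-- the difference functions in the chart -/
def Lk (k : Fin 3) (a b : ℂ) : ℝ := jj (k+1) ![a, b, 1] - jj (k+2) ![a, b, 1]

lemma cc_Ph (hn : 1 ≤ n) (O : ZMod n × ZMod n) {a b : ℂ} (h : TT a b) (m : Fin 3) :
    cc O m (Ph O a b) = jj m ![a, b, 1] := by
  unfold cc; rw [Av_Ph hn O h]

lemma cc_vals (a b : ℂ) : jj 0 ![a, b, 1] = b.im ∧ jj 1 ![a, b, 1] = -a.im ∧
    jj 2 ![a, b, 1] = a.im * b.re - a.re * b.im := by
  refine ⟨by simp [jj], by simp [jj], by simp [jj]; ring⟩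

def VL (O : ZMod n × ZMod n) (k : Fin 3) (σ : ℝ) (u : Fin 3 → ℂ) : Prop :=
  VV O u ∧ 0 < σ * (cc O (k+1) u - cc O (k+2) u)

lemma VL_smul {O : ZMod n × ZMod n} {k : Fin 3} {σ : ℝ} (c : ℂ) (hc : c ≠ 0) (u : Fin 3 → ℂ)
    (h : VL O k σ u) : VL O k σ (c • u) := by
  unfold VL at *
  rw [VV_smul hc, cc_smul hc, cc_smul hc]; exact h

lemma Ph_cont {T : Type*} [TopologicalSpace T] (O : ZMod n × ZMod n) {a b : T → ℂ} {t : T}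
    (ha : ContinuousAt a t) (hb : ContinuousAt b t) (h : TT (a t) (b t)) :
    ContinuousAt (fun t => Ph O (a t) (b t)) t := by
  refine continuousAt_pi.2 fun i => ?_
  have r1 : ContinuousAt (fun t => rti n (a t)) t :=
    ContinuousAt.comp (g := rti n) (rti_cont h.pos1) ha
  have r2 : ContinuousAt (fun t => rti n (b t)) t :=
    ContinuousAt.comp (g := rti n) (rti_cont h.pos2) hb
  fin_cases i
  · exact continuousAt_const.mul r1
  · exact continuousAt_const.mul r2
  · exact continuousAt_const

lemma Ph_line (hn : 1 ≤ n) {O : ZMod n × ZMod n} {k : Fin 3} {σ : ℝ} (a b : ℝ → ℂ)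
    (ha : Continuous a) (hb : Continuous b)
    (h : ∀ t, 0 ≤ t → t ≤ 1 → TT (a t) (b t) ∧ 0 < σ * Lk k (a t) (b t)) :
    JoinedIn {u | VL O k σ u} (Ph O (a 0) (b 0)) (Ph O (a 1) (b 1)) := by
  refine JoinedIn.ofLine (f := fun t => Ph O (a t) (b t)) ?_ rfl rfl ?_
  · intro t ht
    exact (Ph_cont O ha.continuousAt hb.continuousAt (h t ht.1 ht.2).1).continuousWithinAt
  · rintro _ ⟨t, ht, rfl⟩
    obtain ⟨h1, h2⟩ := h t ht.1 ht.2
    refine ⟨VV_Ph hn O h1, ?_⟩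
    rw [cc_Ph hn O h1, cc_Ph hn O h1]
    exact h2

/-- sample points -/
def pp (O : ZMod n × ZMod n) (x y : ℝ) : Fin 3 → ℂ := Ph O (1 + x * I) (1 + y * I)

lemma Lk_aff (k : Fin 3) (p q x y x' y' t : ℝ) :
    Lk k ⟨p, (1-t) * x + t * x'⟩ ⟨q, (1-t) * y + t * y'⟩ =
      (1-t) * Lk k ⟨p, x⟩ ⟨q, y⟩ + t * Lk k ⟨p, x'⟩ ⟨q, y'⟩ := by
  fin_cases k <;> simp [Lk, jj] <;> ring

lemma VL_joined (hn : 1 ≤ n) {O : ZMod n × ZMod n} {k : Fin 3} {σ : ℝ} {u : Fin 3 → ℂ}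
    (h : VL O k σ u) {x y : ℝ}
    (hs : ∀ p q : ℝ, 0 < p → 0 < q → 0 < σ * Lk k ⟨p, x⟩ ⟨q, y⟩) :
    JoinedIn {u | VL O k σ u} u (pp O x y) := by
  obtain ⟨hV, hL⟩ := h
  have hT := hV.2.2.2
  set a := rt n (sA O u) with ha
  set b := rt n (sB O u) with hb
  have hL' : 0 < σ * Lk k a b := hL
  have ea : (⟨a.re, a.im⟩ : ℂ) = a := rfl
  have eb : (⟨b.re, b.im⟩ : ℂ) = b := rfl
  have e1 := Ph_Av hn hV
  have j1 : JoinedIn {u | VL O k σ u} (Ph O a b) u := by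
    have := joined_smul (Q := VL O k σ) (fun c hc u => VL_smul c hc u) (u := Ph O a b)
      (c := u 2) (by
        rw [← e1] at hL hV
        refine ⟨VV_Ph hn O hT, ?_⟩
        rw [cc_Ph hn O hT, cc_Ph hn O hT]; exact hL') hV.1
    rwa [e1] at this
  have cm : ∀ f g : ℝ → ℝ, Continuous f → Continuous g →
      Continuous fun t => (⟨f t, g t⟩ : ℂ) := fun f g hf hg => by
    have : (fun t => (⟨f t, g t⟩ : ℂ)) = fun t => (f t : ℂ) + (g t : ℂ) * I := by
      funext t; exact Complex.mk_eq_add_mul_I _ _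
    rw [this]; fun_prop
  have j2 := Ph_line hn (O := O) (k := k) (σ := σ)
    (fun t => ⟨a.re, (1-t) * a.im + t * x⟩) (fun t => ⟨b.re, (1-t) * b.im + t * y⟩)
    (cm _ _ (by fun_prop) (by fun_prop)) (cm _ _ (by fun_prop) (by fun_prop))
    (fun t t0 t1 => ⟨hT, by
      rw [Lk_aff, ea, eb]
      have := hs a.re b.re hT.pos1 hT.pos2
      rcases eq_or_lt_of_le t0 with rfl | t0
      · simpa using hL'
      · nlinarith [mul_pos t0 this, mul_nonneg (sub_nonneg.2 t1) hL'.le]⟩)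
  have j3 := Ph_line hn (O := O) (k := k) (σ := σ)
    (fun t => ⟨(1-t) * a.re + t, x⟩) (fun t => ⟨(1-t) * b.re + t, y⟩)
    (cm _ _ (by fun_prop) (by fun_prop)) (cm _ _ (by fun_prop) (by fun_prop))
    (fun t t0 t1 => by
      have p1 := hT.pos1
      have p2 := hT.pos2
      obtain ⟨h1, h2, h3⟩ := hT
      refine ⟨⟨?_, ?_, ?_⟩, hs _ _ ?_ ?_⟩
      · simp only; nlinarith
      · simp only; nlinarith
      · simp only; have := conv_lt t0 t1 h3 (by norm_num : (1:ℝ) < 2); linarith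
      · rcases eq_or_lt_of_le t0 with rfl | t0
        · simpa using p1
        · nlinarith
      · rcases eq_or_lt_of_le t0 with rfl | t0
        · simpa using p2
        · nlinarith)
  simp only [sub_zero, one_mul, zero_mul, add_zero, sub_self, zero_add, ea, eb] at j2 j3
  have e : pp O x y = Ph O ⟨1, x⟩ ⟨1, y⟩ := by
    unfold pp; rw [Complex.mk_eq_add_mul_I, Complex.mk_eq_add_mul_I]; simp
  rw [e]
  exact j1.symm.trans (j2.trans j3)

end CN
end

end

section

open Topology Set
noncomputable section
namespace CN

open ComplexConjugate
open Complex (I)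
open scoped Real

variable {n : ℕ} {X : Type*} [TopologicalSpace X]

lemma contr {s : Set X} {x0 : X} (hx0 : x0 ∈ s) (H : ℝ → X → X)
    (hm : ∀ t x, 0 ≤ t → t ≤ 1 → x ∈ s → H t x ∈ s)
    (hc : ∀ t x, 0 ≤ t → t ≤ 1 → x ∈ s → ContinuousAt (fun p : ℝ × X => H p.1 p.2) (t, x))
    (h0 : ∀ x ∈ s, H 0 x = x0) (h1 : ∀ x ∈ s, H 1 x = x) : IsSimplyConnected s := by
  have : ContractibleSpace s := by
    rw [contractible_iff_id_nullhomotopic]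
    refine ⟨⟨x0, hx0⟩, ContinuousMap.Homotopic.symm ⟨⟨⟨fun p => ⟨H p.1 p.2, hm _ _ p.1.2.1 p.1.2.2 p.2.2⟩, ?_⟩, ?_, ?_⟩⟩⟩
    · refine Continuous.subtype_mk ?_ _
      rw [continuous_iff_continuousAt]
      rintro ⟨t, x⟩
      have : ContinuousAt (fun p : unitInterval × s => ((p.1 : ℝ), (p.2 : X))) (t, x) := by fun_prop
      exact ContinuousAt.comp (g := fun p : ℝ × X => H p.1 p.2) (f := fun p : unitInterval × s => ((p.1 : ℝ), (p.2 : X))) (hc _ _ t.2.1 t.2.2 x.2) this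
    · intro x; exact Subtype.ext (by simpa using h0 x x.2)
    · intro x; exact Subtype.ext (by simpa using h1 x x.2)
  exact (inferInstance : SimplyConnectedSpace s)

structure Mdl (n : ℕ) (X : Type*) [TopologicalSpace X] where
  pr : (Fin 3 → ℂ) → X
  rp : X → Fin 3 → ℂ
  hGG : ∀ x, GG n (rp x) ≠ 0
  pr_rp : ∀ x, pr (rp x) = x
  pr_cont : ∀ u, GG n u ≠ 0 → ContinuousAt pr u
  pr_open : ∀ u, GG n u ≠ 0 → 𝓝 (pr u) ≤ Filter.map pr (𝓝 u)
  rp_pr : ∀ u, GG n u ≠ 0 → ∃ c : ℂ, c ≠ 0 ∧ rp (pr u) = c • u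
  pr_smul : ∀ u, GG n u ≠ 0 → ∀ c : ℂ, c ≠ 0 → pr (c • u) = pr u

variable (M : Mdl n X)

def SI (Q : (Fin 3 → ℂ) → Prop) : Prop := ∀ c : ℂ, c ≠ 0 → ∀ u, Q (c • u) ↔ Q u

def dn (Q : (Fin 3 → ℂ) → Prop) : Set X := {x | Q (M.rp x)}

lemma mem_pr {Q : (Fin 3 → ℂ) → Prop} (hQ : SI Q) {u : Fin 3 → ℂ} (hu : GG n u ≠ 0) :
    M.pr u ∈ dn M Q ↔ Q u := by
  obtain ⟨c, hc, h⟩ := M.rp_pr u hu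
  unfold dn; rw [mem_ofPred_eq, h]; exact hQ c hc u

lemma GG_near {u : Fin 3 → ℂ} (h : GG n u ≠ 0) : ∀ᶠ v in 𝓝 u, GG n v ≠ 0 :=
  continuous_GG.continuousAt.eventually_ne h

lemma ev_rp {Q : (Fin 3 → ℂ) → Prop} (hQ : SI Q) {x : X} (h : ∀ᶠ v in 𝓝 (M.rp x), Q v) :
    ∀ᶠ y in 𝓝 x, Q (M.rp y) := by
  have h1 := M.pr_open _ (M.hGG x)
  rw [M.pr_rp] at h1
  apply h1
  rw [Filter.mem_map]
  filter_upwards [h, GG_near (M.hGG x)] with v h1 h2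
  exact (mem_pr M hQ h2).2 h1

lemma cont_rp {E : Type*} [TopologicalSpace E] {G : (Fin 3 → ℂ) → E}
    (hG : ∀ c : ℂ, c ≠ 0 → ∀ u, G (c • u) = G u) {x : X} (h : ContinuousAt G (M.rp x)) :
    ContinuousAt (fun y => G (M.rp y)) x := by
  intro s hs
  have h2 := h hs
  exact ev_rp M (Q := fun v => G v ∈ s) (fun c hc u => by simp only [hG c hc]) h2

lemma isOpen_dn {Q : (Fin 3 → ℂ) → Prop} (hQ : SI Q) (h : ∀ u, Q u → ∀ᶠ v in 𝓝 u, Q v) :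
    IsOpen (dn M Q) := by
  rw [isOpen_iff_mem_nhds]
  intro x hx
  exact ev_rp M hQ (h _ hx)

lemma joined_pr {Q : (Fin 3 → ℂ) → Prop} (hQ : SI Q) (hG : ∀ u, Q u → GG n u ≠ 0)
    {u v : Fin 3 → ℂ} (h : JoinedIn {u | Q u} u v) : JoinedIn (dn M Q) (M.pr u) (M.pr v) := by
  obtain ⟨γ, hγ⟩ := h
  refine ⟨⟨⟨fun t => M.pr (γ t), ?_⟩, by simp, by simp⟩, fun t => (mem_pr M hQ (hG _ (hγ t))).2 (hγ t)⟩
  rw [continuous_iff_continuousAt]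
  intro t
  exact ContinuousAt.comp (M.pr_cont _ (hG _ (hγ t))) γ.continuous.continuousAt

lemma SI_SS (a : Idx n) : SI (SS a) := fun _ hc u => SS_smul hc a u

def UU (a : Idx n) : Set X := dn M (SS a)

lemma isOpen_UU (hn : 1 ≤ n) (a : Idx n) : IsOpen (UU M a) :=
  isOpen_dn M (SI_SS a) fun _ h => SS_near hn h

lemma UU_cover (hn : 1 ≤ n) (x : X) : ∃ a, x ∈ UU M a := SS_cover hn (M.hGG x)

def nrm (k : Fin 3) (u : Fin 3 → ℂ) : Fin 3 → ℂ := (u k)⁻¹ • u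

lemma nrm_smul (k : Fin 3) (c : ℂ) (hc : c ≠ 0) (u : Fin 3 → ℂ) : nrm k (c • u) = nrm k u := by
  unfold nrm
  rw [Pi.smul_apply, smul_eq_mul, mul_inv, smul_smul, mul_right_comm, inv_mul_cancel₀ hc, one_mul]

lemma nrm_cont (k : Fin 3) {u : Fin 3 → ℂ} (h : u k ≠ 0) : ContinuousAt (nrm k) u := by
  unfold nrm
  exact ((continuous_apply k).continuousAt.inv₀ h).smul continuousAt_id

lemma dsc_one (k : Fin 3) (u : Fin 3 → ℂ) : dsc (dk k 1) u = u := by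
  funext i; simp [dsc, dk]

lemma UC_simply (hn : 1 ≤ n) (k : Fin 3) : IsSimplyConnected (UU M (Sum.inl k)) := by
  have hS : ∀ x ∈ UU M (Sum.inl k), M.rp x k ≠ 0 := fun x hx => ne_zero_of_UC hn hx
  have hN : ∀ x ∈ UU M (Sum.inl k), UC n k (nrm k (M.rp x)) := fun x hx =>
    (UC_smul (inv_ne_zero (hS x hx)) k _).2 hx
  set e : Fin 3 → ℂ := fun i => if i = k then 1 else 0 with he
  have hz : ∀ x ∈ UU M (Sum.inl k), dsc (dk k 0) (nrm k (M.rp x)) = e := fun x hx => by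
    funext i
    by_cases hi : i = k
    · subst hi; simp [dsc, dk, nrm, he, hS x hx]
    · simp [dsc, dk, he, hi]
  have hee : UC n k e := by
    right
    have h1 : ∀ i, i ≠ k → sq n i e = 0 := fun i hi => by
      unfold sq Pw; simp [he, hi, show n ≠ 0 by omega]
    have h2 : sq n k e = 1 := by unfold sq Pw; simp [he]
    rw [h1 _ (by simp), h1 _ (by simp), h2]; norm_num
  refine contr (x0 := M.pr e) ((mem_pr M (SI_SS (Sum.inl k)) (GG_ne_of_UC hee)).2 hee)
    (fun s x => M.pr (dsc (dk k s) (nrm k (M.rp x)))) ?_ ?_ ?_ ?_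
  · intro t x h0 h1 hx
    have := UC_contract hn (hN x hx) h0 h1
    exact (mem_pr M (SI_SS (Sum.inl k)) (GG_ne_of_UC this)).2 this
  · intro t x h0 h1 hx
    have hc := GG_ne_of_UC (UC_contract hn (hN x hx) h0 h1)
    refine ContinuousAt.comp (g := M.pr) (f := fun p : ℝ × X => dsc (dk k p.1) (nrm k (M.rp p.2)))
      (M.pr_cont _ hc) ?_
    have c1 : ContinuousAt (fun p : ℝ × X => nrm k (M.rp p.2)) (t, x) :=
      ContinuousAt.comp (g := fun y => nrm k (M.rp y)) (f := Prod.snd)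
        (cont_rp M (nrm_smul k) (nrm_cont k (hS x hx))) continuousAt_snd
    refine continuousAt_pi.2 fun i => ?_
    have c2 := continuousAt_pi.1 c1 i
    unfold dsc
    refine ContinuousAt.mul ?_ c2
    unfold dk
    split_ifs
    · fun_prop
    · fun_prop
  · intro x hx; simp only [hz x hx]
  · intro x hx
    simp only [dsc_one]
    unfold nrm
    rw [M.pr_smul _ (M.hGG x) _ (inv_ne_zero (hS x hx)), M.pr_rp]

lemma V_simply (hn : 1 ≤ n) (O : ZMod n × ZMod n) : IsSimplyConnected (UU M (Sum.inr O)) := by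
  have T1 : TT 1 1 := by unfold TT; norm_num
  have hT : ∀ x ∈ UU M (Sum.inr O), ∀ t : ℝ, 0 ≤ t → t ≤ 1 →
      TT (1 + t * (rt n (sA O (M.rp x)) - 1)) (1 + t * (rt n (sB O (M.rp x)) - 1)) := by
    intro x hx t h0 h1
    obtain ⟨-, -, -, a1, a2, a3⟩ := hx
    refine ⟨?_, ?_, ?_⟩
    · simp; nlinarith
    · simp; nlinarith
    · simp
      have := conv_lt h0 h1 (by norm_num : (1:ℝ) < 2) a3
      linarith
  refine contr (x0 := M.pr (Ph O 1 1)) ((mem_pr M (SI_SS (Sum.inr O)) (GG_VV hn (VV_Ph hn O T1))).2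
    (VV_Ph hn O T1)) (fun t x => M.pr (Ph O (1 + t * (rt n (sA O (M.rp x)) - 1))
      (1 + t * (rt n (sB O (M.rp x)) - 1)))) ?_ ?_ ?_ ?_
  · intro t x h0 h1 hx
    have := VV_Ph hn O (hT x hx t h0 h1)
    exact (mem_pr M (SI_SS (Sum.inr O)) (GG_VV hn this)).2 this
  · intro t x h0 h1 hx
    have := hT x hx t h0 h1
    obtain ⟨k1, k2, -⟩ := VV_near hn hx
    have c1 : ContinuousAt (fun p : ℝ × X => rt n (sA O (M.rp p.2))) (t, x) :=
      ContinuousAt.comp (g := fun y => rt n (sA O (M.rp y))) (f := Prod.snd)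
        (cont_rp M (G := fun u => rt n (sA O u)) (fun c hc u => by rw [sA_smul hc]) k1) continuousAt_snd
    have c2 : ContinuousAt (fun p : ℝ × X => rt n (sB O (M.rp p.2))) (t, x) :=
      ContinuousAt.comp (g := fun y => rt n (sB O (M.rp y))) (f := Prod.snd)
        (cont_rp M (G := fun u => rt n (sB O u)) (fun c hc u => by rw [sB_smul hc]) k2) continuousAt_snd
    refine ContinuousAt.comp (g := M.pr) (f := fun p : ℝ × X =>
      Ph O (1 + p.1 * (rt n (sA O (M.rp p.2)) - 1)) (1 + p.1 * (rt n (sB O (M.rp p.2)) - 1)))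
      (M.pr_cont _ (GG_VV hn (VV_Ph hn O this))) ?_
    refine Ph_cont O ?_ ?_ this
    · fun_prop
    · fun_prop
  · intro x hx; simp
  · intro x hx
    have h := Ph_Av hn hx
    simp only [Complex.ofReal_one, one_mul, add_sub_cancel]
    have h2 := M.pr_smul _ (GG_VV hn (VV_Ph hn O hx.2.2.2)) _ hx.1
    rw [← h2, h, M.pr_rp]

lemma UU_simply (hn : 1 ≤ n) (a : Idx n) : IsSimplyConnected (UU M a) := by
  rcases a with k | O
  · exact UC_simply M hn k
  · exact V_simply M hn O

end CN
end

end

section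

open Topology Set
noncomputable section
namespace CN

open ComplexConjugate
open Complex (I)
open scoped Real

variable {n : ℕ}

lemma pp_facts (hn : 1 ≤ n) (O : ZMod n × ZMod n) (x y : ℝ) :
    VV O (pp O x y) ∧ cc O 0 (pp O x y) = y ∧ cc O 1 (pp O x y) = -x ∧ cc O 2 (pp O x y) = x - y := by
  have hT : TT (1 + x * I) (1 + y * I) := by unfold TT; simp
  obtain ⟨h0, h1, h2⟩ := cc_vals (1 + x * I) (1 + y * I)
  refine ⟨VV_Ph hn O hT, ?_, ?_, ?_⟩
  · unfold pp; rw [cc_Ph hn O hT, h0]; simp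
  · unfold pp; rw [cc_Ph hn O hT, h1]; simp
  · unfold pp; rw [cc_Ph hn O hT, h2]; simp

abbrev S1 (O : ZMod n × ZMod n) := pp O 0 1
abbrev S2 (O : ZMod n × ZMod n) := pp O (-1) 0
abbrev S3 (O : ZMod n × ZMod n) := pp O 0 (-1)
abbrev S4 (O : ZMod n × ZMod n) := pp O 1 0

lemma UC_pp (hn : 1 ≤ n) (O : ZMod n × ZMod n) {x y : ℝ} (h : y ≠ -x) (h0 : -x ≠ x - y) (h1 : x - y ≠ y)
    (k : Fin 3) : UC n k (pp O x y) := by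
  obtain ⟨hV, c0, c1, c2⟩ := pp_facts hn O x y
  rw [UC_cc hn hV]
  fin_cases k
  · change cc O 1 _ ≠ cc O 2 _; rw [c1, c2]; exact h0
  · change cc O 2 _ ≠ cc O 0 _; rw [c0, c2]; exact h1
  · change cc O 0 _ ≠ cc O 1 _; rw [c1, c0]; exact h

lemma UC_S1 (hn : 1 ≤ n) (O : ZMod n × ZMod n) (k : Fin 3) : UC n k (S1 O) :=
  UC_pp hn O (by norm_num) (by norm_num) (by norm_num) k
lemma UC_S2 (hn : 1 ≤ n) (O : ZMod n × ZMod n) (k : Fin 3) : UC n k (S2 O) :=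
  UC_pp hn O (by norm_num) (by norm_num) (by norm_num) k
lemma UC_S3 (hn : 1 ≤ n) (O : ZMod n × ZMod n) (k : Fin 3) : UC n k (S3 O) :=
  UC_pp hn O (by norm_num) (by norm_num) (by norm_num) k
lemma UC_S4 (hn : 1 ≤ n) (O : ZMod n × ZMod n) (k : Fin 3) : UC n k (S4 O) :=
  UC_pp hn O (by norm_num) (by norm_num) (by norm_num) k
lemma VV_pp (hn : 1 ≤ n) (O : ZMod n × ZMod n) (x y : ℝ) : VV O (pp O x y) := (pp_facts hn O x y).1

lemma ar_pp (hn : 1 ≤ n) (O : ZMod n × ZMod n) (x y : ℝ) :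
    (0 < y → ar n 0 (pp O x y) = O.2) ∧ (y < 0 → ar n 0 (pp O x y) = O.2 - 1) ∧
    (0 < -x → ar n 1 (pp O x y) = -O.1) ∧ (-x < 0 → ar n 1 (pp O x y) = -O.1 - 1) ∧
    (0 < x - y → ar n 2 (pp O x y) = O.1 - O.2) ∧ (x - y < 0 → ar n 2 (pp O x y) = O.1 - O.2 - 1) := by
  obtain ⟨hV, c0, c1, c2⟩ := pp_facts hn O x y
  have a0 := ar_V hn hV 0
  have a1 := ar_V hn hV 1
  have a2 := ar_V hn hV 2
  rw [c0] at a0; rw [c1] at a1; rw [c2] at a2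
  exact ⟨a0.1, a0.2, a1.1, a1.2, a2.1, a2.2⟩

lemma S1_A (hn : 1 ≤ n) (O : ZMod n × ZMod n) : AA n 0 (S1 O) ∧ ar n 0 (S1 O) = O.2 := by
  obtain ⟨hV, c0, c1, c2⟩ := pp_facts hn O 0 1
  refine ⟨(V_max hn hV (m := 0) ?_ ?_).1, (ar_pp hn O 0 1).1 (by norm_num)⟩
  · change cc O 1 _ < cc O 0 _; rw [c0, c1]; norm_num
  · change cc O 2 _ < cc O 0 _; rw [c0, c2]; norm_num

lemma S1_E (hn : 1 ≤ n) (O : ZMod n × ZMod n) : EE n 1 (S1 O) ∧ ar n 0 (S1 O) = O.2 ∧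
    ar n 2 (S1 O) = O.1 - O.2 - 1 := by
  obtain ⟨hV, c0, c1, c2⟩ := pp_facts hn O 0 1
  refine ⟨(V_med hn hV (m := 1) ?_ ?_).1, (ar_pp hn O 0 1).1 (by norm_num),
    (ar_pp hn O 0 1).2.2.2.2.2 (by norm_num)⟩
  · change cc O 2 _ < cc O 1 _; rw [c2, c1]; norm_num
  · change cc O 1 _ < cc O 0 _; rw [c0, c1]; norm_num

lemma S2_A (hn : 1 ≤ n) (O : ZMod n × ZMod n) : AA n 1 (S2 O) ∧ ar n 1 (S2 O) = -O.1 := by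
  obtain ⟨hV, c0, c1, c2⟩ := pp_facts hn O (-1) 0
  refine ⟨(V_max hn hV (m := 1) ?_ ?_).1, (ar_pp hn O (-1) 0).2.2.1 (by norm_num)⟩
  · change cc O 2 _ < cc O 1 _; rw [c2, c1]; norm_num
  · change cc O 0 _ < cc O 1 _; rw [c0, c1]; norm_num

lemma S2_E (hn : 1 ≤ n) (O : ZMod n × ZMod n) : EE n 0 (S2 O) ∧ ar n 1 (S2 O) = -O.1 ∧
    ar n 2 (S2 O) = O.1 - O.2 - 1 := by
  obtain ⟨hV, c0, c1, c2⟩ := pp_facts hn O (-1) 0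
  refine ⟨(V_med' hn hV (m := 0) ?_ ?_).1, (ar_pp hn O (-1) 0).2.2.1 (by norm_num),
    (ar_pp hn O (-1) 0).2.2.2.2.2 (by norm_num)⟩
  · change cc O 0 _ < cc O 1 _; rw [c0, c1]; norm_num
  · change cc O 2 _ < cc O 0 _; rw [c0, c2]; norm_num

lemma S3_A (hn : 1 ≤ n) (O : ZMod n × ZMod n) : AA n 2 (S3 O) ∧ ar n 2 (S3 O) = O.1 - O.2 := by
  obtain ⟨hV, c0, c1, c2⟩ := pp_facts hn O 0 (-1)
  refine ⟨(V_max hn hV (m := 2) ?_ ?_).1, (ar_pp hn O 0 (-1)).2.2.2.2.1 (by norm_num)⟩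
  · change cc O 0 _ < cc O 2 _; rw [c0, c2]; norm_num
  · change cc O 1 _ < cc O 2 _; rw [c1, c2]; norm_num

lemma S3_B (hn : 1 ≤ n) (O : ZMod n × ZMod n) : AA n 0 (S3 O) ∧ ar n 0 (S3 O) = O.2 - 1 := by
  obtain ⟨hV, c0, c1, c2⟩ := pp_facts hn O 0 (-1)
  refine ⟨(V_min hn hV (m := 0) ?_ ?_).1, (ar_pp hn O 0 (-1)).2.1 (by norm_num)⟩
  · change cc O 0 _ < cc O 1 _; rw [c0, c1]; norm_num
  · change cc O 0 _ < cc O 2 _; rw [c0, c2]; norm_num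

lemma S3_E (hn : 1 ≤ n) (O : ZMod n × ZMod n) : EE n 1 (S3 O) ∧ ar n 0 (S3 O) = O.2 - 1 ∧
    ar n 2 (S3 O) = O.1 - O.2 := by
  obtain ⟨hV, c0, c1, c2⟩ := pp_facts hn O 0 (-1)
  refine ⟨(V_med' hn hV (m := 1) ?_ ?_).1, (ar_pp hn O 0 (-1)).2.1 (by norm_num),
    (ar_pp hn O 0 (-1)).2.2.2.2.1 (by norm_num)⟩
  · change cc O 1 _ < cc O 2 _; rw [c2, c1]; norm_num
  · change cc O 0 _ < cc O 1 _; rw [c0, c1]; norm_num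

lemma S4_A (hn : 1 ≤ n) (O : ZMod n × ZMod n) : AA n 1 (S4 O) ∧ ar n 1 (S4 O) = -O.1 - 1 := by
  obtain ⟨hV, c0, c1, c2⟩ := pp_facts hn O 1 0
  refine ⟨(V_min hn hV (m := 1) ?_ ?_).1, (ar_pp hn O 1 0).2.2.2.1 (by norm_num)⟩
  · change cc O 1 _ < cc O 2 _; rw [c2, c1]; norm_num
  · change cc O 1 _ < cc O 0 _; rw [c0, c1]; norm_num

lemma S4_E (hn : 1 ≤ n) (O : ZMod n × ZMod n) : EE n 0 (S4 O) ∧ ar n 1 (S4 O) = -O.1 - 1 ∧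
    ar n 2 (S4 O) = O.1 - O.2 := by
  obtain ⟨hV, c0, c1, c2⟩ := pp_facts hn O 1 0
  refine ⟨(V_med hn hV (m := 0) ?_ ?_).1, (ar_pp hn O 1 0).2.2.2.1 (by norm_num),
    (ar_pp hn O 1 0).2.2.2.2.1 (by norm_num)⟩
  · change cc O 1 _ < cc O 0 _; rw [c0, c1]; norm_num
  · change cc O 0 _ < cc O 2 _; rw [c0, c2]; norm_num

/-- abstract transition data -/
structure Hol (n : ℕ) (G : Type*) [Group G] where
  h : Idx n → Idx n → (Fin 3 → ℂ) → G
  mul : ∀ {a b d u}, SS a u → SS b u → SS d u → h a b u * h b d u = h a d u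
  joined : ∀ {a b u v} (Q : (Fin 3 → ℂ) → Prop), SI Q → (∀ u, Q u → SS a u ∧ SS b u) →
    JoinedIn {u | Q u} u v → h a b u = h a b v
  b1 : ∀ O, h (Sum.inl 2) (Sum.inr O) (S1 O) = 1
  b2 : h (Sum.inl 2) (Sum.inl 0) (S2 ((0, 0) : ZMod n × ZMod n)) = 1
  b3 : h (Sum.inl 2) (Sum.inl 1) (S1 ((0, 0) : ZMod n × ZMod n)) = 1

variable {G : Type*} [Group G] (H : Hol n G)
namespace Hol

lemma self {a : Idx n} {u : Fin 3 → ℂ} (h : SS a u) : H.h a a u = 1 := by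
  have := H.mul h h h
  simpa using this

lemma inv {a b : Idx n} {u : Fin 3 → ℂ} (h : SS a u) (h' : SS b u) : (H.h a b u)⁻¹ = H.h b a u := by
  rw [inv_eq_iff_mul_eq_one, H.mul h h' h, H.self h]

lemma SI_VL (O : ZMod n × ZMod n) (k : Fin 3) (σ : ℝ) : SI (VL O k σ) := by
  intro c hc u
  unfold VL
  rw [VV_smul hc, cc_smul hc, cc_smul hc]

lemma VL_UC (hn : 1 ≤ n) {O : ZMod n × ZMod n} {k : Fin 3} {σ : ℝ} {u : Fin 3 → ℂ} (h : VL O k σ u) :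
    UC n k u := by
  rw [UC_cc hn h.1]
  intro he
  have := h.2
  rw [he] at this; simp at this

def sgn (k : Fin 3) (σ x y : ℝ) : Prop := ∀ p q : ℝ, 0 < p → 0 < q → 0 < σ * Lk k ⟨p, x⟩ ⟨q, y⟩

lemma jV (hn : 1 ≤ n) {O : ZMod n × ZMod n} {k : Fin 3} {σ x y : ℝ} {u : Fin 3 → ℂ}
    (h : VL O k σ u) (hs : sgn k σ x y) :
    H.h (Sum.inl k) (Sum.inr O) u = H.h (Sum.inl k) (Sum.inr O) (pp O x y) :=
  H.joined (VL O k σ) (SI_VL O k σ) (fun _ h => ⟨VL_UC hn h, h.1⟩) (VL_joined hn h hs)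

lemma VL_of (hn : 1 ≤ n) (O : ZMod n × ZMod n) {k : Fin 3} {σ x y : ℝ} (hs : sgn k σ x y) :
    VL O k σ (pp O x y) := by
  have hT : TT (1 + x * I) (1 + y * I) := by unfold TT; simp
  refine ⟨VV_pp hn O x y, ?_⟩
  have := hs 1 1 one_pos one_pos
  unfold pp
  rw [cc_Ph hn O hT, cc_Ph hn O hT]
  have e1 : (1 + x * I : ℂ) = ⟨1, x⟩ := by apply Complex.ext <;> simp
  have e2 : (1 + y * I : ℂ) = ⟨1, y⟩ := by apply Complex.ext <;> simp
  rw [e1, e2]; exact this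

lemma jS (hn : 1 ≤ n) (O : ZMod n × ZMod n) {k : Fin 3} {σ x y x' y' : ℝ}
    (h : sgn k σ x y) (hs : sgn k σ x' y') :
    H.h (Sum.inl k) (Sum.inr O) (pp O x y) = H.h (Sum.inl k) (Sum.inr O) (pp O x' y') :=
  H.jV hn (VL_of hn O h) hs

lemma sgn0 (σ x y : ℝ) (h : ∀ p q : ℝ, 0 < p → 0 < q → 0 < σ * (-x - (x * q - p * y))) : sgn 0 σ x y := by
  intro p q hp hq
  have := cc_vals ⟨p, x⟩ ⟨q, y⟩
  change 0 < σ * (jj 1 _ - jj 2 _)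
  rw [this.2.1, this.2.2]; exact h p q hp hq
lemma sgn1 (σ x y : ℝ) (h : ∀ p q : ℝ, 0 < p → 0 < q → 0 < σ * ((x * q - p * y) - y)) : sgn 1 σ x y := by
  intro p q hp hq
  have := cc_vals ⟨p, x⟩ ⟨q, y⟩
  change 0 < σ * (jj 2 _ - jj 0 _)
  rw [this.1, this.2.2]; exact h p q hp hq
lemma sgn2 (σ x y : ℝ) (h : 0 < σ * (y + x)) : sgn 2 σ x y := by
  intro p q hp hq
  have := cc_vals ⟨p, x⟩ ⟨q, y⟩
  change 0 < σ * (jj 0 _ - jj 1 _)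
  rw [this.1, this.2.1]; simpa using h

lemma s01 : sgn 0 1 0 1 := sgn0 _ _ _ fun p q hp hq => by linarith
lemma s02 : sgn 0 1 (-1) 0 := sgn0 _ _ _ fun p q hp hq => by linarith
lemma s03 : sgn 0 (-1) 0 (-1) := sgn0 _ _ _ fun p q hp hq => by linarith
lemma s04 : sgn 0 (-1) 1 0 := sgn0 _ _ _ fun p q hp hq => by linarith
lemma s11 : sgn 1 (-1) 0 1 := sgn1 _ _ _ fun p q hp hq => by linarith
lemma s12 : sgn 1 (-1) (-1) 0 := sgn1 _ _ _ fun p q hp hq => by linarith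
lemma s13 : sgn 1 1 0 (-1) := sgn1 _ _ _ fun p q hp hq => by linarith
lemma s14 : sgn 1 1 1 0 := sgn1 _ _ _ fun p q hp hq => by linarith
lemma s21 : sgn 2 1 0 1 := sgn2 _ _ _ (by norm_num)
lemma s24 : sgn 2 1 1 0 := sgn2 _ _ _ (by norm_num)
lemma s22 : sgn 2 (-1) (-1) 0 := sgn2 _ _ _ (by norm_num)
lemma s23 : sgn 2 (-1) 0 (-1) := sgn2 _ _ _ (by norm_num)

def E (O : ZMod n × ZMod n) : G := H.h (Sum.inl 2) (Sum.inr O) (S2 O)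
def xx (κ : ZMod n) : G := H.h (Sum.inl 2) (Sum.inl 0) (S2 (-κ, 0))
def yy (κ : ZMod n) : G := H.h (Sum.inl 2) (Sum.inl 1) (S1 (0, κ))

lemma h3O4 (hn : 1 ≤ n) (O : ZMod n × ZMod n) : H.h (Sum.inl 2) (Sum.inr O) (S4 O) = 1 := by
  rw [← H.b1 O]; exact H.jS hn O s24 s21
lemma h3O3 (hn : 1 ≤ n) (O : ZMod n × ZMod n) : H.h (Sum.inl 2) (Sum.inr O) (S3 O) = H.E O := H.jS hn O s23 s22

lemma jA (hn : 1 ≤ n) (m : Fin 3) {u v : Fin 3 → ℂ} (hu : AA n m u) (hv : AA n m v)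
    (h : ar n m u = ar n m v) (a b : Fin 3) (ha : a = m+1 ∧ b = m+2 ∨ a = m+2 ∧ b = m+1) :
    H.h (Sum.inl a) (Sum.inl b) u = H.h (Sum.inl a) (Sum.inl b) v := by
  refine H.joined (AA n m) (fun c hc u => AA_smul hc m u) (fun w hw => ?_) (AA_joined hn m hu hv h)
  have := (UC_inter (n := n)).2 (Or.inl hw)
  rcases ha with ⟨rfl, rfl⟩ | ⟨rfl, rfl⟩
  · exact this
  · exact this.symm

lemma jE (hn : 1 ≤ n) (m : Fin 3) {u v : Fin 3 → ℂ} (hu : EE n m u) (hv : EE n m v)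
    (h : ar n (m+1) u = ar n (m+1) v) (h' : ar n (m+2) u = ar n (m+2) v)
    (a b : Fin 3) (ha : a = m+1 ∧ b = m+2 ∨ a = m+2 ∧ b = m+1) :
    H.h (Sum.inl a) (Sum.inl b) u = H.h (Sum.inl a) (Sum.inl b) v := by
  refine H.joined (EE n m) (fun c hc u => EE_smul hc m u) (fun w hw => ?_) (EE_joined hn m hu hv h h')
  have := (UC_inter (n := n)).2 (Or.inr hw)
  rcases ha with ⟨rfl, rfl⟩ | ⟨rfl, rfl⟩
  · exact this
  · exact this.symm

lemma xx_eq (hn : 1 ≤ n) {u : Fin 3 → ℂ} (h : AA n 1 u) : H.h (Sum.inl 2) (Sum.inl 0) u = H.xx (ar n 1 u) :=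
  H.jA hn 1 h (S2_A hn _).1 (by rw [(S2_A hn _).2]; simp) 2 0 (Or.inl ⟨rfl, rfl⟩)

lemma yy_eq (hn : 1 ≤ n) {u : Fin 3 → ℂ} (h : AA n 0 u) : H.h (Sum.inl 2) (Sum.inl 1) u = H.yy (ar n 0 u) :=
  H.jA hn 0 h (S1_A hn _).1 (by rw [(S1_A hn _).2]) 2 1 (Or.inr ⟨rfl, rfl⟩)

lemma xx0 : H.xx 0 = 1 := by unfold xx; rw [neg_zero]; exact H.b2
lemma yy0 : H.yy 0 = 1 := H.b3

/-- going around through a V-cell -/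
lemma via {a b : Fin 3} {O : ZMod n × ZMod n} {u : Fin 3 → ℂ} (ha : UC n a u) (hb : UC n b u) (hO : VV O u) :
    H.h (Sum.inl a) (Sum.inl b) u = H.h (Sum.inl a) (Sum.inr O) u * (H.h (Sum.inl b) (Sum.inr O) u)⁻¹ := by
  rw [H.inv (a := Sum.inl b) (b := Sum.inr O) hb hO]
  exact (H.mul (a := Sum.inl a) (b := Sum.inr O) (d := Sum.inl b) ha hO hb).symm

lemma h1S1 (hn : 1 ≤ n) (O : ZMod n × ZMod n) : H.h (Sum.inl 2) (Sum.inl 0) (S1 O) = (H.E O)⁻¹ * H.xx (-O.1) := by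
  have e := H.xx_eq hn (S2_A hn O).1
  rw [(S2_A hn O).2, H.via (UC_S2 hn O 2) (UC_S2 hn O 0) (VV_pp hn O _ _)] at e
  rw [← e, H.via (UC_S1 hn O 2) (UC_S1 hn O 0) (VV_pp hn O _ _), H.b1, H.jS hn O s01 s02]
  unfold E; group

lemma h1S3 (hn : 1 ≤ n) (O : ZMod n × ZMod n) : H.h (Sum.inl 2) (Sum.inl 0) (S3 O) = H.E O * H.xx (-O.1 - 1) := by
  have e := H.xx_eq hn (S4_A hn O).1
  rw [(S4_A hn O).2, H.via (UC_S4 hn O 2) (UC_S4 hn O 0) (VV_pp hn O _ _), H.h3O4 hn] at e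
  rw [← e, H.via (UC_S3 hn O 2) (UC_S3 hn O 0) (VV_pp hn O _ _), H.h3O3 hn, H.jS hn O s03 s04]
  group

lemma h2S2 (hn : 1 ≤ n) (O : ZMod n × ZMod n) : H.h (Sum.inl 2) (Sum.inl 1) (S2 O) = H.E O * H.yy O.2 := by
  have e := H.yy_eq hn (S1_A hn O).1
  rw [(S1_A hn O).2, H.via (UC_S1 hn O 2) (UC_S1 hn O 1) (VV_pp hn O _ _), H.b1] at e
  rw [← e, H.via (UC_S2 hn O 2) (UC_S2 hn O 1) (VV_pp hn O _ _), H.jS hn O s12 s11]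
  unfold E; group

lemma h2S4 (hn : 1 ≤ n) (O : ZMod n × ZMod n) : H.h (Sum.inl 2) (Sum.inl 1) (S4 O) = (H.E O)⁻¹ * H.yy (O.2 - 1) := by
  have e := H.yy_eq hn (S3_B hn O).1
  rw [(S3_B hn O).2, H.via (UC_S3 hn O 2) (UC_S3 hn O 1) (VV_pp hn O _ _), H.h3O3 hn] at e
  rw [← e, H.via (UC_S4 hn O 2) (UC_S4 hn O 1) (VV_pp hn O _ _), H.h3O4 hn, H.jS hn O s14 s13]
  group

lemma Rx (hn : 1 ≤ n) (i j : ZMod n) : H.xx (-i) = H.E (i, j) * H.E (i, j+1) * H.xx (-i - 1) := by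
  have e := H.jE hn 1 (S1_E hn (i, j)).1 (S3_E hn (i, j+1)).1
    (by have h1 := (S1_E hn (i, j)).2.2
        have h2 := (S3_E hn (i, j+1)).2.2
        change ar n 2 _ = ar n 2 _
        rw [h1, h2]; ring)
    (by have h1 := (S1_E hn (i, j)).2.1
        have h2 := (S3_E hn (i, j+1)).2.1
        change ar n 0 _ = ar n 0 _
        rw [h1, h2]; ring) 2 0 (Or.inl ⟨rfl, rfl⟩)
  rw [H.h1S1 hn, H.h1S3 hn, inv_mul_eq_iff_eq_mul] at e
  simpa [mul_assoc] using e

lemma Ry (hn : 1 ≤ n) (i j : ZMod n) : H.yy (j - 1) = H.E (i - 1, j) * H.E (i, j) * H.yy j := by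
  have e := H.jE hn 0 (S4_E hn (i - 1, j)).1 (S2_E hn (i, j)).1
    (by have h1 := (S4_E hn (i - 1, j)).2.1
        have h2 := (S2_E hn (i, j)).2.1
        change ar n 1 _ = ar n 1 _
        rw [h1, h2]; ring)
    (by have h1 := (S4_E hn (i - 1, j)).2.2
        have h2 := (S2_E hn (i, j)).2.2
        change ar n 2 _ = ar n 2 _
        rw [h1, h2]; ring) 2 1 (Or.inr ⟨rfl, rfl⟩)
  rw [H.h2S2 hn, H.h2S4 hn, inv_mul_eq_iff_eq_mul] at e
  simpa [mul_assoc] using e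

lemma rel2 (hn : 1 ≤ n) (i j : ZMod n) : H.E (i, j+2) = (H.E (i, j+1))⁻¹ * H.E (i, j) * H.E (i, j+1) := by
  have h1 := H.Rx hn i j
  rw [H.Rx hn i (j+1), mul_left_inj, show j + 1 + 1 = j + 2 by ring] at h1
  rw [mul_assoc, ← h1]; group

lemma rel1 (hn : 1 ≤ n) (i j : ZMod n) : H.E (i+2, j) = (H.E (i+1, j))⁻¹ * H.E (i, j) * H.E (i+1, j) := by
  have h1 := H.Ry hn (i+1) j
  rw [H.Ry hn (i+2) j, mul_left_inj, show i + 2 - 1 = i + 1 by ring, show i + 1 - 1 = i by ring] at h1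
  rw [mul_assoc, ← h1]; group

lemma rel3 (hn : 1 ≤ n) :
    ((List.range n).map fun i : ℕ => H.E ((i : ZMod n), (i : ZMod n)) * H.E ((i : ZMod n), (i : ZMod n) + 1)).prod = 1 := by
  have key : ∀ k : ℕ, ((List.range k).map fun i : ℕ => H.E ((i : ZMod n), (i : ZMod n)) *
      H.E ((i : ZMod n), (i : ZMod n) + 1)).prod * H.xx (-(k : ZMod n)) = 1 := by
    intro k
    induction k with
    | zero => simpa using H.xx0
    | succ k ih =>
      rw [List.range_succ, List.map_append, List.prod_append]
      rw [H.Rx hn k k] at ih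
      rw [← ih]
      simp only [List.map_cons, List.map_nil, List.prod_cons, List.prod_nil, mul_one, mul_assoc,
        Nat.cast_succ, neg_add, sub_eq_add_neg]
  have := key n
  simpa [H.xx0] using this

section gen

lemma gxx (K : Subgroup G) (hK : ∀ O, H.E O ∈ K) (hn : 1 ≤ n) (κ : ZMod n) : H.xx κ ∈ K := by
  have : NeZero n := ⟨by omega⟩
  have key : ∀ k : ℕ, H.xx (-(k : ZMod n)) ∈ K := by
    intro k
    induction k with
    | zero => simp [H.xx0]
    | succ k ih =>
      have e := H.Rx hn k 0
      rw [show -((k+1 : ℕ) : ZMod n) = -(k : ZMod n) - 1 by push_cast; ring]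
      rw [← inv_mul_eq_iff_eq_mul] at e
      rw [← e]
      exact K.mul_mem (K.inv_mem (K.mul_mem (hK _) (hK _))) ih
  have := key (-κ).val
  simpa using this

lemma gyy (K : Subgroup G) (hK : ∀ O, H.E O ∈ K) (hn : 1 ≤ n) (κ : ZMod n) : H.yy κ ∈ K := by
  have : NeZero n := ⟨by omega⟩
  have key : ∀ k : ℕ, H.yy (-(k : ZMod n)) ∈ K := by
    intro k
    induction k with
    | zero => simp [H.yy0]
    | succ k ih =>
      have e := H.Ry hn 0 (-(k : ZMod n))
      rw [show -((k+1 : ℕ) : ZMod n) = -(k : ZMod n) - 1 by push_cast; ring, e]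
      exact K.mul_mem (K.mul_mem (hK _) (hK _)) ih
  have := key (-κ).val
  simpa using this

lemma g31 (K : Subgroup G) (hK : ∀ O, H.E O ∈ K) (hn : 1 ≤ n) {u : Fin 3 → ℂ} (h2 : UC n 2 u) (h0 : UC n 0 u) :
    H.h (Sum.inl 2) (Sum.inl 0) u ∈ K := by
  rcases AA_or_EE (m := 1) h2 h0 rfl rfl with h | h
  · rw [H.xx_eq hn h]; exact H.gxx K hK hn _
  · set j := ar n 0 u with hj
    set i := ar n 2 u + j + 1 with hi
    have e := H.jE hn 1 h (S1_E hn (i, j)).1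
      (by have h1 := (S1_E hn (i, j)).2.2
          change ar n 2 _ = ar n 2 _
          rw [h1, hi]; ring)
      (by have h1 := (S1_E hn (i, j)).2.1
          change ar n 0 _ = ar n 0 _
          rw [h1]) 2 0 (Or.inl ⟨rfl, rfl⟩)
    rw [e, H.h1S1 hn]
    exact K.mul_mem (K.inv_mem (hK _)) (H.gxx K hK hn _)

lemma g32 (K : Subgroup G) (hK : ∀ O, H.E O ∈ K) (hn : 1 ≤ n) {u : Fin 3 → ℂ} (h2 : UC n 2 u) (h1 : UC n 1 u) :
    H.h (Sum.inl 2) (Sum.inl 1) u ∈ K := by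
  rcases AA_or_EE (m := 0) h1 h2 rfl rfl with h | h
  · rw [H.yy_eq hn h]; exact H.gyy K hK hn _
  · set i := -ar n 1 u with hi
    set j := i - ar n 2 u - 1 with hj
    have e := H.jE hn 0 h (S2_E hn (i, j)).1
      (by have h1 := (S2_E hn (i, j)).2.1
          change ar n 1 _ = ar n 1 _
          rw [h1, hi]; ring)
      (by have h1 := (S2_E hn (i, j)).2.2
          change ar n 2 _ = ar n 2 _
          rw [h1, hj]; ring) 2 1 (Or.inr ⟨rfl, rfl⟩)
    rw [e, H.h2S2 hn]
    exact K.mul_mem (hK _) (H.gyy K hK hn _)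

lemma g12' (K : Subgroup G) (hK : ∀ O, H.E O ∈ K) (hn : 1 ≤ n) {u : Fin 3 → ℂ} (h2 : UC n 2 u) (h0 : UC n 0 u) (h1 : UC n 1 u) :
    H.h (Sum.inl 0) (Sum.inl 1) u ∈ K := by
  have := H.mul (a := Sum.inl 2) (b := Sum.inl 0) (d := Sum.inl 1) h2 h0 h1
  rw [← inv_mul_eq_iff_eq_mul.2 this.symm]
  exact K.mul_mem (K.inv_mem (H.g31 K hK hn h2 h0)) (H.g32 K hK hn h2 h1)

lemma g12 (K : Subgroup G) (hK : ∀ O, H.E O ∈ K) (hn : 1 ≤ n) {u : Fin 3 → ℂ} (h0 : UC n 0 u) (h1 : UC n 1 u) :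
    H.h (Sum.inl 0) (Sum.inl 1) u ∈ K := by
  rcases AA_or_EE (m := 2) h0 h1 rfl rfl with h | h
  · have e := H.jA hn 2 h (S3_A hn (ar n 2 u, 0)).1 (by rw [(S3_A hn _).2]; simp) 0 1 (Or.inl ⟨rfl, rfl⟩)
    rw [e]
    exact H.g12' K hK hn (UC_S3 hn _ _) (UC_S3 hn _ _) (UC_S3 hn _ _)
  · exact H.g12' K hK hn (EE_UC h) h0 h1

lemma gS (K : Subgroup G) (hK : ∀ O, H.E O ∈ K) (hn : 1 ≤ n) (O : ZMod n × ZMod n) (k : Fin 3) {u : Fin 3 → ℂ} (h2 : UC n 2 u) (hk : UC n k u)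
    (hO : VV O u) (h : H.h (Sum.inl 2) (Sum.inr O) u ∈ K) : H.h (Sum.inl k) (Sum.inr O) u ∈ K := by
  have := H.mul (a := Sum.inl 2) (b := Sum.inl k) (d := Sum.inr O) h2 hk hO
  rw [← inv_mul_eq_iff_eq_mul.2 this.symm]
  refine K.mul_mem (K.inv_mem ?_) h
  fin_cases k
  · exact H.g31 K hK hn h2 hk
  · exact H.g32 K hK hn h2 hk
  · exact (H.self (a := Sum.inl 2) h2) ▸ K.one_mem

lemma gO (K : Subgroup G) (hK : ∀ O, H.E O ∈ K) (hn : 1 ≤ n) {O : ZMod n × ZMod n} {k : Fin 3} {u : Fin 3 → ℂ} (hk : UC n k u) (hO : VV O u) :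
    H.h (Sum.inl k) (Sum.inr O) u ∈ K := by
  have t1 := H.gS K hK hn O k (UC_S1 hn O 2) (UC_S1 hn O k) (VV_pp hn O _ _) (by rw [H.b1]; exact K.one_mem)
  have t2 := H.gS K hK hn O k (UC_S2 hn O 2) (UC_S2 hn O k) (VV_pp hn O _ _) (hK O)
  have t3 := H.gS K hK hn O k (UC_S3 hn O 2) (UC_S3 hn O k) (VV_pp hn O _ _) (by rw [H.h3O3 hn]; exact hK O)
  have hs := (UC_cc hn hO k).1 hk
  rcases lt_or_gt_of_ne hs with hs | hs
  · have hV : VL O k (-1) u := ⟨hO, by linarith⟩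
    fin_cases k
    · exact (H.jV hn hV s03) ▸ t3
    · exact (H.jV hn hV s11) ▸ t1
    · exact (H.jV hn hV s22) ▸ t2
  · have hV : VL O k 1 u := ⟨hO, by linarith⟩
    fin_cases k
    · exact (H.jV hn hV s01) ▸ t1
    · exact (H.jV hn hV s13) ▸ t3
    · exact (H.jV hn hV s21) ▸ t1

lemma gen (K : Subgroup G) (hK : ∀ O, H.E O ∈ K) (hn : 1 ≤ n) (a b : Idx n) {u : Fin 3 → ℂ} (ha : SS a u) (hb : SS b u) : H.h a b u ∈ K := by
  have sw : H.h b a u ∈ K → H.h a b u ∈ K := fun h => by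
    rw [← H.inv hb ha]; exact K.inv_mem h
  rcases a with k | O <;> rcases b with l | O'
  · fin_cases k <;> fin_cases l
    · exact (H.self ha) ▸ K.one_mem
    · exact H.g12 K hK hn ha hb
    · exact sw (H.g31 K hK hn hb ha)
    · exact sw (H.g12 K hK hn hb ha)
    · exact (H.self ha) ▸ K.one_mem
    · exact sw (H.g32 K hK hn hb ha)
    · exact H.g31 K hK hn ha hb
    · exact H.g32 K hK hn ha hb
    · exact (H.self ha) ▸ K.one_mem
  · exact H.gO K hK hn ha hb
  · exact sw (H.gO K hK hn hb ha)
  · obtain rfl := VV_disj hn (O := O) (O' := O') ha hb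
    exact (H.self ha) ▸ K.one_mem

end gen
end Hol

end CN
end

end

section

open Topology Set
noncomputable section
namespace CN

open ComplexConjugate
open Complex (I)
open scoped Real

variable {n : ℕ} {X : Type*} [TopologicalSpace X] (M : Mdl n X)

/-- lifts of the base points -/
def ub : Idx n → (Fin 3 → ℂ)
  | Sum.inl 0 => S2 ((0, 0) : ZMod n × ZMod n)
  | Sum.inl 1 => S1 ((0, 0) : ZMod n × ZMod n)
  | Sum.inl 2 => S1 ((0, 0) : ZMod n × ZMod n)
  | Sum.inr O => S1 O

lemma ub1 (hn : 1 ≤ n) (a : Idx n) : SS a (ub a) := by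
  rcases a with k | O
  · fin_cases k
    · exact UC_S2 hn _ _
    · exact UC_S1 hn _ _
    · exact UC_S1 hn _ _
  · exact VV_pp hn _ _ _

lemma ub2 (hn : 1 ≤ n) (a : Idx n) : SS (Sum.inl 2 : Idx n) (ub a) := by
  rcases a with k | O
  · fin_cases k
    · exact UC_S2 hn _ _
    · exact UC_S1 hn _ _
    · exact UC_S1 hn _ _
  · exact UC_S1 hn _ _

lemma mem_UU (hn : 1 ≤ n) {a : Idx n} {u : Fin 3 → ℂ} (h : SS a u) : M.pr u ∈ UU M a :=
  (mem_pr M (SI_SS a) (SS_GG hn h)).2 h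

def xb (a : Idx n) : X := M.pr (ub a)

lemma xb1 (hn : 1 ≤ n) (a : Idx n) : xb M a ∈ UU M a := mem_UU M hn (ub1 hn a)
lemma xb2 (hn : 1 ≤ n) (a : Idx n) : xb M a ∈ UU M (Sum.inl 2) := mem_UU M hn (ub2 hn a)

def hx (hn : 1 ≤ n) (a b : Idx n) (p : X) : FundamentalGroup X (xb M (Sum.inl 2)) :=
  VK.hh (UU_simply M hn) (Sum.inl 2) (xb M) (xb1 M hn) (xb2 M hn) a b p

def mkHol (hn : 1 ≤ n) : Hol n (FundamentalGroup X (xb M (Sum.inl 2))) where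
  h a b u := hx M hn a b (M.pr u)
  mul ha hb hd := VK.hh_mul _ _ _ _ _ (mem_UU M hn ha) (mem_UU M hn hb) (mem_UU M hn hd)
  joined Q hQ hS hj := by
    refine VK.hh_joined _ _ _ _ _ ((joined_pr M hQ (fun u hu => SS_GG hn (hS u hu).1) hj).mono ?_)
    intro x hx
    exact hS _ hx
  b1 O := VK.hh_base (UU_simply M hn) (Sum.inl 2) (xb M) (xb1 M hn) (xb2 M hn) (Sum.inr O)
  b2 := VK.hh_base (UU_simply M hn) (Sum.inl 2) (xb M) (xb1 M hn) (xb2 M hn) (Sum.inl 0)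
  b3 := VK.hh_base (UU_simply M hn) (Sum.inl 2) (xb M) (xb1 M hn) (xb2 M hn) (Sum.inl 1)

variable {Γ : Type*} [Group Γ]

lemma gg_pr (A : Alg n Γ) (a b : Idx n) {u : Fin 3 → ℂ} (h : GG n u ≠ 0) :
    gg A a b (M.rp (M.pr u)) = gg A a b u := by
  obtain ⟨c, hc, e⟩ := M.rp_pr u h
  rw [e, gg_smul A hc]

lemma main_model (hn : 1 ≤ n) (e : ZMod n → ZMod n → Γ)
    (h1 : ∀ i j, e (i+2) j = (e (i+1) j)⁻¹ * e i j * e (i+1) j)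
    (h2 : ∀ i j, e i (j+2) = (e i (j+1))⁻¹ * e i j * e i (j+1))
    (h3 : ((List.range n).map fun i : ℕ => e i i * e i (i+1)).prod = 1)
    (hgen : Subgroup.closure (range fun O : ZMod n × ZMod n => e O.1 O.2) = ⊤)
    (huniv : ∀ E : ZMod n → ZMod n → FundamentalGroup X (xb M (Sum.inl 2)),
      (∀ i j, E (i+2) j = (E (i+1) j)⁻¹ * E i j * E (i+1) j) →
      (∀ i j, E i (j+2) = (E i (j+1))⁻¹ * E i j * E i (j+1)) →
      ((List.range n).map fun i : ℕ => E i i * E i (i+1)).prod = 1 →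
      ∃ φ : Γ →* FundamentalGroup X (xb M (Sum.inl 2)), ∀ i j, φ (e i j) = E i j) :
    Nonempty (FundamentalGroup X (xb M (Sum.inl 2)) ≃* Γ) := by
  have : NeZero n := ⟨by omega⟩
  obtain ⟨A, hA⟩ := mkAlg e h1 h2 h3
  set H := mkHol M hn with hH
  obtain ⟨φ, hφ⟩ := huniv (fun i j => H.E (i, j)) (H.rel1 hn) (H.rel2 hn) (H.rel3 hn)
  have hbij : Function.Bijective φ := by
    refine VK.main (UU_simply M hn) (Sum.inl 2) (xb M) (xb1 M hn) (xb2 M hn) (isOpen_UU M hn)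
      (UU_cover M hn) (fun a b p => gg A a b (M.rp p)) ?_ ?_ ?_ φ _ hgen ?_ ?_
    · intro a b p ha hb
      have := gg_near hn A ha hb
      exact ev_rp M (Q := fun v => gg A a b v = gg A a b (M.rp p))
        (fun c hc u => by simp only [gg_smul A hc]) this
    · intro a b d p ha hb hd
      exact gg_co hn A ha hb hd
    · intro a
      unfold xb
      simp only [gg_pr M A _ _ (SS_GG hn (ub1 hn a))]
      rcases a with k | O
      · fin_cases k
        · change (f31 A (S2 ((0, 0) : ZMod n × ZMod n)))⁻¹ = 1
          unfold f31
          rw [if_pos (S2_A hn _).1, (S2_A hn _).2]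
          simp [A.X1]
        · change (f32 A (S1 ((0, 0) : ZMod n × ZMod n)))⁻¹ = 1
          unfold f32
          rw [if_pos (S1_A hn _).1, (S1_A hn _).2]
          simp [A.Y0]
        · rfl
      · change (f3O A O (S1 O))⁻¹ = 1
        obtain ⟨-, c0, c1, -⟩ := pp_facts hn O 0 1
        unfold f3O
        rw [if_pos (by rw [c0, c1]; norm_num), inv_one]
    · rintro _ ⟨O, rfl⟩
      refine ⟨Sum.inl 2, Sum.inr O, M.pr (S2 O), mem_UU M hn (UC_S2 hn _ _),
        mem_UU M hn (VV_pp hn _ _ _), hφ _ _, ?_⟩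
      simp only [gg_pr M A _ _ (GG_VV hn (VV_pp hn O (-1) 0))]
      change f3O A O (S2 O) = _
      obtain ⟨-, c0, c1, -⟩ := pp_facts hn O (-1) 0
      unfold f3O
      rw [if_neg (by rw [c0, c1]; norm_num), hA]
    · intro a b p ha hb
      have := H.gen φ.range (fun O => ⟨e O.1 O.2, hφ _ _⟩) hn a b ha hb
      have h' : H.h a b (M.rp p) = hx M hn a b p := by
        change hx M hn a b (M.pr (M.rp p)) = _
        rw [M.pr_rp]
      rw [h'] at this
      exact this
  exact ⟨(MulEquiv.ofBijective φ hbij).symm⟩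

lemma pathConn (M : Mdl n X) (hn : 1 ≤ n) : PathConnectedSpace X := by
  have key : ∀ x, Joined x (xb M (Sum.inl 2)) := by
    intro x
    obtain ⟨a, ha⟩ := UU_cover M hn x
    have p1 := (UU_simply M hn a).isPathConnected
    have p2 := (UU_simply M hn (Sum.inl 2)).isPathConnected
    exact (p1.joinedIn _ ha _ (xb1 M hn a)).joined.trans
      (p2.joinedIn _ (xb2 M hn a) _ (xb2 M hn _)).joined
  exact ⟨⟨xb M (Sum.inl 2)⟩, fun x y => (key x).trans (key y).symm⟩

lemma main_model' (M : Mdl n X) (hn : 1 ≤ n) (x : X) (e : ZMod n → ZMod n → Γ)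
    (h1 : ∀ i j, e (i+2) j = (e (i+1) j)⁻¹ * e i j * e (i+1) j)
    (h2 : ∀ i j, e i (j+2) = (e i (j+1))⁻¹ * e i j * e i (j+1))
    (h3 : ((List.range n).map fun i : ℕ => e i i * e i (i+1)).prod = 1)
    (hgen : Subgroup.closure (range fun O : ZMod n × ZMod n => e O.1 O.2) = ⊤)
    (huniv : ∀ x : X, ∀ E : ZMod n → ZMod n → FundamentalGroup X x,
      (∀ i j, E (i+2) j = (E (i+1) j)⁻¹ * E i j * E (i+1) j) →
      (∀ i j, E i (j+2) = (E i (j+1))⁻¹ * E i j * E i (j+1)) →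
      ((List.range n).map fun i : ℕ => E i i * E i (i+1)).prod = 1 →
      ∃ φ : Γ →* FundamentalGroup X x, ∀ i j, φ (e i j) = E i j) :
    Nonempty (FundamentalGroup X x ≃* Γ) := by
  have := pathConn M hn
  obtain ⟨f⟩ := main_model M hn e h1 h2 h3 hgen (huniv _)
  exact ⟨(FundamentalGroup.fundamentalGroupMulEquivOfPathConnected x (xb M (Sum.inl 2))).trans f⟩

end CN
end

end

section
open Topology Set
noncomputable section
namespace CN

variable {n : ℕ}

abbrev PP := Projectivization ℂ (Fin 3 → ℂ)

abbrev NZ := {v : Fin 3 → ℂ // v ≠ 0}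

def qq (w : NZ) : PP := Projectivization.mk ℂ w.1 w.2

lemma qq_cont : Continuous qq := continuous_quotient_mk'

lemma qq_open : IsOpenMap qq := by
  intro B hB
  have hq : IsOpen (qq ⁻¹' (qq '' B)) := by
    have he : qq ⁻¹' (qq '' B) = ⋃ a : ℂˣ, (fun w : NZ => (⟨(a : ℂ) • w.1, smul_ne_zero a.ne_zero w.2⟩ : NZ)) ⁻¹' B := by
      ext w
      simp only [mem_preimage, mem_image, mem_iUnion]
      constructor
      · rintro ⟨b, hb, e⟩
        obtain ⟨a, ha⟩ := (Projectivization.mk_eq_mk_iff ℂ _ _ b.2 w.2).1 e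
        refine ⟨a, ?_⟩
        have : (⟨(a : ℂ) • w.1, smul_ne_zero a.ne_zero w.2⟩ : NZ) = b := Subtype.ext ha
        rw [this]; exact hb
      · rintro ⟨a, ha⟩
        exact ⟨_, ha, (Projectivization.mk_eq_mk_iff ℂ _ _ _ w.2).2 ⟨a, rfl⟩⟩
    rw [he]
    refine isOpen_iUnion fun a => hB.preimage ?_
    exact Continuous.subtype_mk (by fun_prop) _
  exact hq

def kap (n : ℕ) : ℂ := Complex.exp (Real.pi * Complex.I / n)

lemma kap_pow (hn : 1 ≤ n) : kap n ^ n = -1 := by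
  have : (n : ℂ) ≠ 0 := by exact_mod_cast (by omega : n ≠ 0)
  unfold kap
  rw [← Complex.exp_nat_mul, mul_div_cancel₀ _ this, Complex.exp_pi_mul_I]

def dd (n : ℕ) : Fin 3 → ℂ := ![1, 1, kap n]

lemma dd_ne (n : ℕ) (i : Fin 3) : dd n i ≠ 0 := by
  fin_cases i
  · simp [dd]
  · simp [dd]
  · exact Complex.exp_ne_zero _

def tw (n : ℕ) (u : Fin 3 → ℂ) : Fin 3 → ℂ := fun i => dd n i * u i
def ut (n : ℕ) (u : Fin 3 → ℂ) : Fin 3 → ℂ := fun i => (dd n i)⁻¹ * u i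

lemma tw_ut (u : Fin 3 → ℂ) : tw n (ut n u) = u := by
  funext i; simp only [tw, ut]; rw [mul_inv_cancel_left₀ (dd_ne n i)]
lemma ut_tw (u : Fin 3 → ℂ) : ut n (tw n u) = u := by
  funext i; simp only [tw, ut]; rw [inv_mul_cancel_left₀ (dd_ne n i)]
lemma tw_smul (c : ℂ) (u : Fin 3 → ℂ) : tw n (c • u) = c • tw n u := by
  funext i; simp only [tw, Pi.smul_apply, smul_eq_mul]; ring
lemma ut_smul (c : ℂ) (u : Fin 3 → ℂ) : ut n (c • u) = c • ut n u := by
  funext i; simp only [ut, Pi.smul_apply, smul_eq_mul]; ring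
lemma tw_cont : Continuous (tw n) := by unfold tw; fun_prop
lemma ut_cont : Continuous (ut n) := by unfold ut; fun_prop

lemma Fn_tw (hn : 1 ≤ n) (u : Fin 3 → ℂ) : MvPolynomial.eval (tw n u) (Fn n) = GG n u := by
  have h2 : (tw n u 2) ^ n = -(u 2) ^ n := by
    change (kap n * u 2) ^ n = _
    rw [mul_pow, kap_pow hn]; ring
  have h0 : tw n u 0 = u 0 := by simp [tw, dd]
  have h1 : tw n u 1 = u 1 := by simp [tw, dd]
  simp only [Fn, fPoly, map_add, map_mul, map_sub, map_pow, MvPolynomial.bind₁_X_right,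
    MvPolynomial.eval_X, map_ofNat, h0, h1, h2, GG, Pw]
  ring

lemma Fn_ut (hn : 1 ≤ n) (u : Fin 3 → ℂ) : MvPolynomial.eval u (Fn n) = GG n (ut n u) := by
  rw [← Fn_tw hn, tw_ut]

lemma tw_ne (hn : 1 ≤ n) {u : Fin 3 → ℂ} (h : GG n u ≠ 0) : tw n u ≠ 0 := by
  intro h0
  have : u = 0 := by rw [← ut_tw (n := n) u, h0]; funext i; simp [ut]
  apply h
  rw [this]
  simp [GG, Pw, show n ≠ 0 by omega]

lemma mem_curve (hn : 1 ≤ n) {u : Fin 3 → ℂ} (h0 : tw n u ≠ 0) (h : GG n u ≠ 0) :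
    Projectivization.mk ℂ (tw n u) h0 ∈ (curveCn n)ᶜ := by
  obtain ⟨a, ha⟩ := Projectivization.exists_smul_eq_mk_rep ℂ (tw n u) h0
  intro hm
  have hm : MvPolynomial.eval (Projectivization.mk ℂ (tw n u) h0).rep (Fn n) = 0 := hm
  have e : (a • tw n u) = tw n ((a : ℂ) • u) := (tw_smul _ _).symm
  rw [← ha, e, Fn_tw hn, GG_smul] at hm
  have : (a : ℂ) ≠ 0 := a.ne_zero
  have h3 : (((a : ℂ) ^ n) ^ 2) ≠ 0 := by positivity
  exact (mul_ne_zero h3 h) hm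

open Classical in
def prr (hn : 1 ≤ n) (x : ↥(curveCn n)ᶜ) (u : Fin 3 → ℂ) : ↥(curveCn n)ᶜ :=
  if h : GG n u ≠ 0 then ⟨Projectivization.mk ℂ (tw n u) (tw_ne hn h), mem_curve hn _ h⟩ else x

lemma prr_eq (hn : 1 ≤ n) (x : ↥(curveCn n)ᶜ) {u : Fin 3 → ℂ} (h : GG n u ≠ 0) :
    prr hn x u = ⟨Projectivization.mk ℂ (tw n u) (tw_ne hn h), mem_curve hn _ h⟩ := dif_pos h

lemma isOpen_GG : IsOpen {u : Fin 3 → ℂ | GG n u ≠ 0} := isOpen_ne_fun continuous_GG continuous_const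

lemma rep_GG (hn : 1 ≤ n) (y : ↥(curveCn n)ᶜ) : GG n (ut n y.1.rep) ≠ 0 := by
  rw [← Fn_ut hn]; exact y.2

def mdl (hn : 1 ≤ n) (x : ↥(curveCn n)ᶜ) : Mdl n ↥(curveCn n)ᶜ where
  pr := prr hn x
  rp y := ut n y.1.rep
  hGG y := rep_GG hn y
  pr_rp y := by
    rw [prr_eq hn x (rep_GG hn y)]
    apply Subtype.ext
    simp only [tw_ut, Projectivization.mk_rep]
  pr_cont u hu := by
    have : ContinuousOn (prr hn x) {u : Fin 3 → ℂ | GG n u ≠ 0} := by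
      rw [continuousOn_iff_continuous_domRestrict]
      have e : ({u : Fin 3 → ℂ | GG n u ≠ 0}).domRestrict (prr hn x) =
          fun w => ⟨qq ⟨tw n w.1, tw_ne hn w.2⟩, mem_curve hn _ w.2⟩ := by
        funext w; exact prr_eq hn x w.2
      rw [e]
      refine Continuous.subtype_mk (qq_cont.comp ?_) _
      exact Continuous.subtype_mk (tw_cont.comp continuous_subtype_val) _
    exact this.continuousAt (isOpen_GG.mem_nhds hu)
  pr_open u hu := by
    intro s hs
    rw [Filter.mem_map] at hs
    set w : NZ := ⟨tw n u, tw_ne hn hu⟩ with hw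
    have hc : ContinuousAt (fun w : NZ => ut n w.1) w := (ut_cont.comp continuous_subtype_val).continuousAt
    have hB : (fun w : NZ => ut n w.1) ⁻¹' (prr hn x ⁻¹' s ∩ {u : Fin 3 → ℂ | GG n u ≠ 0}) ∈ 𝓝 w := by
      apply hc
      change _ ∈ 𝓝 (ut n (tw n u))
      rw [ut_tw]
      exact Filter.inter_mem hs (isOpen_GG.mem_nhds hu)
    have ht := qq_open.image_mem_nhds hB
    rw [prr_eq hn x hu, nhds_subtype]
    refine ⟨_, ht, ?_⟩
    rintro y ⟨w', ⟨h1, h2⟩, e⟩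
    have h1 : prr hn x (ut n w'.1) ∈ s := h1
    rw [prr_eq hn x h2] at h1
    convert h1 using 1
    apply Subtype.ext
    rw [← e]
    simp only [tw_ut, qq]
  rp_pr u hu := by
    rw [prr_eq hn x hu]
    obtain ⟨a, ha⟩ := Projectivization.exists_smul_eq_mk_rep ℂ (tw n u) (tw_ne hn hu)
    refine ⟨a, a.ne_zero, ?_⟩
    simp only
    rw [← ha]
    change ut n ((a : ℂ) • tw n u) = _
    rw [ut_smul, ut_tw]
  pr_smul u hu c hc := by
    have h' : GG n (c • u) ≠ 0 := by
      rw [GG_smul]; exact mul_ne_zero (pow_ne_zero _ (pow_ne_zero _ hc)) hu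
    rw [prr_eq hn x hu, prr_eq hn x h']
    apply Subtype.ext
    simp only
    rw [Projectivization.mk_eq_mk_iff']
    exact ⟨c, (tw_smul c u).symm⟩

lemma lst (k : ℕ) : (do let a ← List.range k; pure (a : ZMod n)) = (List.range k).map (fun a : ℕ => (a : ZMod n)) := by
  rw [bind_pure_comp]; rfl

lemma lift_prod {G : Type*} [Group G] (f : ZMod n × ZMod n → G) (k : ℕ) :
    FreeGroup.lift f ((List.range k).map (fun i =>
          FreeGroup.of ((i : ZMod n), (i : ZMod n)) *
          FreeGroup.of ((i : ZMod n), (i : ZMod n) + 1))).prod =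
      ((List.range k).map fun i : ℕ => f (i, i) * f (i, i+1)).prod := by
  rw [lst, map_list_prod, List.map_map, List.map_map]
  congr 1
  apply List.map_congr_left
  intro i _
  simp

lemma final (hn : 1 ≤ n) (x : ↥(curveCn n)ᶜ) :
    Nonempty (FundamentalGroup (↥(curveCn n)ᶜ) x ≃* PresentedGroup (relsCn n)) := by
  refine main_model' (mdl hn x) hn x (fun i j => PresentedGroup.of (i, j)) ?_ ?_ ?_ ?_ ?_
  · intro i j
    exact PresentedGroup.mk_eq_mk_of_mul_inv_mem (Or.inl ⟨i, j, rfl⟩)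
  · intro i j
    exact PresentedGroup.mk_eq_mk_of_mul_inv_mem (Or.inr (Or.inl ⟨i, j, rfl⟩))
  · have h := PresentedGroup.one_of_mem (rels := relsCn n) (Or.inr (Or.inr rfl))
    rw [lst, map_list_prod, List.map_map, List.map_map] at h
    exact h
  · exact PresentedGroup.closure_range_of (relsCn n)
  · intro y E h1 h2 h3
    have hr : ∀ r ∈ relsCn n, FreeGroup.lift (fun O : ZMod n × ZMod n => E O.1 O.2) r = 1 := by
      rintro r (⟨i, j, rfl⟩ | ⟨i, j, rfl⟩ | rfl)
      · rw [map_mul, map_inv, mul_inv_eq_one]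
        simpa using h1 i j
      · rw [map_mul, map_inv, mul_inv_eq_one]
        simpa using h2 i j
      · rw [lift_prod]; exact h3
    exact ⟨PresentedGroup.toGroup hr, fun i j => PresentedGroup.toGroup.of hr⟩

end CN
end

end

/-- Theorem 1: for `n ≥ 1`, the fundamental group of `ℙ²(ℂ) ∖ C̃_n` (with respect to any base
point) is the group presented by generators `ε_{i,j}`, `i, j ∈ ℤ/nℤ` and the relations
`ε_{i+2,j} = ε_{i+1,j}⁻¹ ε_{i,j} ε_{i+1,j}`, `ε_{i,j+2} = ε_{i,j+1}⁻¹ ε_{i,j} ε_{i,j+1}`,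
`ε_{0,0} ε_{0,1} ε_{1,1} ε_{1,2} ⋯ ε_{n−1,n−1} ε_{n−1,0} = 1`. -/
theorem fundamental_group_complement_Cn (n : ℕ) (hn : 1 ≤ n)
    (x : ↥(curveCn n)ᶜ) :
    Nonempty (FundamentalGroup (↥(curveCn n)ᶜ) x ≃* PresentedGroup (relsCn n)) := by
  exact CN.final hn x

end
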